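/- Let V be a smoothly bounded strictly pseudoconvex domain in ℂ^n, let U ⊂ ℂ be open, and let φ be a smooth strictly plurisubharmonic function on a neighbourhood of the closure of U × V. Fix z ∈ V and let K_t(·,z) be the Bergman kernel of V with weight φ^t = φ(t,·). Then t ↦ K_t(z,z) is a subharmonic function of t on U; indeed ∂²K_t(z,z)/∂t∂t̄ ≥ ∫_V |K_t(·,z)|² D e^{-φ^t} dλ, where D = φ_{tt̄} − Σ_{j,k} (φ_{z_j z̄_k})^{-1}_{jk} φ_{t z̄_j} conj(φ_{t z̄_k}) ≥ 0 is the determinant of the full complex Hessian of φ divided by the determinant of the complex Hessian of φ^t. -/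

import Mathlib

open MeasureTheory Filter Set Metric Complex
open scoped ENNReal NNReal Topology

noncomputable section

namespace Berndtsson

instance (n : ℕ) : MeasurableSpace (EuclideanSpace ℂ (Fin n)) := borel _
instance (n : ℕ) : BorelSpace (EuclideanSpace ℂ (Fin n)) := ⟨rfl⟩
instance (n : ℕ) : MeasureSpace (EuclideanSpace ℂ (Fin n)) :=
  ⟨Measure.map (EuclideanSpace.equiv (Fin n) ℂ).symm volume⟩

abbrev Cn (n : ℕ) := EuclideanSpace ℂ (Fin n)

/-- A function `f`, with values in `EReal`, is plurisubharmonic on `s` if it is upper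
semicontinuous on `s` and satisfies the sub-mean value inequality on every complex circle
whose corresponding closed disk is contained in `s` (formulated via continuous majorants,
which for upper semicontinuous integrands is equivalent to the upper-integral form). -/
def PlurisubharmonicOn {E : Type*} [NormedAddCommGroup E] [NormedSpace ℂ E]
    (f : E → EReal) (s : Set E) : Prop :=
  UpperSemicontinuousOn f s ∧
    ∀ z ∈ s, ∀ w : E, ∀ r : ℝ, 0 < r →
      (∀ l : ℂ, ‖l‖ ≤ r → z + l • w ∈ s) →
      ∀ h : ℝ → ℝ, Continuous h →
        (∀ θ : ℝ, f (z + ((r : ℂ) * Complex.exp (θ * Complex.I)) • w) ≤ (h θ : EReal)) →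
        f z ≤ (((2 * Real.pi)⁻¹ * ∫ θ in (0:ℝ)..(2 * Real.pi), h θ : ℝ) : EReal)

/-- Plurisubharmonicity for real-valued functions. -/
def PshOn {E : Type*} [NormedAddCommGroup E] [NormedSpace ℂ E] (f : E → ℝ) (s : Set E) : Prop :=
  PlurisubharmonicOn (fun z => (f z : EReal)) s

/-- A pseudoconvex domain: an open set admitting a plurisubharmonic exhaustion function. -/
def Pseudoconvex {E : Type*} [NormedAddCommGroup E] [NormedSpace ℂ E] (D : Set E) : Prop :=
  IsOpen D ∧ ∃ u : E → ℝ, PshOn u D ∧ ∀ c : ℝ, IsCompact {z ∈ D | u z ≤ c}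

/-- `log` with values in `EReal`, sending nonpositive reals to `⊥`. -/
def elog (x : ℝ) : EReal := if 0 < x then ((Real.log x : ℝ) : EReal) else ⊥

/-- Membership in the weighted Bergman space `A²(Ω, e^{-φ})`. -/
def MemA2 {n : ℕ} (Ω : Set (Cn n)) (φ : Cn n → ℝ) (h : Cn n → ℂ) : Prop :=
  DifferentiableOn ℂ h Ω ∧
    IntegrableOn (fun ζ => ‖h ζ‖ ^ 2 * Real.exp (-φ ζ)) Ω volume

/-- `Kz` is the Bergman kernel of `A²(Ω, e^{-φ})` at the point `z`:
it belongs to the space and reproduces the value at `z` of every member. -/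
def IsBergmanKernelAt {n : ℕ} (Ω : Set (Cn n)) (φ : Cn n → ℝ) (z : Cn n)
    (Kz : Cn n → ℂ) : Prop :=
  MemA2 Ω φ Kz ∧
    ∀ h : Cn n → ℂ, MemA2 Ω φ h →
      ∫ ζ in Ω, h ζ * (starRingEnd ℂ) (Kz ζ) * (Real.exp (-φ ζ) : ℂ) = h z

/-- The Bergman kernel on the diagonal, via its extremal characterization
`K(z,z) = sup {|h(z)|² : h holomorphic on Ω, ∫_Ω |h|² e^{-φ} ≤ 1}`. -/
def bergmanDiag {n : ℕ} (Ω : Set (Cn n)) (φ : Cn n → ℝ) (z : Cn n) : ℝ :=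
  sSup {v : ℝ | ∃ h : Cn n → ℂ, DifferentiableOn ℂ h Ω ∧
    IntegrableOn (fun ζ => ‖h ζ‖ ^ 2 * Real.exp (-φ ζ)) Ω volume ∧
    (∫ ζ in Ω, ‖h ζ‖ ^ 2 * Real.exp (-φ ζ)) ≤ 1 ∧ v = ‖h z‖ ^ 2}

end Berndtsson

namespace Berndtsson

/-- Strict plurisubharmonicity of a (C²) function: positivity of the Levi form, expressed by
`4 ∂∂̄f(z)(w,w̄) = D²f(z)(w,w) + D²f(z)(iw,iw) > 0` for all `w ≠ 0`. -/
def StrictPlurisubharmonicOn {E : Type*} [NormedAddCommGroup E] [NormedSpace ℂ E]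
    (f : E → ℝ) (s : Set E) : Prop :=
  ∀ z ∈ s, ∀ w : E, w ≠ 0 →
    0 < iteratedFDeriv ℝ 2 f z ![w, w] +
        iteratedFDeriv ℝ 2 f z ![Complex.I • w, Complex.I • w]

/-- The Wirtinger derivative `∂f/∂w = (1/2)(D_w f - i D_{iw} f)` in the direction `w`. -/
def wirtingerD {F : Type*} [NormedAddCommGroup F] [NormedSpace ℂ F]
    (f : F → ℂ) (p w : F) : ℂ :=
  (1 / 2 : ℂ) * (fderiv ℝ f p w - Complex.I * fderiv ℝ f p (Complex.I • w))

/-- The conjugate Wirtinger derivative `∂f/∂w̄ = (1/2)(D_w f + i D_{iw} f)`. -/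
def wirtingerDbar {F : Type*} [NormedAddCommGroup F] [NormedSpace ℂ F]
    (f : F → ℂ) (p w : F) : ℂ :=
  (1 / 2 : ℂ) * (fderiv ℝ f p w + Complex.I * fderiv ℝ f p (Complex.I • w))

/-- The direction of the base variable `t` in `ℂ × ℂⁿ`. -/
def dirT (n : ℕ) : ℂ × Cn n := (1, 0)

/-- The direction of the fiber variable `z_j` in `ℂ × ℂⁿ`. -/
def dirZ (n : ℕ) (j : Fin n) : ℂ × Cn n := (0, EuclideanSpace.single j 1)

/-- `φ_{t t̄}`. -/
def hessTTbar (n : ℕ) (φ : ℂ × Cn n → ℝ) (p : ℂ × Cn n) : ℂ :=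
  wirtingerD (fun q => wirtingerDbar (fun x => (φ x : ℂ)) q (dirT n)) p (dirT n)

/-- `φ_{t z̄_j}`. -/
def hessTZbar (n : ℕ) (φ : ℂ × Cn n → ℝ) (j : Fin n) (p : ℂ × Cn n) : ℂ :=
  wirtingerD (fun q => wirtingerDbar (fun x => (φ x : ℂ)) q (dirZ n j)) p (dirT n)

/-- The complex Hessian `(φ_{z_j z̄_k})_{j,k}` in the fiber directions. -/
def hessZZbar (n : ℕ) (φ : ℂ × Cn n → ℝ) (p : ℂ × Cn n) : Matrix (Fin n) (Fin n) ℂ :=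
  Matrix.of fun j k =>
    wirtingerD (fun q => wirtingerDbar (fun x => (φ x : ℂ)) q (dirZ n k)) p (dirZ n j)

/-- `D = φ_{t t̄} - ∑_{j,k} (φ_{z_j z̄_k})⁻¹_{jk} φ_{t z̄_j} conj (φ_{t z̄_k})`, i.e. the
determinant of the full complex Hessian of `φ` divided by the determinant of the complex
Hessian of `φ^t`. -/
def bigD (n : ℕ) (φ : ℂ × Cn n → ℝ) (p : ℂ × Cn n) : ℂ :=
  hessTTbar n φ p -
    ∑ j, ∑ k, (hessZZbar n φ p)⁻¹ j k * hessTZbar n φ j p *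
      (starRingEnd ℂ) (hessTZbar n φ k p)

section Calculus

variable {F : Type*} [NormedAddCommGroup F] [NormedSpace ℂ F]

/-- Complex conjugation intertwines the two Wirtinger derivatives. -/
lemma fderiv_conj_apply {f : F → ℂ} {x : F} (hf : DifferentiableAt ℝ f x) (v : F) :
    fderiv ℝ (fun y => (starRingEnd ℂ) (f y)) x v = (starRingEnd ℂ) (fderiv ℝ f x v) := by
  have h := (Complex.conjCLE.toContinuousLinearMap.hasFDerivAt (x := f x)).comp x hf.hasFDerivAt
  have h2 : HasFDerivAt (fun y => (starRingEnd ℂ) (f y))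
      (Complex.conjCLE.toContinuousLinearMap.comp (fderiv ℝ f x)) x := h
  rw [h2.fderiv]; rfl

lemma wirtingerD_conj {f : F → ℂ} {x : F} (hf : DifferentiableAt ℝ f x) (v : F) :
    wirtingerD (fun y => (starRingEnd ℂ) (f y)) x v = (starRingEnd ℂ) (wirtingerDbar f x v) := by
  simp only [wirtingerD, wirtingerDbar, fderiv_conj_apply hf, map_mul, map_add, Complex.conj_I,
    map_div₀, map_one, map_ofNat]
  ring

lemma wirtingerDbar_conj {f : F → ℂ} {x : F} (hf : DifferentiableAt ℝ f x) (v : F) :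
    wirtingerDbar (fun y => (starRingEnd ℂ) (f y)) x v = (starRingEnd ℂ) (wirtingerD f x v) := by
  simp only [wirtingerD, wirtingerDbar, fderiv_conj_apply hf, map_mul, map_sub, Complex.conj_I,
    map_div₀, map_one, map_ofNat]
  ring

lemma wirtingerD_mul {f g : F → ℂ} {x : F} (hf : DifferentiableAt ℝ f x)
    (hg : DifferentiableAt ℝ g x) (v : F) :
    wirtingerD (fun y => f y * g y) x v = wirtingerD f x v * g x + f x * wirtingerD g x v := by
  simp only [wirtingerD, fderiv_fun_mul hf hg, add_apply,
    smul_apply, smul_eq_mul]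
  ring

lemma wirtingerDbar_mul {f g : F → ℂ} {x : F} (hf : DifferentiableAt ℝ f x)
    (hg : DifferentiableAt ℝ g x) (v : F) :
    wirtingerDbar (fun y => f y * g y) x v =
      wirtingerDbar f x v * g x + f x * wirtingerDbar g x v := by
  simp only [wirtingerDbar, fderiv_fun_mul hf hg, add_apply,
    smul_apply, smul_eq_mul]
  ring

lemma wirtingerD_add {f g : F → ℂ} {x : F} (hf : DifferentiableAt ℝ f x)
    (hg : DifferentiableAt ℝ g x) (v : F) :
    wirtingerD (fun y => f y + g y) x v = wirtingerD f x v + wirtingerD g x v := by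
  simp only [wirtingerD, fderiv_fun_add hf hg, add_apply]
  ring

lemma wirtingerDbar_add {f g : F → ℂ} {x : F} (hf : DifferentiableAt ℝ f x)
    (hg : DifferentiableAt ℝ g x) (v : F) :
    wirtingerDbar (fun y => f y + g y) x v = wirtingerDbar f x v + wirtingerDbar g x v := by
  simp only [wirtingerDbar, fderiv_fun_add hf hg, add_apply]
  ring

lemma wirtingerDbar_sub {f g : F → ℂ} {x : F} (hf : DifferentiableAt ℝ f x)
    (hg : DifferentiableAt ℝ g x) (v : F) :
    wirtingerDbar (fun y => f y - g y) x v = wirtingerDbar f x v - wirtingerDbar g x v := by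
  simp only [wirtingerDbar, fderiv_fun_sub hf hg, sub_apply]
  ring

lemma hasFDerivAt_comp_ofReal {f : F → ℝ} {x : F} (hf : DifferentiableAt ℝ f x) {h : ℝ → ℝ}
    {h' : ℝ} (hh : HasDerivAt h h' (f x)) :
    HasFDerivAt (fun y => ((h (f y) : ℝ) : ℂ))
      (Complex.ofRealCLM.comp (h' • fderiv ℝ f x)) x := by
  have := hh.comp_hasFDerivAt x hf.hasFDerivAt
  exact (Complex.ofRealCLM.hasFDerivAt).comp x this

lemma fderiv_ofReal_apply {f : F → ℝ} {x : F} (hf : DifferentiableAt ℝ f x) (v : F) :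
    fderiv ℝ (fun y => (f y : ℂ)) x v = ((fderiv ℝ f x v : ℝ) : ℂ) := by
  have h := (hasFDerivAt_comp_ofReal hf (hasDerivAt_id _)).fderiv
  simp only [id, one_smul] at h
  rw [h]; rfl

lemma wirtingerD_comp_ofReal {f : F → ℝ} {x : F} (hf : DifferentiableAt ℝ f x) {h : ℝ → ℝ}
    {h' : ℝ} (hh : HasDerivAt h h' (f x)) (v : F) :
    wirtingerD (fun y => ((h (f y) : ℝ) : ℂ)) x v =
      h' * wirtingerD (fun y => (f y : ℂ)) x v := by
  simp only [wirtingerD, (hasFDerivAt_comp_ofReal hf hh).fderiv, fderiv_ofReal_apply hf]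
  simp
  ring

lemma wirtingerDbar_comp_ofReal {f : F → ℝ} {x : F} (hf : DifferentiableAt ℝ f x) {h : ℝ → ℝ}
    {h' : ℝ} (hh : HasDerivAt h h' (f x)) (v : F) :
    wirtingerDbar (fun y => ((h (f y) : ℝ) : ℂ)) x v =
      h' * wirtingerDbar (fun y => (f y : ℂ)) x v := by
  simp only [wirtingerDbar, (hasFDerivAt_comp_ofReal hf hh).fderiv, fderiv_ofReal_apply hf]
  simp
  ring

lemma wirtingerDbar_ofReal {f : F → ℝ} {x : F} (hf : DifferentiableAt ℝ f x) (v : F) :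
    wirtingerDbar (fun y => (f y : ℂ)) x v =
      (starRingEnd ℂ) (wirtingerD (fun y => (f y : ℂ)) x v) := by
  simp only [wirtingerD, wirtingerDbar, fderiv_ofReal_apply hf, map_mul, map_sub, Complex.conj_I,
    map_div₀, map_one, map_ofNat, Complex.conj_ofReal]
  ring

lemma contDiffOn_wirtingerD {f : F → ℂ} {s : Set F} (hs : IsOpen s)
    (hf : ContDiffOn ℝ (⊤ : ℕ∞) f s) (v : F) :
    ContDiffOn ℝ (⊤ : ℕ∞) (fun x => wirtingerD f x v) s := by
  have h := hf.fderiv_of_isOpen (m := (⊤ : ℕ∞)) hs le_rfl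
  unfold wirtingerD
  exact contDiffOn_const.mul ((h.clm_apply contDiffOn_const).sub
    (contDiffOn_const.mul (h.clm_apply contDiffOn_const)))

lemma contDiffOn_wirtingerDbar {f : F → ℂ} {s : Set F} (hs : IsOpen s)
    (hf : ContDiffOn ℝ (⊤ : ℕ∞) f s) (v : F) :
    ContDiffOn ℝ (⊤ : ℕ∞) (fun x => wirtingerDbar f x v) s := by
  have h := hf.fderiv_of_isOpen (m := (⊤ : ℕ∞)) hs le_rfl
  unfold wirtingerDbar
  exact contDiffOn_const.mul ((h.clm_apply contDiffOn_const).add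
    (contDiffOn_const.mul (h.clm_apply contDiffOn_const)))

lemma contDiff_wirtingerD {f : F → ℂ} (hf : ContDiff ℝ (⊤ : ℕ∞) f) (v : F) :
    ContDiff ℝ (⊤ : ℕ∞) (fun x => wirtingerD f x v) :=
  contDiffOn_univ.1 (contDiffOn_wirtingerD isOpen_univ hf.contDiffOn v)

lemma contDiff_wirtingerDbar {f : F → ℂ} (hf : ContDiff ℝ (⊤ : ℕ∞) f) (v : F) :
    ContDiff ℝ (⊤ : ℕ∞) (fun x => wirtingerDbar f x v) :=
  contDiffOn_univ.1 (contDiffOn_wirtingerDbar isOpen_univ hf.contDiffOn v)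

/-- The sesquilinear form attached to `∂∂̄ f`. -/
def leviForm (f : F → ℂ) (p v w : F) : ℂ :=
  (1 / 4 : ℂ) * (fderiv ℝ (fderiv ℝ f) p v w + I * fderiv ℝ (fderiv ℝ f) p v (I • w)
    - I * fderiv ℝ (fderiv ℝ f) p (I • v) w + fderiv ℝ (fderiv ℝ f) p (I • v) (I • w))

lemma fderiv_fderiv_clm_apply {f : F → ℂ} {p : F} (hf : DifferentiableAt ℝ (fderiv ℝ f) p)
    (v w : F) : fderiv ℝ (fun q => fderiv ℝ f q w) p v = fderiv ℝ (fderiv ℝ f) p v w := by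
  have := (hf.hasFDerivAt.clm_apply (hasFDerivAt_const w p)).fderiv
  rw [this]; simp

lemma wirtingerD_wirtingerDbar {f : F → ℂ} {p : F} (hf : DifferentiableAt ℝ (fderiv ℝ f) p)
    (v w : F) : wirtingerD (fun q => wirtingerDbar f q w) p v = leviForm f p v w := by
  have h1 : ∀ u : F, DifferentiableAt ℝ (fun q => fderiv ℝ f q u) p := fun u =>
    hf.clm_apply (differentiableAt_const _)
  have h2 : ∀ u : F, fderiv ℝ (fun q => wirtingerDbar f q w) p u = (1 / 2 : ℂ) *
      (fderiv ℝ (fderiv ℝ f) p u w + I * fderiv ℝ (fderiv ℝ f) p u (I • w)) := by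
    intro u
    unfold wirtingerDbar
    rw [fderiv_const_mul ((h1 _).fun_add ((h1 _).const_mul _)),
      fderiv_fun_add (h1 _) ((h1 _).const_mul _), fderiv_const_mul (h1 _)]
    simp [fderiv_fderiv_clm_apply hf]
    ring
  unfold wirtingerD leviForm
  rw [h2, h2]
  ring_nf
  simp only [I_sq]
  ring

lemma wirtingerDbar_wirtingerD {f : F → ℂ} {p : F} (hf : DifferentiableAt ℝ (fderiv ℝ f) p)
    (hs : IsSymmSndFDerivAt ℝ f p) (v w : F) :
    wirtingerDbar (fun q => wirtingerD f q v) p w = leviForm f p v w := by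
  have h1 : ∀ u : F, DifferentiableAt ℝ (fun q => fderiv ℝ f q u) p := fun u =>
    hf.clm_apply (differentiableAt_const _)
  have h2 : ∀ u : F, fderiv ℝ (fun q => wirtingerD f q v) p u = (1 / 2 : ℂ) *
      (fderiv ℝ (fderiv ℝ f) p v u - I * fderiv ℝ (fderiv ℝ f) p (I • v) u) := by
    intro u
    unfold wirtingerD
    rw [fderiv_const_mul ((h1 _).fun_sub ((h1 _).const_mul _)),
      fderiv_fun_sub (h1 _) ((h1 _).const_mul _), fderiv_const_mul (h1 _)]
    simp [fderiv_fderiv_clm_apply hf, hs v u, hs (I • v) u]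
  unfold wirtingerDbar leviForm
  rw [h2, h2]
  ring_nf
  simp only [I_sq]
  ring

lemma wirtingerDbar_wirtingerDbar_comm {f : F → ℂ} {p : F}
    (hf : DifferentiableAt ℝ (fderiv ℝ f) p) (hs : IsSymmSndFDerivAt ℝ f p) (v w : F) :
    wirtingerDbar (fun q => wirtingerDbar f q v) p w =
      wirtingerDbar (fun q => wirtingerDbar f q w) p v := by
  have h1 : ∀ u : F, DifferentiableAt ℝ (fun q => fderiv ℝ f q u) p := fun u =>
    hf.clm_apply (differentiableAt_const _)
  have h2 : ∀ u v: F, fderiv ℝ (fun q => wirtingerDbar f q v) p u = (1 / 2 : ℂ) *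
      (fderiv ℝ (fderiv ℝ f) p u v + I * fderiv ℝ (fderiv ℝ f) p u (I • v)) := by
    intro u v
    unfold wirtingerDbar
    rw [fderiv_const_mul ((h1 _).fun_add ((h1 _).const_mul _)),
      fderiv_fun_add (h1 _) ((h1 _).const_mul _), fderiv_const_mul (h1 _)]
    simp [fderiv_fderiv_clm_apply hf]
    ring
  rw [wirtingerDbar, wirtingerDbar, h2, h2, h2, h2, hs v w, hs (I • v) w, hs v (I • w),
    hs (I • v) (I • w)]
  ring

lemma leviForm_add_left (f : F → ℂ) (p u v w : F) :
    leviForm f p (u + v) w = leviForm f p u w + leviForm f p v w := by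
  simp only [leviForm, smul_add, map_add, add_apply]; ring

lemma leviForm_add_right (f : F → ℂ) (p u v w : F) :
    leviForm f p u (v + w) = leviForm f p u v + leviForm f p u w := by
  simp only [leviForm, smul_add, map_add]; ring

lemma complex_smul_eq (c : ℂ) (v : F) : c • v = c.re • v + c.im • (I • v) := by
  conv_lhs => rw [← Complex.re_add_im c]
  rw [add_smul, mul_smul]; simp

lemma leviForm_smul_left (f : F → ℂ) (p : F) (c : ℂ) (v w : F) :
    leviForm f p (c • v) w = c * leviForm f p v w := by
  have e2 : I • c • v = c.re • (I • v) - c.im • v := by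
    rw [smul_comm, complex_smul_eq c (I • v), smul_smul, I_mul_I]; simp [sub_eq_add_neg]
  rw [leviForm, e2, complex_smul_eq c v]
  simp only [leviForm, map_add, map_sub, map_smul, add_apply,
    sub_apply, smul_apply, real_smul]
  conv_rhs => rw [← Complex.re_add_im c]
  ring_nf
  simp only [I_sq]
  ring

lemma leviForm_smul_right (f : F → ℂ) (p : F) (c : ℂ) (v w : F) :
    leviForm f p v (c • w) = (starRingEnd ℂ) c * leviForm f p v w := by
  have e2 : I • c • w = c.re • (I • w) - c.im • w := by
    rw [smul_comm, complex_smul_eq c (I • w), smul_smul, I_mul_I]; simp [sub_eq_add_neg]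
  have e3 : (starRingEnd ℂ) c = c.re - c.im * I := by
    apply Complex.ext <;> simp
  rw [leviForm, e2, complex_smul_eq c w, e3]
  simp only [leviForm, map_add, map_sub, map_smul, real_smul]
  ring_nf
  simp only [I_sq]
  ring

lemma leviForm_sum_left {ι : Type*} (s : Finset ι) (f : F → ℂ) (p : F) (v : ι → F) (w : F) :
    leviForm f p (∑ i ∈ s, v i) w = ∑ i ∈ s, leviForm f p (v i) w := by
  classical
  induction s using Finset.induction_on with
  | empty => simp [leviForm]
  | insert a s ha ih => rw [Finset.sum_insert ha, Finset.sum_insert ha, leviForm_add_left, ih]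

lemma leviForm_sum_right {ι : Type*} (s : Finset ι) (f : F → ℂ) (p : F) (v : F) (w : ι → F) :
    leviForm f p v (∑ i ∈ s, w i) = ∑ i ∈ s, leviForm f p v (w i) := by
  classical
  induction s using Finset.induction_on with
  | empty => simp [leviForm]
  | insert a s ha ih => rw [Finset.sum_insert ha, Finset.sum_insert ha, leviForm_add_right, ih]

lemma fderiv_fderiv_ofReal {f : F → ℝ} {p : F} (hf : ContDiffAt ℝ 2 f p) (v w : F) :
    fderiv ℝ (fderiv ℝ (fun y => (f y : ℂ))) p v w =
      ((fderiv ℝ (fderiv ℝ f) p v w : ℝ) : ℂ) := by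
  have h1 : DifferentiableAt ℝ (fderiv ℝ f) p :=
    (hf.fderiv_right (m := 1) (by norm_num)).differentiableAt (by norm_num)
  have hC : ContDiffAt ℝ 2 (fun y => (f y : ℂ)) p :=
    (Complex.ofRealCLM.contDiff.contDiffAt).comp p hf
  have h2 : DifferentiableAt ℝ (fderiv ℝ (fun y => (f y : ℂ))) p :=
    (hC.fderiv_right (m := 1) (by norm_num)).differentiableAt (by norm_num)
  rw [← fderiv_fderiv_clm_apply h2]
  have he : (fun q => fderiv ℝ (fun y => (f y : ℂ)) q w) =ᶠ[𝓝 p]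
      fun q => ((fderiv ℝ f q w : ℝ) : ℂ) := by
    filter_upwards [hf.eventually (by simp)] with q hq
    exact fderiv_ofReal_apply (hq.differentiableAt (by norm_num)) w
  rw [he.fderiv_eq, fderiv_ofReal_apply (h1.clm_apply (differentiableAt_const _))]
  rw [(h1.hasFDerivAt.clm_apply (hasFDerivAt_const w p)).fderiv]
  simp

lemma leviForm_self {f : F → ℝ} {p : F} (hf : ContDiffAt ℝ 2 f p) (v : F) :
    leviForm (fun y => (f y : ℂ)) p v v =
      (((1 / 4) * (iteratedFDeriv ℝ 2 f p ![v, v] +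
        iteratedFDeriv ℝ 2 f p ![I • v, I • v]) : ℝ) : ℂ) := by
  have hs : IsSymmSndFDerivAt ℝ f p := hf.isSymmSndFDerivAt (by simp)
  simp only [leviForm, fderiv_fderiv_ofReal hf, iteratedFDeriv_two_apply, hs (I • v) v]
  simp

lemma leviForm_conj {f : F → ℝ} {p : F} (hf : ContDiffAt ℝ 2 f p) (v w : F) :
    (starRingEnd ℂ) (leviForm (fun y => (f y : ℂ)) p v w) =
      leviForm (fun y => (f y : ℂ)) p w v := by
  have hs : IsSymmSndFDerivAt ℝ f p := hf.isSymmSndFDerivAt (by simp)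
  simp only [leviForm, fderiv_fderiv_ofReal hf, hs w v, hs (I • w) v, hs w (I • v),
    hs (I • w) (I • v), map_mul, map_sub, map_add, Complex.conj_I, map_div₀, map_one, map_ofNat,
    Complex.conj_ofReal]
  ring

end Calculus

instance (n : ℕ) : (volume : Measure (Cn n)).IsAddHaarMeasure :=
  ContinuousLinearEquiv.isAddHaarMeasure_map (EuclideanSpace.equiv (Fin n) ℂ).symm volume

section TestFunctions

variable {n : ℕ}

/-- `∂f/∂z_j`. -/
def dz (j : Fin n) (f : Cn n → ℂ) (x : Cn n) : ℂ := wirtingerD f x (EuclideanSpace.single j 1)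

/-- `∂f/∂z̄_j`. -/
def dzb (j : Fin n) (f : Cn n → ℂ) (x : Cn n) : ℂ :=
  wirtingerDbar f x (EuclideanSpace.single j 1)

/-- Smooth complex functions with compact support in `V`. -/
structure IsTest (V : Set (Cn n)) (f : Cn n → ℂ) : Prop where
  smooth : ContDiff ℝ (⊤ : ℕ∞) f
  compact : HasCompactSupport f
  subset : tsupport f ⊆ V

variable {V : Set (Cn n)} {f g : Cn n → ℂ}

lemma IsTest.mono {V' : Set (Cn n)} (hf : IsTest V f) (h : V ⊆ V') : IsTest V' f :=
  ⟨hf.smooth, hf.compact, hf.subset.trans h⟩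

lemma IsTest.differentiable (hf : IsTest V f) : Differentiable ℝ f :=
  hf.smooth.differentiable (by simp)

lemma IsTest.zero_outside (hf : IsTest V f) {x : Cn n} (hx : x ∉ V) : f x = 0 :=
  image_eq_zero_of_notMem_tsupport fun h => hx (hf.subset h)

lemma IsTest.integrable (hf : IsTest V f) : Integrable f :=
  hf.smooth.continuous.integrable_of_hasCompactSupport hf.compact

lemma contDiff_mul_of_tsupport_subset (hV : IsOpen V) (hg : ContDiffOn ℝ (⊤ : ℕ∞) g V)
    (hf : ContDiff ℝ (⊤ : ℕ∞) f) (hs : tsupport f ⊆ V) :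
    ContDiff ℝ (⊤ : ℕ∞) (fun x => g x * f x) := by
  rw [contDiff_iff_contDiffAt]
  intro x
  by_cases hx : x ∈ V
  · exact ((hg x hx).contDiffAt (hV.mem_nhds hx)).mul hf.contDiffAt
  · have : (fun x => g x * f x) =ᶠ[𝓝 x] fun _ => 0 := by
      have h1 : (tsupport f)ᶜ ∈ 𝓝 x :=
        (isClosed_tsupport f).isOpen_compl.mem_nhds (fun h => hx (hs h))
      filter_upwards [h1] with y hy
      rw [image_eq_zero_of_notMem_tsupport hy, mul_zero]
    exact (contDiffAt_const (c := (0:ℂ))).congr_of_eventuallyEq this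

lemma IsTest.mul_left (hV : IsOpen V) (hf : IsTest V f) (hg : ContDiffOn ℝ (⊤ : ℕ∞) g V) :
    IsTest V (fun x => g x * f x) :=
  ⟨contDiff_mul_of_tsupport_subset hV hg hf.smooth hf.subset, hf.compact.mul_left,
    (tsupport_mul_subset_right).trans hf.subset⟩

lemma IsTest.mul_left' (hf : IsTest V f) (hg : ContDiff ℝ (⊤ : ℕ∞) g) :
    IsTest V (fun x => g x * f x) :=
  ⟨hg.mul hf.smooth, hf.compact.mul_left, (tsupport_mul_subset_right).trans hf.subset⟩

lemma IsTest.add (hf : IsTest V f) (hg : IsTest V g) : IsTest V (fun x => f x + g x) :=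
  ⟨hf.smooth.add hg.smooth, hf.compact.add hg.compact,
    (tsupport_add f g).trans (union_subset hf.subset hg.subset)⟩

lemma IsTest.zero : IsTest V (fun _ => 0) :=
  ⟨contDiff_const, HasCompactSupport.zero, by
    have : tsupport (fun _ : Cn n => (0 : ℂ)) = ∅ := by
      rw [tsupport_eq_empty_iff]; rfl
    rw [this]; exact empty_subset _⟩

lemma IsTest.const_mul (hf : IsTest V f) (c : ℂ) : IsTest V (fun x => c * f x) :=
  hf.mul_left' contDiff_const

lemma IsTest.sub (hf : IsTest V f) (hg : IsTest V g) : IsTest V (fun x => f x - g x) := by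
  have := hf.add (hg.const_mul (-1))
  simpa [sub_eq_add_neg] using this

lemma IsTest.sum {ι : Type*} (s : Finset ι) {f : ι → Cn n → ℂ} (hf : ∀ i ∈ s, IsTest V (f i)) :
    IsTest V (fun x => ∑ i ∈ s, f i x) := by
  classical
  induction s using Finset.induction_on with
  | empty => simpa using IsTest.zero
  | insert a s ha ih =>
    simp only [Finset.sum_insert ha]
    exact (hf a (Finset.mem_insert_self _ _)).add
      (ih fun i hi => hf i (Finset.mem_insert_of_mem hi))

lemma IsTest.conj (hf : IsTest V f) : IsTest V (fun x => (starRingEnd ℂ) (f x)) := by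
  have h : tsupport (fun x => (starRingEnd ℂ) (f x)) ⊆ tsupport f :=
    closure_mono fun x hx => by
      simp only [Function.mem_support, ne_eq, map_eq_zero] at hx ⊢
      exact hx
  exact ⟨Complex.conjCLE.contDiff.comp hf.smooth, hf.compact.mono' (subset_closure.trans h),
    h.trans hf.subset⟩

lemma support_wirtinger_subset (f : Cn n → ℂ) (v : Cn n) :
    (Function.support fun x => wirtingerD f x v) ⊆ tsupport f ∧
    (Function.support fun x => wirtingerDbar f x v) ⊆ tsupport f := by
  constructor <;>
  · intro x hx
    by_contra h
    have : fderiv ℝ f x = 0 := by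
      have h1 : x ∉ Function.support (fderiv ℝ f) := fun h2 => h (support_fderiv_subset ℝ h2)
      simpa using h1
    simp [wirtingerD, wirtingerDbar, this] at hx

lemma IsTest.dz (hf : IsTest V f) (j : Fin n) : IsTest V (dz j f) := by
  have h := (support_wirtinger_subset f (EuclideanSpace.single j 1)).1
  exact ⟨contDiff_wirtingerD hf.smooth _, hf.compact.mono' h,
    (closure_minimal h (isClosed_tsupport f)).trans hf.subset⟩

lemma IsTest.dzb (hf : IsTest V f) (j : Fin n) : IsTest V (dzb j f) := by
  have h := (support_wirtinger_subset f (EuclideanSpace.single j 1)).2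
  exact ⟨contDiff_wirtingerDbar hf.smooth _, hf.compact.mono' h,
    (closure_minimal h (isClosed_tsupport f)).trans hf.subset⟩

lemma dzb_conj (hf : Differentiable ℝ f) (j : Fin n) :
    dzb j (fun y => (starRingEnd ℂ) (f y)) = fun x => (starRingEnd ℂ) (dz j f x) :=
  funext fun x => wirtingerDbar_conj (hf x) _

lemma integral_mul_fderiv_eq (hV : IsOpen V) (hg : ContDiffOn ℝ (⊤ : ℕ∞) g V) (hf : IsTest V f)
    (v : Cn n) : ∫ x, g x * fderiv ℝ f x v = -∫ x, fderiv ℝ g x v * f x := by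
  have ht : IsTest V (fun x => fderiv ℝ f x v) := by
    have h : (Function.support fun x => fderiv ℝ f x v) ⊆ tsupport f := by
      intro x hx
      by_contra h
      have : fderiv ℝ f x = 0 := by
        have h1 : x ∉ Function.support (fderiv ℝ f) := fun h2 => h (support_fderiv_subset ℝ h2)
        simpa using h1
      simp [this] at hx
    exact ⟨(hf.smooth.fderiv_right (m := (⊤ : ℕ∞)) le_rfl).clm_apply contDiff_const,
      hf.compact.mono' h, (closure_minimal h (isClosed_tsupport f)).trans hf.subset⟩
  have hg' : ContDiffOn ℝ (⊤ : ℕ∞) (fun x => fderiv ℝ g x v) V :=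
    (hg.fderiv_of_isOpen (m := (⊤ : ℕ∞)) hV le_rfl).clm_apply contDiffOn_const
  refine integral_mul_fderiv_eq_neg_fderiv_mul_of_integrable (hf.mul_left hV hg').integrable
    (ht.mul_left hV hg).integrable (hf.mul_left hV hg).integrable ?_ ?_
  · intro x hx
    exact ((hg x (hf.subset hx)).contDiffAt (hV.mem_nhds (hf.subset hx))).differentiableAt
      (by simp)
  · exact fun x _ => hf.differentiable x

lemma integrable_mul_fderiv (hV : IsOpen V) (hg : ContDiffOn ℝ (⊤ : ℕ∞) g V) (hf : IsTest V f)
    (v : Cn n) : Integrable (fun x => g x * fderiv ℝ f x v) ∧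
      Integrable (fun x => fderiv ℝ g x v * f x) := by
  have ht : IsTest V (fun x => fderiv ℝ f x v) := by
    have h : (Function.support fun x => fderiv ℝ f x v) ⊆ tsupport f := by
      intro x hx
      by_contra h
      have : fderiv ℝ f x = 0 := by
        have h1 : x ∉ Function.support (fderiv ℝ f) := fun h2 => h (support_fderiv_subset ℝ h2)
        simpa using h1
      simp [this] at hx
    exact ⟨(hf.smooth.fderiv_right (m := (⊤ : ℕ∞)) le_rfl).clm_apply contDiff_const,
      hf.compact.mono' h, (closure_minimal h (isClosed_tsupport f)).trans hf.subset⟩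
  have hg' : ContDiffOn ℝ (⊤ : ℕ∞) (fun x => fderiv ℝ g x v) V :=
    (hg.fderiv_of_isOpen (m := (⊤ : ℕ∞)) hV le_rfl).clm_apply contDiffOn_const
  exact ⟨(ht.mul_left hV hg).integrable, (hf.mul_left hV hg').integrable⟩

lemma integral_mul_dz (hV : IsOpen V) (hg : ContDiffOn ℝ (⊤ : ℕ∞) g V) (hf : IsTest V f)
    (j : Fin n) : ∫ x, g x * dz j f x = -∫ x, dz j g x * f x := by
  set e : Cn n := EuclideanSpace.single j 1
  have h1 := integral_mul_fderiv_eq hV hg hf e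
  have h2 := integral_mul_fderiv_eq hV hg hf (I • e)
  obtain ⟨i1, i2⟩ := integrable_mul_fderiv hV hg hf e
  obtain ⟨i3, i4⟩ := integrable_mul_fderiv hV hg hf (I • e)
  have e1 : ∀ x, g x * dz j f x = (1 / 2 : ℂ) * (g x * fderiv ℝ f x e)
      - (I / 2) * (g x * fderiv ℝ f x (I • e)) := by
    intro x; simp only [dz, wirtingerD]; ring
  have e2 : ∀ x, dz j g x * f x = (1 / 2 : ℂ) * (fderiv ℝ g x e * f x)
      - (I / 2) * (fderiv ℝ g x (I • e) * f x) := by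
    intro x; simp only [dz, wirtingerD]; ring
  simp_rw [e1, e2]
  rw [integral_sub (i1.const_mul _) (i3.const_mul _), integral_sub (i2.const_mul _)
    (i4.const_mul _), integral_const_mul, integral_const_mul, integral_const_mul,
    integral_const_mul, h1, h2]
  ring

lemma integral_mul_dzb (hV : IsOpen V) (hg : ContDiffOn ℝ (⊤ : ℕ∞) g V) (hf : IsTest V f)
    (j : Fin n) : ∫ x, g x * dzb j f x = -∫ x, dzb j g x * f x := by
  set e : Cn n := EuclideanSpace.single j 1
  have h1 := integral_mul_fderiv_eq hV hg hf e
  have h2 := integral_mul_fderiv_eq hV hg hf (I • e)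
  obtain ⟨i1, i2⟩ := integrable_mul_fderiv hV hg hf e
  obtain ⟨i3, i4⟩ := integrable_mul_fderiv hV hg hf (I • e)
  have e1 : ∀ x, g x * dzb j f x = (1 / 2 : ℂ) * (g x * fderiv ℝ f x e)
      + (I / 2) * (g x * fderiv ℝ f x (I • e)) := by
    intro x; simp only [dzb, wirtingerDbar]; ring
  have e2 : ∀ x, dzb j g x * f x = (1 / 2 : ℂ) * (fderiv ℝ g x e * f x)
      + (I / 2) * (fderiv ℝ g x (I • e) * f x) := by
    intro x; simp only [dzb, wirtingerDbar]; ring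
  simp_rw [e1, e2]
  rw [integral_add (i1.const_mul _) (i3.const_mul _), integral_add (i2.const_mul _)
    (i4.const_mul _), integral_const_mul, integral_const_mul, integral_const_mul,
    integral_const_mul, h1, h2]
  ring

end TestFunctions

section BasicIdentity

variable {n : ℕ} {V : Set (Cn n)} {f g : Cn n → ℂ} {ψ : Cn n → ℝ}

lemma two_le_top : (2 : WithTop ℕ∞) ≤ ((⊤ : ℕ∞) : WithTop ℕ∞) := by
  change ((2 : ℕ∞) : WithTop ℕ∞) ≤ _
  exact WithTop.coe_le_coe.2 le_top

/-- The Levi coefficients `∂²ψ/∂z_j∂z̄_k`. -/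
def leviCoeff (ψ : Cn n → ℝ) (j k : Fin n) (x : Cn n) : ℂ :=
  leviForm (fun y => (ψ y : ℂ)) x (EuclideanSpace.single j 1) (EuclideanSpace.single k 1)

/-- The twisted derivative `e^ψ ∂_j (e^{-ψ} f)`. -/
def dzTwist (ψ : Cn n → ℝ) (j : Fin n) (f : Cn n → ℂ) (x : Cn n) : ℂ :=
  dz j f x - dz j (fun y => (ψ y : ℂ)) x * f x

lemma contDiff_ofReal_comp {s : Set (Cn n)} (hψ : ContDiffOn ℝ (⊤ : ℕ∞) ψ s) :
    ContDiffOn ℝ (⊤ : ℕ∞) (fun y => (ψ y : ℂ)) s :=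
  Complex.ofRealCLM.contDiff.comp_contDiffOn hψ

lemma contDiff_exp_neg {s : Set (Cn n)} (hψ : ContDiffOn ℝ (⊤ : ℕ∞) ψ s) :
    ContDiffOn ℝ (⊤ : ℕ∞) (fun y => (Real.exp (-ψ y) : ℂ)) s :=
  Complex.ofRealCLM.contDiff.comp_contDiffOn (Real.contDiff_exp.comp_contDiffOn hψ.neg)

lemma dz_exp_neg {x : Cn n} (hψ : DifferentiableAt ℝ ψ x) (j : Fin n) :
    dz j (fun y => (Real.exp (-ψ y) : ℂ)) x =
      -(dz j (fun y => (ψ y : ℂ)) x * (Real.exp (-ψ x) : ℂ)) := by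
  have h : HasDerivAt (fun r : ℝ => Real.exp (-r)) (-Real.exp (-ψ x)) (ψ x) := by
    simpa using (hasDerivAt_neg (ψ x)).exp
  have := wirtingerD_comp_ofReal hψ h (EuclideanSpace.single j 1)
  rw [dz, this, dz]; push_cast; ring

lemma dz_mul_exp_neg {x : Cn n} (hψ : DifferentiableAt ℝ ψ x) (hf : DifferentiableAt ℝ f x)
    (j : Fin n) : dz j (fun y => f y * (Real.exp (-ψ y) : ℂ)) x =
      dzTwist ψ j f x * (Real.exp (-ψ x) : ℂ) := by
  have hE : DifferentiableAt ℝ (fun y => (Real.exp (-ψ y) : ℂ)) x :=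
    Complex.ofRealCLM.differentiableAt.comp x (hψ.neg.exp)
  have h2 := dz_exp_neg hψ j
  unfold dz at h2
  rw [dz, wirtingerD_mul hf hE, h2, dzTwist, dz, dz]
  ring

lemma contDiff_dz (hf : ContDiff ℝ (⊤ : ℕ∞) f) (j : Fin n) : ContDiff ℝ (⊤ : ℕ∞) (dz j f) :=
  contDiff_wirtingerD hf _

lemma contDiff_dzb (hf : ContDiff ℝ (⊤ : ℕ∞) f) (j : Fin n) : ContDiff ℝ (⊤ : ℕ∞) (dzb j f) :=
  contDiff_wirtingerDbar hf _

lemma IsTest.dzTwist (hψ : ContDiff ℝ (⊤ : ℕ∞) ψ) (hf : IsTest V f) (j : Fin n) :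
    IsTest V (dzTwist ψ j f) :=
  (hf.dz j).sub (hf.mul_left' (contDiff_dz (contDiffOn_univ.1
    (contDiff_ofReal_comp hψ.contDiffOn)) j))

lemma integral_mul_conj_dzTwist (hψ : ContDiff ℝ (⊤ : ℕ∞) ψ) (hf : ContDiff ℝ (⊤ : ℕ∞) f)
    (hg : IsTest V g) (k : Fin n) :
    ∫ x, f x * (starRingEnd ℂ) (dzTwist ψ k g x) * (Real.exp (-ψ x) : ℂ) =
      -∫ x, dzb k f x * (starRingEnd ℂ) (g x) * (Real.exp (-ψ x) : ℂ) := by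
  have hE := contDiffOn_univ.1 (contDiff_exp_neg hψ.contDiffOn)
  have hgE : IsTest V (fun y => g y * (Real.exp (-ψ y) : ℂ)) := by
    simpa only [mul_comm] using hg.mul_left' hE
  have h := integral_mul_dzb isOpen_univ hf.contDiffOn (hgE.conj.mono (subset_univ _)) k
  rw [dzb_conj hgE.differentiable] at h
  have e1 : ∀ x, dz k (fun y => g y * (Real.exp (-ψ y) : ℂ)) x = _ := fun x =>
    dz_mul_exp_neg (hψ.differentiable (by simp) x) (hg.differentiable x) k
  simp_rw [e1, map_mul, Complex.conj_ofReal] at h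
  simpa only [mul_assoc] using h

lemma integral_dzTwist_mul_conj (hψ : ContDiff ℝ (⊤ : ℕ∞) ψ) (hf : IsTest V f)
    (hg : ContDiff ℝ (⊤ : ℕ∞) g) (j : Fin n) :
    ∫ x, dzTwist ψ j f x * (starRingEnd ℂ) (g x) * (Real.exp (-ψ x) : ℂ) =
      -∫ x, f x * (starRingEnd ℂ) (dzb j g x) * (Real.exp (-ψ x) : ℂ) := by
  have h := integral_mul_conj_dzTwist hψ hg hf j
  have h2 := congrArg (starRingEnd ℂ) h
  rw [map_neg, ← integral_conj, ← integral_conj] at h2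
  simp only [map_mul, Complex.conj_conj, Complex.conj_ofReal] at h2
  simpa only [mul_comm, mul_left_comm, mul_assoc] using h2

lemma dz_dzb_real (hψ : ContDiff ℝ (⊤ : ℕ∞) ψ) (j k : Fin n) (x : Cn n) :
    dz j (dzb k (fun y => (ψ y : ℂ))) x = leviCoeff ψ j k x ∧
    dzb k (dz j (fun y => (ψ y : ℂ))) x = leviCoeff ψ j k x := by
  have hc : ContDiff ℝ (⊤ : ℕ∞) (fun y => (ψ y : ℂ)) :=
    contDiffOn_univ.1 (contDiff_ofReal_comp hψ.contDiffOn)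
  have hd : DifferentiableAt ℝ (fderiv ℝ fun y => (ψ y : ℂ)) x :=
    (hc.fderiv_right (m := (⊤ : ℕ∞)) le_rfl).differentiable (by simp) x
  exact ⟨wirtingerD_wirtingerDbar hd _ _, wirtingerDbar_wirtingerD hd
    (hc.contDiffAt.isSymmSndFDerivAt (by simpa using two_le_top)) _ _⟩

lemma dzb_dz_comm (hf : ContDiff ℝ (⊤ : ℕ∞) f) (j k : Fin n) (x : Cn n) :
    dzb k (dz j f) x = dz j (dzb k f) x := by
  have hd : DifferentiableAt ℝ (fderiv ℝ f) x :=
    (hf.fderiv_right (m := (⊤ : ℕ∞)) le_rfl).differentiable (by simp) x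
  exact (wirtingerDbar_wirtingerD hd
    (hf.contDiffAt.isSymmSndFDerivAt (by simpa using two_le_top)) _ _).trans
    (wirtingerD_wirtingerDbar hd _ _).symm

lemma dzb_dzb_comm (hf : ContDiff ℝ (⊤ : ℕ∞) f) (j k : Fin n) (x : Cn n) :
    dzb k (dzb j f) x = dzb j (dzb k f) x := by
  have hd : DifferentiableAt ℝ (fderiv ℝ f) x :=
    (hf.fderiv_right (m := (⊤ : ℕ∞)) le_rfl).differentiable (by simp) x
  exact wirtingerDbar_wirtingerDbar_comm hd
    (hf.contDiffAt.isSymmSndFDerivAt (by simpa using two_le_top)) _ _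

lemma dzb_dzTwist (hψ : ContDiff ℝ (⊤ : ℕ∞) ψ) (hf : ContDiff ℝ (⊤ : ℕ∞) f) (j k : Fin n)
    (x : Cn n) : dzb k (dzTwist ψ j f) x =
      dzTwist ψ j (dzb k f) x - leviCoeff ψ j k x * f x := by
  have hc : ContDiff ℝ (⊤ : ℕ∞) (fun y => (ψ y : ℂ)) :=
    contDiffOn_univ.1 (contDiff_ofReal_comp hψ.contDiffOn)
  have d1 := (contDiff_dz hf j).differentiable (by simp) x
  have d2 := (contDiff_dz hc j).differentiable (by simp) x
  have d3 := hf.differentiable (by simp) x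
  have e : dzTwist ψ j f = fun x => dz j f x - dz j (fun y => (ψ y : ℂ)) x * f x := rfl
  have h1 := dzb_dz_comm hf j k x
  have h2 := (dz_dzb_real hψ j k x).2
  unfold dzb at h1 h2
  rw [e, dzb, wirtingerDbar_sub d1 (d2.fun_mul d3), wirtingerDbar_mul d2 d3, h1, h2, dzTwist]
  change dz j (dzb k f) x - (leviCoeff ψ j k x * f x + dz j (fun y => (ψ y : ℂ)) x * dzb k f x) = _
  ring

/-- The Kohn–Morrey–Hörmander identity for a pair of components. -/
lemma integral_dzTwist_mul_conj_dzTwist (hψ : ContDiff ℝ (⊤ : ℕ∞) ψ) (hf : IsTest V f)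
    (hg : IsTest V g) (j k : Fin n) :
    ∫ x, dzTwist ψ j f x * (starRingEnd ℂ) (dzTwist ψ k g x) * (Real.exp (-ψ x) : ℂ) =
      (∫ x, dzb k f x * (starRingEnd ℂ) (dzb j g x) * (Real.exp (-ψ x) : ℂ)) +
      ∫ x, leviCoeff ψ j k x * f x * (starRingEnd ℂ) (g x) * (Real.exp (-ψ x) : ℂ) := by
  have hE := contDiffOn_univ.1 (contDiff_exp_neg hψ.contDiffOn)
  have hc : ContDiff ℝ (⊤ : ℕ∞) (fun y => (ψ y : ℂ)) :=
    contDiffOn_univ.1 (contDiff_ofReal_comp hψ.contDiffOn)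
  have hL : ContDiff ℝ (⊤ : ℕ∞) (fun x => leviCoeff ψ j k x) := by
    have := contDiff_dz (contDiff_dzb hc k) j
    exact (funext fun x => (dz_dzb_real hψ j k x).1) ▸ this
  have i1 : Integrable fun x => dzTwist ψ j (dzb k f) x * (starRingEnd ℂ) (g x) *
      (Real.exp (-ψ x) : ℂ) := by
    have := ((hg.conj.mul_left' ((hf.dzb k).dzTwist hψ j).smooth).mul_left' hE).integrable
    simpa only [mul_comm] using this
  have i2 : Integrable fun x => leviCoeff ψ j k x * f x * (starRingEnd ℂ) (g x) *
      (Real.exp (-ψ x) : ℂ) := by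
    have := ((hg.conj.mul_left' (hL.mul hf.smooth)).mul_left' hE).integrable
    simpa only [mul_comm] using this
  rw [integral_mul_conj_dzTwist hψ (hf.dzTwist hψ j).smooth hg]
  simp_rw [dzb_dzTwist hψ hf.smooth, sub_mul]
  rw [integral_sub i1 i2, integral_dzTwist_mul_conj hψ (hf.dzb k) hg.smooth]
  ring

end BasicIdentity

section SummedInequality

variable {n : ℕ} {V : Set (Cn n)} {ψ : Cn n → ℝ}

lemma contDiff_leviCoeff (hψ : ContDiff ℝ (⊤ : ℕ∞) ψ) (j k : Fin n) :
    ContDiff ℝ (⊤ : ℕ∞) (fun x => leviCoeff ψ j k x) := by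
  have hc : ContDiff ℝ (⊤ : ℕ∞) (fun y => (ψ y : ℂ)) :=
    contDiffOn_univ.1 (contDiff_ofReal_comp hψ.contDiffOn)
  have := contDiff_dz (contDiff_dzb hc k) j
  exact (funext fun x => (dz_dzb_real hψ j k x).1) ▸ this

lemma norm_sum_sq_eq_re {ι : Type*} [Fintype ι] (a : ι → ℂ) :
    ‖∑ j, a j‖ ^ 2 = (∑ j, ∑ k, a j * (starRingEnd ℂ) (a k)).re := by
  rw [← Complex.normSq_eq_norm_sq, ← Complex.ofReal_re (Complex.normSq _), ← Complex.mul_conj,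
    map_sum, Finset.sum_mul_sum]

lemma half_sum_norm_sub_sq {ι : Type*} [Fintype ι] (b : ι → ι → ℂ) :
    (1 / 2 : ℝ) * ∑ j, ∑ k, ‖b j k - b k j‖ ^ 2 =
      (∑ j, ∑ k, ‖b j k‖ ^ 2) - (∑ j, ∑ k, b k j * (starRingEnd ℂ) (b j k)).re := by
  have h : ∀ j k, ‖b j k - b k j‖ ^ 2 = ‖b j k‖ ^ 2 + ‖b k j‖ ^ 2 -
      2 * (b k j * (starRingEnd ℂ) (b j k)).re := by
    intro j k
    rw [← Complex.normSq_eq_norm_sq, ← Complex.normSq_eq_norm_sq, ← Complex.normSq_eq_norm_sq]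
    simp [Complex.normSq_apply]; ring
  simp_rw [h, Finset.sum_sub_distrib, Finset.sum_add_distrib, ← Finset.mul_sum, Complex.re_sum]
  rw [Finset.sum_comm (f := fun i j => ‖b j i‖ ^ 2)]
  ring

lemma integral_levi_le_of_isTest (hψ : ContDiff ℝ (⊤ : ℕ∞) ψ) {f : Fin n → Cn n → ℂ}
    (hf : ∀ j, IsTest V (f j)) :
    ∫ x, (∑ j, ∑ k, leviCoeff ψ j k x * f j x * (starRingEnd ℂ) (f k x)).re * Real.exp (-ψ x) ≤
      ∫ x, (‖∑ j, dzTwist ψ j (f j) x‖ ^ 2 +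
        (1 / 2) * ∑ j, ∑ k, ‖dzb j (f k) x - dzb k (f j) x‖ ^ 2) * Real.exp (-ψ x) := by
  have hE := contDiffOn_univ.1 (contDiff_exp_neg hψ.contDiffOn)
  have key := fun j k => integral_dzTwist_mul_conj_dzTwist hψ (hf j) (hf k) j k
  have iA : ∀ j k, Integrable fun x => dzTwist ψ j (f j) x * (starRingEnd ℂ) (dzTwist ψ k (f k) x)
      * (Real.exp (-ψ x) : ℂ) := fun j k => by
    have := ((((hf k).dzTwist hψ k).conj.mul_left' ((hf j).dzTwist hψ j).smooth).mul_left'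
      hE).integrable
    simpa only [mul_comm] using this
  have iB : ∀ j k, Integrable fun x => dzb k (f j) x * (starRingEnd ℂ) (dzb j (f k) x)
      * (Real.exp (-ψ x) : ℂ) := fun j k => by
    have := ((((hf k).dzb j).conj.mul_left' ((hf j).dzb k).smooth).mul_left' hE).integrable
    simpa only [mul_comm] using this
  have iN : ∀ j k, Integrable fun x => ‖dzb j (f k) x‖ ^ 2 * Real.exp (-ψ x) := fun j k => by
    have := ((((hf k).dzb j).conj.mul_left' ((hf k).dzb j).smooth).mul_left' hE).integrable.re
    refine this.congr (Eventually.of_forall fun x => ?_)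
    simp only [Complex.mul_conj, Complex.normSq_eq_norm_sq]
    rw [← Complex.ofReal_mul, mul_comm]; rfl
  have iL : ∀ j k, Integrable fun x => leviCoeff ψ j k x * f j x * (starRingEnd ℂ) (f k x)
      * (Real.exp (-ψ x) : ℂ) := fun j k => by
    have := (((hf k).conj.mul_left' ((contDiff_leviCoeff hψ j k).mul (hf j).smooth)).mul_left'
      hE).integrable
    simpa only [mul_comm] using this
  have iAs := integrable_finsetSum Finset.univ fun j _ =>
    integrable_finsetSum Finset.univ fun k _ => iA j k
  have iBs := integrable_finsetSum Finset.univ fun j _ =>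
    integrable_finsetSum Finset.univ fun k _ => iB j k
  have iLs := integrable_finsetSum Finset.univ fun j _ =>
    integrable_finsetSum Finset.univ fun k _ => iL j k
  have iNs := integrable_finsetSum Finset.univ fun j _ =>
    integrable_finsetSum Finset.univ fun k _ => iN j k
  have tot : ∫ x, (∑ j, ∑ k, dzTwist ψ j (f j) x * (starRingEnd ℂ) (dzTwist ψ k (f k) x)
      * (Real.exp (-ψ x) : ℂ)) = (∫ x, ∑ j, ∑ k, dzb k (f j) x * (starRingEnd ℂ) (dzb j (f k) x)
      * (Real.exp (-ψ x) : ℂ)) + ∫ x, ∑ j, ∑ k, leviCoeff ψ j k x * f j x *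
        (starRingEnd ℂ) (f k x) * (Real.exp (-ψ x) : ℂ) := by
    have sumint : ∀ {F : Fin n → Fin n → Cn n → ℂ}, (∀ j k, Integrable (F j k)) →
        ∫ x, ∑ j, ∑ k, F j k x = ∑ j, ∑ k, ∫ x, F j k x := by
      intro F hF
      rw [integral_finsetSum _ fun j _ => integrable_finsetSum _ fun k _ => hF j k]
      exact Finset.sum_congr rfl fun j _ => integral_finsetSum _ fun k _ => hF j k
    rw [sumint iA, sumint iB, sumint iL]
    simp_rw [key, Finset.sum_add_distrib]
  have tot' := congrArg Complex.re tot
  rw [Complex.add_re] at tot'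
  have re_int : ∀ {F : Cn n → ℂ}, Integrable F → (∫ x, F x).re = ∫ x, (F x).re :=
    fun hF => (integral_re hF).symm
  rw [re_int iAs, re_int iBs, re_int iLs] at tot'
  have e1 : ∀ x, (∑ j, ∑ k, leviCoeff ψ j k x * f j x * (starRingEnd ℂ) (f k x)).re *
      Real.exp (-ψ x) = (∑ j, ∑ k, leviCoeff ψ j k x * f j x *
        (starRingEnd ℂ) (f k x) * (Real.exp (-ψ x) : ℂ)).re := by
    intro x
    rw [← Complex.re_mul_ofReal]; simp_rw [Finset.sum_mul]
  have e2 : ∀ x, (‖∑ j, dzTwist ψ j (f j) x‖ ^ 2 +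
        (1 / 2) * ∑ j, ∑ k, ‖dzb j (f k) x - dzb k (f j) x‖ ^ 2) * Real.exp (-ψ x) =
      (∑ j, ∑ k, dzTwist ψ j (f j) x * (starRingEnd ℂ) (dzTwist ψ k (f k) x)
        * (Real.exp (-ψ x) : ℂ)).re - (∑ j, ∑ k, dzb k (f j) x * (starRingEnd ℂ) (dzb j (f k) x)
        * (Real.exp (-ψ x) : ℂ)).re + ∑ j, ∑ k, ‖dzb j (f k) x‖ ^ 2 * Real.exp (-ψ x) := by
    intro x
    rw [norm_sum_sq_eq_re, half_sum_norm_sub_sq fun j k => dzb j (f k) x]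
    simp_rw [← Finset.sum_mul, Complex.re_mul_ofReal]
    ring
  simp_rw [e1, e2]
  have h1 := integral_add (iAs.re.sub iBs.re) iNs
  have h2 := integral_sub iAs.re iBs.re
  have h3 : 0 ≤ ∫ x, ∑ j, ∑ k, ‖dzb j (f k) x‖ ^ 2 * Real.exp (-ψ x) :=
    integral_nonneg fun x => Finset.sum_nonneg fun j _ => Finset.sum_nonneg fun k _ => by positivity
  have h4 : ∫ x, ((∑ j, ∑ k, dzTwist ψ j (f j) x * (starRingEnd ℂ) (dzTwist ψ k (f k) x)
        * (Real.exp (-ψ x) : ℂ)).re - (∑ j, ∑ k, dzb k (f j) x * (starRingEnd ℂ) (dzb j (f k) x)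
        * (Real.exp (-ψ x) : ℂ)).re + ∑ j, ∑ k, ‖dzb j (f k) x‖ ^ 2 * Real.exp (-ψ x)) = 
      (∫ x, (∑ j, ∑ k, dzTwist ψ j (f j) x * (starRingEnd ℂ) (dzTwist ψ k (f k) x)
        * (Real.exp (-ψ x) : ℂ)).re) - (∫ x, (∑ j, ∑ k, dzb k (f j) x *
          (starRingEnd ℂ) (dzb j (f k) x) * (Real.exp (-ψ x) : ℂ)).re) +
        ∫ x, ∑ j, ∑ k, ‖dzb j (f k) x‖ ^ 2 * Real.exp (-ψ x) :=
    h1.trans (congrArg (· + _) h2)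
  rw [h4, tot']
  linarith

end SummedInequality

section Mollifier

variable {n : ℕ}

/-- An unnormalised radial bump function supported in the ball of radius `1 / (m + 1)`. -/
def radialBump (n m : ℕ) (y : Cn n) : ℝ :=
  Real.smoothTransition (1 - ((m : ℝ) + 1) ^ 2 * ∑ i, Complex.normSq (y i))

lemma radialBump_contDiff (m : ℕ) : ContDiff ℝ (⊤ : ℕ∞) (radialBump n m) := by
  have h1 : ∀ i : Fin n, ContDiff ℝ (⊤ : ℕ∞) (fun y : Cn n => Complex.normSq (y i)) := by
    intro i
    have hp : ContDiff ℝ (⊤ : ℕ∞) (fun y : Cn n => y i) :=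
      ((EuclideanSpace.proj (𝕜 := ℂ) i).restrictScalars ℝ).contDiff
    have hre := Complex.reCLM.contDiff.comp hp (n := (⊤ : ℕ∞))
    have him := Complex.imCLM.contDiff.comp hp (n := (⊤ : ℕ∞))
    simp_rw [Complex.normSq_apply]
    exact (hre.mul hre).add (him.mul him)
  exact Real.smoothTransition.contDiff.comp
    (contDiff_const.sub (contDiff_const.mul (ContDiff.sum fun i _ => h1 i)))

lemma radialBump_eq (m : ℕ) (y : Cn n) :
    radialBump n m y = Real.smoothTransition (1 - (((m : ℝ) + 1) * ‖y‖) ^ 2) := by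
  rw [radialBump, mul_pow, EuclideanSpace.norm_sq_eq]
  simp_rw [Complex.normSq_eq_norm_sq]

lemma radialBump_eq_zero {m : ℕ} {y : Cn n} (hy : 1 / ((m : ℝ) + 1) ≤ ‖y‖) :
    radialBump n m y = 0 := by
  rw [radialBump_eq]
  refine Real.smoothTransition.zero_of_nonpos ?_
  have : 1 ≤ ((m : ℝ) + 1) * ‖y‖ := by
    rw [div_le_iff₀ (by positivity)] at hy; linarith
  nlinarith

lemma radialBump_support (m : ℕ) :
    tsupport (radialBump n m) ⊆ closedBall 0 (1 / ((m : ℝ) + 1)) := by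
  refine closure_minimal (fun y hy => ?_) isClosed_closedBall
  by_contra h
  rw [mem_closedBall_zero_iff, not_le] at h
  exact hy (radialBump_eq_zero h.le)

lemma radialBump_compact (m : ℕ) : HasCompactSupport (radialBump n m) :=
  (isCompact_closedBall _ _).of_isClosed_subset (isClosed_tsupport _) (radialBump_support m)

lemma radialBump_nonneg (m : ℕ) (y : Cn n) : 0 ≤ radialBump n m y :=
  Real.smoothTransition.nonneg _

lemma radialBump_integrable (m : ℕ) : Integrable (radialBump n m) :=
  (radialBump_contDiff m).continuous.integrable_of_hasCompactSupport (radialBump_compact m)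

lemma radialBump_integral_pos (m : ℕ) : 0 < ∫ y, radialBump n m y := by
  refine (radialBump_contDiff m).continuous.integral_pos_of_hasCompactSupport_nonneg_nonzero
    (radialBump_compact m) (radialBump_nonneg m) (x := 0) ?_
  rw [radialBump_eq]
  simp

/-- The normalised radial mollifier, as a real function. -/
def mollReal (n m : ℕ) (y : Cn n) : ℝ := (∫ y, radialBump n m y)⁻¹ * radialBump n m y

/-- The normalised radial mollifier, as a complex function. -/
def moll (n m : ℕ) (y : Cn n) : ℂ := (mollReal n m y : ℂ)

lemma mollReal_nonneg (m : ℕ) (y : Cn n) : 0 ≤ mollReal n m y :=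
  mul_nonneg (inv_nonneg.2 (radialBump_integral_pos m).le) (radialBump_nonneg m y)

lemma mollReal_integrable (m : ℕ) : Integrable (mollReal n m) :=
  (radialBump_integrable m).const_mul _

lemma mollReal_integral (m : ℕ) : ∫ y, mollReal n m y = 1 := by
  simp_rw [mollReal, integral_const_mul]
  exact inv_mul_cancel₀ (radialBump_integral_pos m).ne'

lemma mollReal_contDiff (m : ℕ) : ContDiff ℝ (⊤ : ℕ∞) (mollReal n m) :=
  contDiff_const.mul (radialBump_contDiff m)

lemma moll_contDiff (m : ℕ) : ContDiff ℝ (⊤ : ℕ∞) (moll n m) :=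
  Complex.ofRealCLM.contDiff.comp (mollReal_contDiff m)

lemma moll_eq_zero {m : ℕ} {y : Cn n} (hy : 1 / ((m : ℝ) + 1) ≤ ‖y‖) : moll n m y = 0 := by
  simp [moll, mollReal, radialBump_eq_zero hy]

lemma moll_tsupport (m : ℕ) : tsupport (moll n m) ⊆ closedBall 0 (1 / ((m : ℝ) + 1)) := by
  refine closure_minimal (fun y hy => ?_) isClosed_closedBall
  by_contra h
  rw [mem_closedBall_zero_iff, not_le] at h
  exact hy (moll_eq_zero h.le)

lemma moll_compact (m : ℕ) : HasCompactSupport (moll n m) :=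
  (isCompact_closedBall _ _).of_isClosed_subset (isClosed_tsupport _) (moll_tsupport m)

lemma moll_congr_norm (m : ℕ) {x y : Cn n} (h : ‖x‖ = ‖y‖) : moll n m x = moll n m y := by
  simp only [moll, mollReal, radialBump_eq, h]

lemma moll_isTest (m : ℕ) : IsTest univ (moll n m) :=
  ⟨moll_contDiff m, moll_compact m, subset_univ _⟩

lemma moll_integral (m : ℕ) : ∫ y, moll n m y = 1 := by
  simp only [moll]
  rw [integral_complex_ofReal, mollReal_integral, Complex.ofReal_one]

/-- The reflected translate `t ↦ moll (x - t)` as a test function. -/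
lemma moll_translate_isTest (m : ℕ) (x : Cn n) {V : Set (Cn n)}
    (hx : closedBall x (1 / ((m : ℝ) + 1)) ⊆ V) : IsTest V (fun t => moll n m (x - t)) := by
  have hs : tsupport (fun t => moll n m (x - t)) ⊆ closedBall x (1 / ((m : ℝ) + 1)) := by
    refine closure_minimal (fun y hy => ?_) isClosed_closedBall
    by_contra h
    rw [mem_closedBall, not_le, dist_comm, dist_eq_norm] at h
    exact hy (moll_eq_zero h.le)
  exact ⟨(moll_contDiff m).comp (contDiff_const.sub contDiff_id),
    (isCompact_closedBall _ _).of_isClosed_subset (isClosed_tsupport _) hs, hs.trans hx⟩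

/-- Convolution with the radial mollifier. -/
def mollify (m : ℕ) (f : Cn n → ℂ) (x : Cn n) : ℂ := ∫ t, f t * moll n m (x - t)

variable {f g : Cn n → ℂ}

lemma mollify_eq_convolution (m : ℕ) (f : Cn n → ℂ) :
    mollify m f = convolution f (moll n m) (ContinuousLinearMap.mul ℝ ℂ) volume := rfl

lemma mollify_contDiff (m : ℕ) (hf : LocallyIntegrable f) :
    ContDiff ℝ (⊤ : ℕ∞) (mollify m f) :=
  mollify_eq_convolution m f ▸ (moll_compact m).contDiff_convolution_right
    (ContinuousLinearMap.mul ℝ ℂ) hf (moll_contDiff m)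

lemma integrable_mul_isTest (hf : LocallyIntegrable f) (hg : IsTest univ g) :
    Integrable fun t => f t * g t := by
  have h := hf.integrable_smul_right_of_hasCompactSupport hg.smooth.continuous hg.compact
  simpa only [smul_eq_mul] using h

lemma fderiv_mollify (m : ℕ) (hf : LocallyIntegrable f) (x v : Cn n) :
    fderiv ℝ (mollify m f) x v = -∫ t, f t * fderiv ℝ (fun t => moll n m (x - t)) t v := by
  have h := (moll_compact m).hasFDerivAt_convolution_right (ContinuousLinearMap.mul ℝ ℂ) hf
    ((moll_contDiff m).of_le (by exact_mod_cast le_top)) x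
  rw [mollify_eq_convolution, h.fderiv, convolution_def]
  have hD : IsTest univ (fun t => moll n m (x - t)) := moll_translate_isTest m x (subset_univ _)
  have hcc : HasCompactSupport (fun t => fderiv ℝ (moll n m) (x - t)) := by
    have := ((moll_compact (n := n) m).fderiv (𝕜 := ℝ)).comp_homeomorph (Homeomorph.subLeft x)
    exact this
  have hcont : Continuous (fun t => fderiv ℝ (moll n m) (x - t)) :=
    ((moll_contDiff m).continuous_fderiv (by simp)).comp (continuous_const.sub continuous_id)
  have hintg : Integrable (fun t => (((ContinuousLinearMap.mul ℝ ℂ).precompR (Cn n)) (f t))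
      (fderiv ℝ (moll n m) (x - t))) := by
    have := ((moll_compact (n := n) m).fderiv (𝕜 := ℝ)).convolutionExists_right
      ((ContinuousLinearMap.mul ℝ ℂ).precompR (Cn n)) hf
      ((moll_contDiff m).continuous_fderiv (by simp)) x
    exact this
  rw [ContinuousLinearMap.integral_apply hintg, ← integral_neg]
  refine integral_congr_ae (Eventually.of_forall fun t => ?_)
  have e : fderiv ℝ (fun t => moll n m (x - t)) t v = -fderiv ℝ (moll n m) (x - t) v := by
    have h1 : HasFDerivAt (fun t => x - t) (-(ContinuousLinearMap.id ℝ (Cn n))) t := by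
      simpa using (hasFDerivAt_id (𝕜 := ℝ) t).const_sub x
    have h2 := (((moll_contDiff m).differentiable (by simp) (x - t)).hasFDerivAt).comp t h1
    have h3 : fderiv ℝ (fun t => moll n m (x - t)) t = _ := h2.fderiv
    rw [h3]; simp
  simp only [e]
  simp [ContinuousLinearMap.precompR_apply]

lemma integrable_mul_fderiv_isTest (hf : LocallyIntegrable f) (hg : IsTest univ g) (v : Cn n) :
    Integrable fun t => f t * fderiv ℝ g t v := by
  have hc : Continuous fun t => fderiv ℝ g t v :=
    (hg.smooth.continuous_fderiv (by simp)).clm_apply continuous_const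
  have h := hf.integrable_smul_right_of_hasCompactSupport hc (hg.compact.fderiv_apply (𝕜 := ℝ) v)
  simpa only [smul_eq_mul] using h

lemma dz_mollify (m : ℕ) (hf : LocallyIntegrable f) (j : Fin n) (x : Cn n) :
    dz j (mollify m f) x = -∫ t, f t * dz j (fun t => moll n m (x - t)) t := by
  have hD : IsTest univ (fun t => moll n m (x - t)) := moll_translate_isTest m x (subset_univ _)
  set e : Cn n := EuclideanSpace.single j 1
  have i1 := integrable_mul_fderiv_isTest hf hD e
  have i2 := integrable_mul_fderiv_isTest hf hD (I • e)
  rw [dz, wirtingerD, fderiv_mollify m hf, fderiv_mollify m hf]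
  have : ∀ t, f t * dz j (fun t => moll n m (x - t)) t =
      (1 / 2 : ℂ) * (f t * fderiv ℝ (fun t => moll n m (x - t)) t e) -
      (I / 2) * (f t * fderiv ℝ (fun t => moll n m (x - t)) t (I • e)) := by
    intro t; simp only [dz, wirtingerD]; ring
  simp_rw [this]
  rw [integral_sub (i1.const_mul _) (i2.const_mul _), integral_const_mul, integral_const_mul]
  ring

lemma dzb_mollify (m : ℕ) (hf : LocallyIntegrable f) (j : Fin n) (x : Cn n) :
    dzb j (mollify m f) x = -∫ t, f t * dzb j (fun t => moll n m (x - t)) t := by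
  have hD : IsTest univ (fun t => moll n m (x - t)) := moll_translate_isTest m x (subset_univ _)
  set e : Cn n := EuclideanSpace.single j 1
  have i1 := integrable_mul_fderiv_isTest hf hD e
  have i2 := integrable_mul_fderiv_isTest hf hD (I • e)
  rw [dzb, wirtingerDbar, fderiv_mollify m hf, fderiv_mollify m hf]
  have : ∀ t, f t * dzb j (fun t => moll n m (x - t)) t =
      (1 / 2 : ℂ) * (f t * fderiv ℝ (fun t => moll n m (x - t)) t e) +
      (I / 2) * (f t * fderiv ℝ (fun t => moll n m (x - t)) t (I • e)) := by
    intro t; simp only [dzb, wirtingerDbar]; ring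
  simp_rw [this]
  rw [integral_add (i1.const_mul _) (i2.const_mul _), integral_const_mul, integral_const_mul]
  ring

lemma mollify_isTest (m : ℕ) (hf : LocallyIntegrable f) (hc : HasCompactSupport f) :
    IsTest univ (mollify m f) :=
  ⟨mollify_contDiff m hf, HasCompactSupport.convolution (ContinuousLinearMap.mul ℝ ℂ) hc
    (moll_compact m), subset_univ _⟩

end Mollifier

section MollifierConvergence

variable {n : ℕ} {f : Cn n → ℂ}

lemma tendsto_eLpNorm_translate_sub (hf : MemLp f 2 volume) :
    Tendsto (fun y : Cn n => eLpNorm (fun x => f (x - y) - f x) 2 volume) (𝓝 0) (𝓝 0) := by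
  let g : Cn n → C(Cn n, Cn n) := fun y => ⟨fun x => x - y, by fun_prop⟩
  have hg : Continuous g := ContinuousMap.continuous_of_continuous_uncurry _ (by
    change Continuous fun p : Cn n × Cn n => p.2 - p.1
    fun_prop)
  have hmp : ∀ y, MeasurePreserving (g y) (volume : Measure (Cn n)) volume := fun y =>
    measurePreserving_sub_right volume y
  have h := (Filter.Tendsto.compMeasurePreservingLp (tendsto_const_nhds (x := hf.toLp f))
    (hg.tendsto 0) hmp (hmp 0) (by simp) : Tendsto _ (𝓝 (0 : Cn n)) _)
  have e0 : Lp.compMeasurePreserving (g 0) (hmp 0) (hf.toLp f) = hf.toLp f := by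
    rw [Lp.toLp_compMeasurePreserving]
    congr 1
    ext x; simp [g]
  have ey : ∀ y, Lp.compMeasurePreserving (g y) (hmp y) (hf.toLp f) =
      (hf.comp_measurePreserving (hmp y)).toLp _ := fun y => Lp.toLp_compMeasurePreserving _ _
  rw [e0] at h
  simp_rw [ey] at h
  have := (Lp.tendsto_Lp_iff_tendsto_eLpNorm'' (fun y => f ∘ g y)
    (fun y => hf.comp_measurePreserving (hmp y)) f hf).1 h
  exact this

/-- The probability measure with density the mollifier. -/
def mollMeasure (n m : ℕ) : Measure (Cn n) :=
  volume.withDensity fun y => ENNReal.ofReal (mollReal n m y)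

lemma mollMeasure_density_measurable (m : ℕ) :
    Measurable fun y : Cn n => ENNReal.ofReal (mollReal n m y) :=
  (mollReal_contDiff m).continuous.measurable.ennreal_ofReal

instance (n m : ℕ) : IsProbabilityMeasure (mollMeasure n m) := by
  constructor
  rw [mollMeasure, withDensity_apply _ MeasurableSet.univ, Measure.restrict_univ,
    ← ofReal_integral_eq_lintegral_ofReal (mollReal_integrable m)
      (Eventually.of_forall (mollReal_nonneg m)), mollReal_integral, ENNReal.ofReal_one]

lemma mollMeasure_ac (m : ℕ) : mollMeasure n m ≪ volume := withDensity_absolutelyContinuous _ _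

lemma mollify_eq_integral_mollMeasure (m : ℕ) (f : Cn n → ℂ) (x : Cn n) :
    mollify m f x = ∫ y, f (x - y) ∂(mollMeasure n m) := by
  rw [mollMeasure, integral_withDensity_eq_integral_toReal_smul (mollMeasure_density_measurable m)
    (Eventually.of_forall fun _ => ENNReal.ofReal_lt_top), mollify,
    ← integral_sub_left_eq_self _ volume x]
  refine integral_congr_ae (Eventually.of_forall fun y => ?_)
  simp only [sub_sub_cancel, ENNReal.toReal_ofReal (mollReal_nonneg m y), moll]
  rw [mul_comm]; rfl

lemma mollMeasure_ae_lt (m : ℕ) : ∀ᵐ y ∂(mollMeasure n m), ‖y‖ < 1 / ((m : ℝ) + 1) := by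
  rw [mollMeasure, ae_withDensity_iff (mollMeasure_density_measurable m)]
  refine Eventually.of_forall fun y hy => ?_
  by_contra h
  exact hy (by simp [mollReal, radialBump_eq_zero (not_lt.1 h)])

lemma integrable_translate_mollMeasure (m : ℕ) (hf : LocallyIntegrable f) (x : Cn n) :
    Integrable (fun y => f (x - y)) (mollMeasure n m) := by
  rw [mollMeasure, integrable_withDensity_iff_integrable_smul'
    (mollMeasure_density_measurable m) (Eventually.of_forall fun _ => ENNReal.ofReal_lt_top)]
  have h := integrable_mul_isTest hf (moll_translate_isTest m x (subset_univ _))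
  have h2 := h.comp_sub_left x
  refine h2.congr (Eventually.of_forall fun y => ?_)
  simp only [sub_sub_cancel, ENNReal.toReal_ofReal (mollReal_nonneg m y), moll]
  rw [mul_comm]; rfl

lemma tendsto_eLpNorm_mollify_sub (hf : MemLp f 2 volume) :
    Tendsto (fun m => eLpNorm (mollify m f - f) 2 volume) atTop (𝓝 0) := by
  have hloc : LocallyIntegrable f := (hf.locallyIntegrable (by norm_num))
  have sq : ∀ {μ : Measure (Cn n)} (g : Cn n → ℂ), eLpNorm g 2 μ ^ 2 = ∫⁻ x, ‖g x‖ₑ ^ 2 ∂μ := by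
    intro μ g
    rw [eLpNorm_eq_lintegral_rpow_enorm_toReal (by norm_num) (by norm_num), ← ENNReal.rpow_natCast,
      ← ENNReal.rpow_mul]
    simp
  have meas : AEStronglyMeasurable (fun p : Cn n × Cn n => f (p.1 - p.2) - f p.1)
      (volume.prod volume) :=
    (hf.1.comp_quasiMeasurePreserving
      (quasiMeasurePreserving_sub_of_right_invariant volume volume)).sub
      (hf.1.comp_quasiMeasurePreserving Measure.quasiMeasurePreserving_fst)
  have key : ∀ m, eLpNorm (mollify m f - f) 2 volume ^ 2 ≤
      ∫⁻ y, eLpNorm (fun x => f (x - y) - f x) 2 volume ^ 2 ∂(mollMeasure n m) := by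
    intro m
    have meas' : AEStronglyMeasurable (fun p : Cn n × Cn n => f (p.1 - p.2) - f p.1)
        (volume.prod (mollMeasure n m)) :=
      meas.mono_ac (Measure.AbsolutelyContinuous.rfl.prod (mollMeasure_ac m))
    simp_rw [sq]
    rw [← lintegral_lintegral_swap (f := fun x y => ‖f (x - y) - f x‖ₑ ^ 2)
      (meas'.enorm.pow_const 2)]
    refine lintegral_mono_ae ?_
    filter_upwards [meas'.prodMk_left] with x hx
    have e1 : (mollify m f - f) x = ∫ y, (f (x - y) - f x) ∂(mollMeasure n m) := by
      rw [integral_sub (integrable_translate_mollMeasure m hloc x) (integrable_const _)]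
      simp [mollify_eq_integral_mollMeasure]
    calc ‖(mollify m f - f) x‖ₑ ^ 2
        ≤ (eLpNorm (fun y => f (x - y) - f x) 1 (mollMeasure n m)) ^ 2 := by
          rw [e1, eLpNorm_one_eq_lintegral_enorm]
          gcongr
          exact enorm_integral_le_lintegral_enorm _
      _ ≤ (eLpNorm (fun y => f (x - y) - f x) 2 (mollMeasure n m)) ^ 2 := by
          gcongr
          exact eLpNorm_le_eLpNorm_of_exponent_le (by norm_num) hx
      _ = _ := sq _
  rw [ENNReal.tendsto_nhds_zero]
  intro ε hε
  have h1 := ENNReal.tendsto_nhds_zero.1 (tendsto_eLpNorm_translate_sub hf) ε hε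
  obtain ⟨δ, hδ, hball⟩ := Metric.eventually_nhds_iff.1 h1
  obtain ⟨N, hN⟩ := exists_nat_one_div_lt hδ
  filter_upwards [eventually_ge_atTop N] with m hm
  have h2 : eLpNorm (mollify m f - f) 2 volume ^ 2 ≤ ε ^ 2 := by
    refine (key m).trans ?_
    calc _ ≤ ∫⁻ _, ε ^ 2 ∂(mollMeasure n m) := by
          refine lintegral_mono_ae ?_
          filter_upwards [mollMeasure_ae_lt m] with y hy
          gcongr
          refine hball ?_
          rw [dist_zero_right]
          refine hy.trans (lt_of_le_of_lt ?_ hN)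
          gcongr
      _ = ε ^ 2 := by simp
  exact (ENNReal.pow_le_pow_left_iff two_ne_zero).1 h2

lemma memLp_mollify (m : ℕ) (hf : LocallyIntegrable f) (hc : HasCompactSupport f) :
    MemLp (mollify m f) 2 volume :=
  (mollify_contDiff m hf).continuous.memLp_of_hasCompactSupport (mollify_isTest m hf hc).compact

/-- Convergence in `L²`. -/
structure TendstoL2 (F : ℕ → Cn n → ℂ) (f : Cn n → ℂ) : Prop where
  seq_mem : ∀ m, MemLp (F m) 2 volume
  lim_mem : MemLp f 2 volume
  tendsto : Tendsto (fun m => eLpNorm (F m - f) 2 volume) atTop (𝓝 0)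

lemma tendstoL2_mollify (hf : MemLp f 2 volume) (hc : HasCompactSupport f) :
    TendstoL2 (fun m => mollify m f) f :=
  ⟨fun m => memLp_mollify m (hf.locallyIntegrable (by norm_num)) hc, hf,
    tendsto_eLpNorm_mollify_sub hf⟩

variable {F G : ℕ → Cn n → ℂ} {g c : Cn n → ℂ}

lemma TendstoL2.sub (hF : TendstoL2 F f) (hG : TendstoL2 G g) :
    TendstoL2 (fun m x => F m x - G m x) (fun x => f x - g x) := by
  refine ⟨fun m => (hF.seq_mem m).sub (hG.seq_mem m), hF.lim_mem.sub hG.lim_mem, ?_⟩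
  have h := hF.tendsto.add hG.tendsto
  rw [add_zero] at h
  refine tendsto_of_tendsto_of_tendsto_of_le_of_le tendsto_const_nhds h (fun _ => zero_le)
    fun m => ?_
  have e : ((fun x => F m x - G m x) - fun x => f x - g x) = (F m - f) - (G m - g) := by
    ext x; simp; ring
  simp only [e]
  exact eLpNorm_sub_le ((hF.seq_mem m).sub hF.lim_mem).1 ((hG.seq_mem m).sub hG.lim_mem).1
    (by norm_num)

lemma TendstoL2.bdd_mul (hF : TendstoL2 F f) (hc : Continuous c) {B : ℝ} (hB : ∀ x, ‖c x‖ ≤ B) :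
    TendstoL2 (fun m x => c x * F m x) (fun x => c x * f x) := by
  have mem : ∀ {h : Cn n → ℂ}, MemLp h 2 volume → MemLp (fun x => c x * h x) 2 volume :=
    fun hh => hh.of_le_mul (c := B) (hc.aestronglyMeasurable.mul hh.1)
      (Eventually.of_forall fun x => by
        rw [norm_mul]; exact mul_le_mul_of_nonneg_right (hB x) (norm_nonneg _))
  refine ⟨fun m => mem (hF.seq_mem m), mem hF.lim_mem, ?_⟩
  have h := ENNReal.Tendsto.const_mul hF.tendsto (a := ENNReal.ofReal B)
    (Or.inr ENNReal.ofReal_ne_top)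
  rw [mul_zero] at h
  refine tendsto_of_tendsto_of_tendsto_of_le_of_le tendsto_const_nhds h (fun _ => zero_le)
    fun m => ?_
  refine eLpNorm_le_mul_eLpNorm_of_ae_le_mul (Eventually.of_forall fun x => ?_) 2
  have : ((fun x => c x * F m x) - fun x => c x * f x) x = c x * (F m - f) x := by
    simp; ring
  rw [this, norm_mul]
  exact mul_le_mul_of_nonneg_right (hB x) (norm_nonneg _)

lemma TendstoL2.integral_mul_conj (hF : TendstoL2 F f) (hG : TendstoL2 G g) :
    Tendsto (fun m => ∫ x, F m x * (starRingEnd ℂ) (G m x)) atTop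
      (𝓝 (∫ x, f x * (starRingEnd ℂ) (g x))) := by
  have h1 := (Lp.tendsto_Lp_iff_tendsto_eLpNorm'' F hF.seq_mem f hF.lim_mem).2 hF.tendsto
  have h2 := (Lp.tendsto_Lp_iff_tendsto_eLpNorm'' G hG.seq_mem g hG.lim_mem).2 hG.tendsto
  have h := h2.inner h1 (𝕜 := ℂ)
  have e : ∀ {u v : Cn n → ℂ} (hu : MemLp u 2 volume) (hv : MemLp v 2 volume),
      inner ℂ (hv.toLp v) (hu.toLp u) = ∫ x, u x * (starRingEnd ℂ) (v x) := by
    intro u v hu hv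
    rw [L2.inner_def]
    refine integral_congr_ae ?_
    filter_upwards [hu.coeFn_toLp, hv.coeFn_toLp] with x h1 h2
    rw [h1, h2, RCLike.inner_apply]
  simp_rw [e] at h
  exact h

end MollifierConvergence

section WeakInequality

variable {n : ℕ} {ψ : Cn n → ℝ}

lemma integrable_mul_conj_of_memLp {μ : Measure (Cn n)} {u v : Cn n → ℂ} (hu : MemLp u 2 μ)
    (hv : MemLp v 2 μ) : Integrable (fun x => u x * (starRingEnd ℂ) (v x)) μ :=
  hu.integrable_mul (q := 2) hv.star

lemma memLp_bdd_mul {μ : Measure (Cn n)} {c h : Cn n → ℂ} (hh : MemLp h 2 μ)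
    (hc : AEStronglyMeasurable c μ) {B : ℝ} (hB : ∀ x, ‖c x‖ ≤ B) :
    MemLp (fun x => c x * h x) 2 μ :=
  hh.of_le_mul (c := B) (hc.mul hh.1)
    (Eventually.of_forall fun x => by
        rw [norm_mul]; exact mul_le_mul_of_nonneg_right (hB x) (norm_nonneg _))

/-- A continuous weighted sesquilinear expression converges under `L²` convergence. -/
lemma TendstoL2.tendsto_quad {F G : ℕ → Cn n → ℂ} {f g : Cn n → ℂ} (hF : TendstoL2 F f)
    (hG : TendstoL2 G g) {c : Cn n → ℂ} (hc : Continuous c) {B : ℝ} (hB : ∀ x, ‖c x‖ ≤ B) :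
    Tendsto (fun m => ∫ x, c x * F m x * (starRingEnd ℂ) (G m x)) atTop
      (𝓝 (∫ x, c x * f x * (starRingEnd ℂ) (g x))) :=
  (hF.bdd_mul hc hB).integral_mul_conj hG

lemma TendstoL2.sum {ι : Type*} (s : Finset ι) {F : ι → ℕ → Cn n → ℂ} {f : ι → Cn n → ℂ}
    (h : ∀ i ∈ s, TendstoL2 (F i) (f i)) :
    TendstoL2 (fun m x => ∑ i ∈ s, F i m x) (fun x => ∑ i ∈ s, f i x) := by
  classical
  have zero : TendstoL2 (n := n) (fun _ _ => 0) (fun _ => 0) :=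
    ⟨fun _ => MemLp.zero', MemLp.zero', by
      have : ((fun _ => 0 : Cn n → ℂ) - fun _ => 0) = 0 := by ext; simp
      simp only [this, eLpNorm_zero]
      exact tendsto_const_nhds⟩
  induction s using Finset.induction_on with
  | empty => simpa using zero
  | insert a s ha ih =>
    simp only [Finset.sum_insert ha]
    have h1 := h a (Finset.mem_insert_self _ _)
    have h2 := (zero.sub (ih fun i hi => h i (Finset.mem_insert_of_mem hi)))
    simpa using h1.sub h2

lemma norm_sq_mul_eq_re (u : ℂ) (r : ℝ) :
    ‖u‖ ^ 2 * r = ((r : ℂ) * u * (starRingEnd ℂ) u).re := by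
  rw [mul_assoc, Complex.mul_conj, Complex.re_ofReal_mul, Complex.ofReal_re,
    Complex.normSq_eq_norm_sq, mul_comm]

lemma TendstoL2.tendsto_norm_sq {F : ℕ → Cn n → ℂ} {f : Cn n → ℂ} (hF : TendstoL2 F f)
    {w : Cn n → ℝ} (hc : Continuous w) {B : ℝ} (hB : ∀ x, ‖w x‖ ≤ B) :
    Tendsto (fun m => ∫ x, ‖F m x‖ ^ 2 * w x) atTop (𝓝 (∫ x, ‖f x‖ ^ 2 * w x)) := by
  have hc' : Continuous fun x => (w x : ℂ) := Complex.continuous_ofReal.comp hc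
  have hB' : ∀ x, ‖(w x : ℂ)‖ ≤ B := fun x => by simpa using hB x
  have h := hF.tendsto_quad hF hc' hB'
  have e : ∀ {u : Cn n → ℂ}, MemLp u 2 volume → ∫ x, ‖u x‖ ^ 2 * w x =
      (∫ x, (w x : ℂ) * u x * (starRingEnd ℂ) (u x)).re := by
    intro u hu
    simp_rw [norm_sq_mul_eq_re]
    exact integral_re (integrable_mul_conj_of_memLp
      (memLp_bdd_mul hu hc'.aestronglyMeasurable hB') hu)
  rw [e hF.lim_mem]
  simp_rw [fun m => e (hF.seq_mem m)]
  exact (Complex.continuous_re.tendsto _).comp h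

lemma memLp_norm_sq_integrable {μ : Measure (Cn n)} {u : Cn n → ℂ} (hu : MemLp u 2 μ)
    {w : Cn n → ℝ} (hc : AEStronglyMeasurable w μ) {B : ℝ} (hB : ∀ x, ‖w x‖ ≤ B) :
    Integrable (fun x => ‖u x‖ ^ 2 * w x) μ := by
  have := (integrable_mul_conj_of_memLp
      (memLp_bdd_mul hu (Complex.continuous_ofReal.comp_aestronglyMeasurable hc)
        (B := B) (fun x => by simpa using hB x)) hu).re
  refine this.congr (Eventually.of_forall fun x => ?_)
  simp only [norm_sq_mul_eq_re]; rfl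

lemma exp_neg_bounded (hψ : ContDiff ℝ (⊤ : ℕ∞) ψ) (hψc : HasCompactSupport ψ) :
    ∃ B, ∀ x, ‖Real.exp (-ψ x)‖ ≤ B := by
  obtain ⟨B, hB⟩ := hψc.exists_bound_of_continuous hψ.continuous
  refine ⟨Real.exp B, fun x => ?_⟩
  rw [Real.norm_eq_abs, abs_of_pos (Real.exp_pos _)]
  exact Real.exp_le_exp.2 ((neg_le_abs _).trans (hB x))

lemma hasCompactSupport_dz {f : Cn n → ℂ} (hf : HasCompactSupport f) (j : Fin n) :
    HasCompactSupport (dz j f) ∧ HasCompactSupport (dzb j f) :=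
  ⟨hf.mono' (support_wirtinger_subset f _).1, hf.mono' (support_wirtinger_subset f _).2⟩

/-- The basic `L²` inequality for compactly supported forms with weak divergence and curl
in `L²`. -/
theorem integral_levi_le_of_weak (hψ : ContDiff ℝ (⊤ : ℕ∞) ψ) (hψc : HasCompactSupport ψ)
    {g : Fin n → Cn n → ℂ} {G : Cn n → ℂ} {C : Fin n → Fin n → Cn n → ℂ}
    (hg : ∀ j, MemLp (g j) 2 volume) (hgc : ∀ j, HasCompactSupport (g j))
    (hG : MemLp G 2 volume) (hGc : HasCompactSupport G)
    (hC : ∀ j k, MemLp (C j k) 2 volume) (hCc : ∀ j k, HasCompactSupport (C j k))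
    (hdiv : ∀ χ, IsTest univ χ → ∫ x, ∑ j, g j x * dz j χ x = -∫ x, G x * χ x)
    (hcurl : ∀ j k χ, IsTest univ χ →
      ∫ x, (g k x * dzb j χ x - g j x * dzb k χ x) = -∫ x, C j k x * χ x) :
    ∫ x, (∑ j, ∑ k, leviCoeff ψ j k x * g j x * (starRingEnd ℂ) (g k x)).re * Real.exp (-ψ x) ≤
      ∫ x, (‖G x - ∑ j, dz j (fun y => (ψ y : ℂ)) x * g j x‖ ^ 2 +
        (1 / 2) * ∑ j, ∑ k, ‖C j k x‖ ^ 2) * Real.exp (-ψ x) := by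
  have hloc : ∀ j, LocallyIntegrable (g j) := fun j => (hg j).locallyIntegrable (by norm_num)
  have hc : ContDiff ℝ (⊤ : ℕ∞) (fun y => (ψ y : ℂ)) :=
    contDiffOn_univ.1 (contDiff_ofReal_comp hψ.contDiffOn)
  have hcc : HasCompactSupport (fun y => (ψ y : ℂ)) := hψc.comp_left Complex.ofReal_zero
  obtain ⟨BE, hBE⟩ := exp_neg_bounded hψ hψc
  have hEc : Continuous fun x => Real.exp (-ψ x) := hψ.continuous.neg.rexp
  have hLc : ∀ j k, HasCompactSupport fun x => leviCoeff ψ j k x := fun j k => by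
    have := (hasCompactSupport_dz (hasCompactSupport_dz hcc k).2 j).1
    exact (funext fun x => (dz_dzb_real hψ j k x).1) ▸ this
  let cf : Fin n → Fin n → Cn n → ℂ := fun j k x => leviCoeff ψ j k x * (Real.exp (-ψ x) : ℂ)
  have hcf : ∀ j k, Continuous (cf j k) := fun j k =>
    (contDiff_leviCoeff hψ j k).continuous.mul (Complex.continuous_ofReal.comp hEc)
  have hcfB : ∀ j k, ∃ B, ∀ x, ‖cf j k x‖ ≤ B := fun j k =>
    (hLc j k).mul_right.exists_bound_of_continuous (hcf j k)
  choose BL hBL using hcfB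
  have hdB : ∀ j, ∃ B, ∀ x, ‖dz j (fun y => (ψ y : ℂ)) x‖ ≤ B := fun j =>
    (hasCompactSupport_dz hcc j).1.exists_bound_of_continuous (contDiff_dz hc j).continuous
  choose Bd hBd using hdB
  let f : ℕ → Fin n → Cn n → ℂ := fun m j => mollify m (g j)
  have hf : ∀ m j, IsTest univ (f m j) := fun m j => mollify_isTest m (hloc j) (hgc j)
  have tg : ∀ j, TendstoL2 (fun m => f m j) (g j) := fun j => tendstoL2_mollify (hg j) (hgc j)
  have tG := tendstoL2_mollify hG hGc
  have tC := fun j k => tendstoL2_mollify (hC j k) (hCc j k)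
  have tDiv : TendstoL2 (fun m x => mollify m G x - ∑ j, dz j (fun y => (ψ y : ℂ)) x * f m j x)
      (fun x => G x - ∑ j, dz j (fun y => (ψ y : ℂ)) x * g j x) :=
    tG.sub (TendstoL2.sum _ fun j _ => (tg j).bdd_mul (contDiff_dz hc j).continuous (hBd j))
  have eDiv : ∀ m x, ∑ j, dzTwist ψ j (f m j) x =
      mollify m G x - ∑ j, dz j (fun y => (ψ y : ℂ)) x * f m j x := by
    intro m x
    simp only [dzTwist, Finset.sum_sub_distrib]
    congr 1
    have hχ : IsTest univ fun t => moll n m (x - t) := moll_translate_isTest m x (subset_univ _)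
    have h := hdiv _ hχ
    rw [integral_finsetSum _ fun j _ => integrable_mul_isTest (hloc j) (hχ.dz j)] at h
    simp only [f, fun j => dz_mollify m (hloc j) j x]
    rw [Finset.sum_neg_distrib, h, neg_neg]; rfl
  have eCurl : ∀ m j k x, dzb j (f m k) x - dzb k (f m j) x = mollify m (C j k) x := by
    intro m j k x
    have hχ : IsTest univ fun t => moll n m (x - t) := moll_translate_isTest m x (subset_univ _)
    have h := hcurl j k _ hχ
    rw [integral_sub (integrable_mul_isTest (hloc k) (hχ.dzb j))
      (integrable_mul_isTest (hloc j) (hχ.dzb k))] at h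
    simp only [f, dzb_mollify m (hloc k) j x, dzb_mollify m (hloc j) k x]
    rw [mollify, ← neg_eq_iff_eq_neg.2 h]; ring
  have quad : ∀ {u : Fin n → Cn n → ℂ}, (∀ j, MemLp (u j) 2 volume) →
      ∫ x, (∑ j, ∑ k, leviCoeff ψ j k x * u j x * (starRingEnd ℂ) (u k x)).re * Real.exp (-ψ x)
        = ∑ j, ∑ k, (∫ x, cf j k x * u j x * (starRingEnd ℂ) (u k x)).re := by
    intro u hu
    have hintg : ∀ j k, Integrable fun x => (cf j k x * u j x * (starRingEnd ℂ) (u k x)).re :=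
      fun j k => (integrable_mul_conj_of_memLp (memLp_bdd_mul (hu j)
        (hcf j k).aestronglyMeasurable (hBL j k)) (hu k)).re
    have e : ∀ x, (∑ j, ∑ k, leviCoeff ψ j k x * u j x * (starRingEnd ℂ) (u k x)).re *
        Real.exp (-ψ x) = ∑ j, ∑ k, (cf j k x * u j x * (starRingEnd ℂ) (u k x)).re := by
      intro x
      rw [← Complex.re_mul_ofReal]
      simp_rw [Finset.sum_mul, Complex.re_sum]
      refine Finset.sum_congr rfl fun j _ => Finset.sum_congr rfl fun k _ => ?_
      simp only [cf]; congr 1; ring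
    simp_rw [e]
    rw [integral_finsetSum _ fun j _ => integrable_finsetSum _ fun k _ => hintg j k]
    refine Finset.sum_congr rfl fun j _ => ?_
    rw [integral_finsetSum _ fun k _ => hintg j k]
    refine Finset.sum_congr rfl fun k _ => ?_
    exact integral_re (integrable_mul_conj_of_memLp (memLp_bdd_mul (hu j)
        (hcf j k).aestronglyMeasurable (hBL j k)) (hu k))
  have rhs : ∀ {u : Cn n → ℂ} {v : Fin n → Fin n → Cn n → ℂ}, MemLp u 2 volume →
      (∀ j k, MemLp (v j k) 2 volume) →
      ∫ x, (‖u x‖ ^ 2 + (1 / 2) * ∑ j, ∑ k, ‖v j k x‖ ^ 2) * Real.exp (-ψ x) =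
        (∫ x, ‖u x‖ ^ 2 * Real.exp (-ψ x)) +
          (1 / 2) * ∑ j, ∑ k, ∫ x, ‖v j k x‖ ^ 2 * Real.exp (-ψ x) := by
    intro u v hu hv
    have i1 := memLp_norm_sq_integrable hu hEc.aestronglyMeasurable hBE
    have i2 := fun j k => memLp_norm_sq_integrable (hv j k) hEc.aestronglyMeasurable hBE
    simp_rw [add_mul, mul_assoc, Finset.sum_mul]
    rw [integral_add i1 ((integrable_finsetSum _ fun j _ =>
      integrable_finsetSum _ fun k _ => i2 j k).const_mul _), integral_const_mul,
      integral_finsetSum _ fun j _ => integrable_finsetSum _ fun k _ => i2 j k]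
    simp_rw [fun j => integral_finsetSum Finset.univ fun k _ => i2 j k]
  have ineq : ∀ m, _ := fun m => integral_levi_le_of_isTest hψ (hf m)
  simp_rw [eDiv, eCurl] at ineq
  rw [quad hg, rhs tDiv.lim_mem hC]
  refine le_of_tendsto_of_tendsto'
    (f := fun m => ∑ j, ∑ k, (∫ x, cf j k x * f m j x * (starRingEnd ℂ) (f m k x)).re)
    (g := fun m => (∫ x, ‖mollify m G x - ∑ j, dz j (fun y => (ψ y : ℂ)) x * f m j x‖ ^ 2 *
      Real.exp (-ψ x)) + (1 / 2) * ∑ j, ∑ k, ∫ x, ‖mollify m (C j k) x‖ ^ 2 * Real.exp (-ψ x))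
    (b := atTop) ?_ ?_ ?_
  · exact tendsto_finsetSum _ fun j _ => tendsto_finsetSum _ fun k _ =>
      (Complex.continuous_re.tendsto _).comp ((tg j).tendsto_quad (tg k) (hcf j k) (hBL j k))
  · exact (tDiv.tendsto_norm_sq hEc hBE).add (tendsto_const_nhds.mul
      (tendsto_finsetSum _ fun j _ => tendsto_finsetSum _ fun k _ =>
        (tC j k).tendsto_norm_sq hEc hBE))
  · intro m
    have h := ineq m
    rwa [quad fun j => (tg j).seq_mem m, rhs (tDiv.seq_mem m) fun j k => (tC j k).seq_mem m] at h

end WeakInequality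

section Cutoff

/-- A smooth cutoff equal to one near a compact set and compactly supported in an open one. -/
lemma exists_cutoff {E : Type*} [NormedAddCommGroup E] [NormedSpace ℝ E] [FiniteDimensional ℝ E]
    {K V : Set E} (hK : IsCompact K) (hV : IsOpen V) (hKV : K ⊆ V) :
    ∃ κ : E → ℝ, ContDiff ℝ (⊤ : ℕ∞) κ ∧ HasCompactSupport κ ∧ tsupport κ ⊆ V ∧
      (∀ᶠ x in 𝓝ˢ K, κ x = 1) ∧ ∀ x, κ x ∈ Icc (0 : ℝ) 1 := by
  obtain ⟨L, hL, hKL, hLV⟩ := exists_compact_between hK hV hKV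
  obtain ⟨f, hf1, hf0, hf⟩ := exists_contMDiffMap_one_nhds_of_subset_interior
    (n := (⊤ : ℕ∞)) (modelWithCornersSelf ℝ E) hK.isClosed hKL
  have hs : tsupport f ⊆ L := closure_minimal (fun x hx => by
    by_contra h; exact hx (hf0 x h)) hL.isClosed
  exact ⟨f, f.contMDiff.contDiff, hL.of_isClosed_subset (isClosed_tsupport _) hs, hs.trans hLV,
    hf1, hf⟩

end Cutoff

section SingleCutoff

variable {n : ℕ} {V : Set (Cn n)} {ψ : Cn n → ℝ}

/-- The weight `e^{cψ}` as a complex function. -/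
def ew (ψ : Cn n → ℝ) (c : ℝ) (x : Cn n) : ℂ := (Real.exp (c * ψ x) : ℂ)

lemma ew_mul (c d : ℝ) (x : Cn n) : ew ψ c x * ew ψ d x = ew ψ (c + d) x := by
  simp only [ew, ← Complex.ofReal_mul, ← Real.exp_add, add_mul]

lemma ew_zero (x : Cn n) : ew ψ 0 x = 1 := by simp [ew]

lemma ew_conj (c : ℝ) (x : Cn n) : (starRingEnd ℂ) (ew ψ c x) = ew ψ c x := by
  simp only [ew, Complex.conj_ofReal]

lemma norm_ew (c : ℝ) (x : Cn n) : ‖ew ψ c x‖ = Real.exp (c * ψ x) := by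
  simp only [ew, Complex.norm_real, Real.norm_eq_abs, Real.abs_exp]

lemma contDiffOn_ew {s : Set (Cn n)} (hψ : ContDiffOn ℝ (⊤ : ℕ∞) ψ s) (c : ℝ) :
    ContDiffOn ℝ (⊤ : ℕ∞) (ew ψ c) s :=
  Complex.ofRealCLM.contDiff.comp_contDiffOn
    (Real.contDiff_exp.comp_contDiffOn (contDiffOn_const.mul hψ))

lemma dz_ew {x : Cn n} (hψ : DifferentiableAt ℝ ψ x) (c : ℝ) (j : Fin n) :
    dz j (ew ψ c) x = c * dz j (fun y => (ψ y : ℂ)) x * ew ψ c x := by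
  have h : HasDerivAt (fun r : ℝ => Real.exp (c * r)) (Real.exp (c * ψ x) * c) (ψ x) := by
    simpa using ((hasDerivAt_id (ψ x)).const_mul c).exp
  have := wirtingerD_comp_ofReal hψ h (EuclideanSpace.single j 1)
  simp only [dz]
  rw [show ew ψ c = fun y => (Real.exp (c * ψ y) : ℂ) from rfl, this]
  push_cast; ring

lemma differentiableAt_of_contDiffOn {F G : Type*} [NormedAddCommGroup F] [NormedSpace ℝ F]
    [NormedAddCommGroup G] [NormedSpace ℝ G] {s : Set F} {f : F → G} (hs : IsOpen s)
    (hf : ContDiffOn ℝ (⊤ : ℕ∞) f s) {x : F} (hx : x ∈ s) : DifferentiableAt ℝ f x :=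
  (hf.contDiffAt (hs.mem_nhds hx)).differentiableAt (by simp)

lemma dz_congr {f g : Cn n → ℂ} {x : Cn n} (h : f =ᶠ[𝓝 x] g) (j : Fin n) :
    dz j f x = dz j g x ∧ dzb j f x = dzb j g x := by
  simp only [dz, dzb, wirtingerD, wirtingerDbar, h.fderiv_eq, and_self]

lemma leviCoeff_congr {f g : Cn n → ℝ} {x : Cn n} (h : f =ᶠ[𝓝 x] g) (j k : Fin n) :
    leviCoeff f j k x = leviCoeff g j k x := by
  have h' : (fun y => (f y : ℂ)) =ᶠ[𝓝 x] fun y => (g y : ℂ) := h.mono fun y hy => by simp [hy]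
  simp only [leviCoeff, leviForm, h'.fderiv.fderiv_eq]

/-- The Lagrange identity. -/
lemma half_sum_norm_sub_sq_eq (p a : Fin n → ℂ) :
    (1 / 2) * ∑ j, ∑ k, ‖p j * a k - p k * a j‖ ^ 2 =
      (∑ j, ‖p j‖ ^ 2) * (∑ j, ‖a j‖ ^ 2) - ‖∑ j, (starRingEnd ℂ) (p j) * a j‖ ^ 2 := by
  rw [half_sum_norm_sub_sq fun j k => p j * a k, norm_sum_sq_eq_re, Finset.sum_mul_sum]
  congr 1
  · simp_rw [norm_mul, mul_pow]
  · congr 1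
    refine Finset.sum_congr rfl fun j _ => Finset.sum_congr rfl fun k _ => ?_
    simp only [map_mul, Complex.conj_conj]; ring

lemma hasCompactSupport_sum {u : Fin n → Cn n → ℂ} (hu : ∀ j, HasCompactSupport (u j)) :
    HasCompactSupport fun x => ∑ j, u j x := by
  classical
  suffices h : ∀ s : Finset (Fin n), HasCompactSupport fun x => ∑ j ∈ s, u j x from h _
  intro s
  induction s using Finset.induction_on with
  | empty => exact HasCompactSupport.zero
  | insert a s ha ih =>
    simp only [Finset.sum_insert ha]
    exact (hu a).add ih

lemma IsTest.memLp_mul {c h : Cn n → ℂ} (hc : IsTest V c) (hh : MemLp h 2 volume) :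
    MemLp (fun x => c x * h x) 2 volume ∧ HasCompactSupport fun x => c x * h x := by
  obtain ⟨B, hB⟩ := hc.compact.exists_bound_of_continuous hc.smooth.continuous
  exact ⟨memLp_bdd_mul hh hc.smooth.continuous.aestronglyMeasurable hB, hc.compact.mul_right⟩

lemma IsTest.memLp {c : Cn n → ℂ} (hc : IsTest V c) : MemLp c 2 volume :=
  hc.smooth.continuous.memLp_of_hasCompactSupport hc.compact

lemma IsTest.dz_eq_zero {c : Cn n → ℂ} {x : Cn n} (hx : x ∉ tsupport c) (j : Fin n) :
    Berndtsson.dz j c x = 0 ∧ Berndtsson.dzb j c x = 0 :=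
  ⟨by_contra fun h => hx ((support_wirtinger_subset c _).1 h),
    by_contra fun h => hx ((support_wirtinger_subset c _).2 h)⟩

/-- The basic inequality applied to `ησα`, where `α` is a square integrable form with
`σ⁻¹α` of weak divergence `v` and `σα` weakly `∂̄`-closed, `σ = e^{ψ/2}`. -/
theorem integral_levi_cutoff_le (hV : IsOpen V) (hψ : ContDiffOn ℝ (⊤ : ℕ∞) ψ V) {η : Cn n → ℝ}
    (hη : IsTest V fun x => (η x : ℂ)) {v : Cn n → ℂ} (hv : IsTest V v) {α : Fin n → Cn n → ℂ}
    (hα : ∀ j, MemLp (α j) 2 volume)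
    (hdiv : ∀ χ, IsTest V χ → ∫ x, ∑ j, ew ψ (-1 / 2) x * α j x * dz j χ x = -∫ x, v x * χ x)
    (hcurl : ∀ j k χ, IsTest V χ →
      ∫ x, ew ψ (1 / 2) x * (α k x * dzb j χ x - α j x * dzb k χ x) = 0) :
    ∫ x, η x ^ 2 * (∑ j, ∑ k, leviCoeff ψ j k x * α j x * (starRingEnd ℂ) (α k x)).re ≤
      ∫ x, (‖η x * ew ψ (1 / 2) x * v x + ∑ j, dz j (fun y => (η y : ℂ)) x * α j x‖ ^ 2 +
        (1 / 2) * ∑ j, ∑ k, ‖dzb j (fun y => (η y : ℂ)) x * α k x -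
          dzb k (fun y => (η y : ℂ)) x * α j x‖ ^ 2) := by
  obtain ⟨κ, hκ, hκc, hκV, hκ1, -⟩ := exists_cutoff hη.compact hV hη.subset
  set ηc : Cn n → ℂ := fun x => (η x : ℂ) with hηc
  have hψd : ContDiffOn ℝ (⊤ : ℕ∞) (fun y => (ψ y : ℂ)) V := contDiff_ofReal_comp hψ
  have hκt : IsTest V fun x => (κ x : ℂ) :=
    ⟨contDiffOn_univ.1 (contDiff_ofReal_comp hκ.contDiffOn), hκc.comp_left Complex.ofReal_zero,
      (closure_mono fun x hx => by simpa using hx).trans hκV⟩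
  have hψt := hκt.mul_left hV hψd
  set ψ' : Cn n → ℝ := fun x => ((ψ x : ℂ) * (κ x : ℂ)).re with hψ'
  have hψ's : ContDiff ℝ (⊤ : ℕ∞) ψ' := Complex.reCLM.contDiff.comp hψt.smooth
  have hψ'c : HasCompactSupport ψ' := hψt.compact.comp_left Complex.zero_re
  have hev : ∀ x ∈ tsupport ηc, ψ' =ᶠ[𝓝 x] ψ := fun x hx => by
    have : ∀ᶠ y in 𝓝 x, κ y = 1 := (eventually_nhdsSet_iff_forall.1 hκ1) x hx
    filter_upwards [this] with y hy
    simp [hψ', hy]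
  have hdψ : ∀ j, ContDiffOn ℝ (⊤ : ℕ∞) (dz j fun y => (ψ y : ℂ)) V := fun j =>
    contDiffOn_wirtingerD hV hψd _
  have tη : ∀ c, IsTest V fun x => ew ψ c x * ηc x := fun c =>
    hη.mul_left hV (contDiffOn_ew hψ c)
  have tD : ∀ j, IsTest V fun x => ew ψ (1 / 2) x *
      (dz j (fun y => (ψ y : ℂ)) x * ηc x + dz j ηc x) := fun j =>
    ((hη.mul_left hV (hdψ j)).add (hη.dz j)).mul_left hV (contDiffOn_ew hψ _)
  have tB : ∀ j, IsTest V fun x => ew ψ (1 / 2) x * dzb j ηc x := fun j =>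
    (hη.dzb j).mul_left hV (contDiffOn_ew hψ _)
  let g : Fin n → Cn n → ℂ := fun j x => (ew ψ (1 / 2) x * ηc x) * α j x
  let G : Cn n → ℂ := fun x => (ew ψ 1 x * ηc x) * v x + ∑ j, (ew ψ (1 / 2) x *
      (dz j (fun y => (ψ y : ℂ)) x * ηc x + dz j ηc x)) * α j x
  let C : Fin n → Fin n → Cn n → ℂ := fun j k x =>
    (ew ψ (1 / 2) x * dzb j ηc x) * α k x - (ew ψ (1 / 2) x * dzb k ηc x) * α j x
  have main := integral_levi_le_of_weak (g := g) (G := G) (C := C) hψ's hψ'c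
    (fun j => ((tη _).memLp_mul (hα j)).1) (fun j => ((tη _).memLp_mul (hα j)).2)
    (((tη _).memLp_mul hv.memLp).1.add (memLp_finsetSum _ fun j _ => ((tD j).memLp_mul (hα j)).1))
    (((tη _).memLp_mul hv.memLp).2.add (hasCompactSupport_sum fun j => ((tD j).memLp_mul (hα j)).2))
    (fun j k => ((tB j).memLp_mul (hα k)).1.sub ((tB k).memLp_mul (hα j)).1)
    (fun j k => ((tB j).memLp_mul (hα k)).2.sub ((tB k).memLp_mul (hα j)).2)
    ?_ ?_
  · have e1 : ∀ x, (∑ j, ∑ k, leviCoeff ψ' j k x * g j x * (starRingEnd ℂ) (g k x)).re *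
        Real.exp (-ψ' x) =
        η x ^ 2 * (∑ j, ∑ k, leviCoeff ψ j k x * α j x * (starRingEnd ℂ) (α k x)).re := by
      intro x
      by_cases hx : x ∈ tsupport ηc
      · have h1 : ∀ j k, leviCoeff ψ' j k x * g j x * (starRingEnd ℂ) (g k x) =
            ((η x ^ 2 * Real.exp (ψ x) : ℝ) : ℂ) *
              (leviCoeff ψ j k x * α j x * (starRingEnd ℂ) (α k x)) := by
          intro j k
          have h2 : ew ψ (1 / 2) x * ew ψ (1 / 2) x = (Real.exp (ψ x) : ℂ) := by
            rw [ew_mul]; norm_num [ew]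
          simp only [g, map_mul, ew_conj, leviCoeff_congr (hev x hx), Complex.ofReal_mul, ← h2, hηc,
            Complex.conj_ofReal, Complex.ofReal_pow]
          ring
        simp_rw [h1, ← Finset.mul_sum, Complex.re_ofReal_mul, (hev x hx).self_of_nhds,
          Real.exp_neg]
        have := Real.exp_ne_zero (ψ x)
        field_simp
      · have h0 : ηc x = 0 := image_eq_zero_of_notMem_tsupport hx
        have h0' : η x = 0 := by simpa [hηc] using h0
        simp [g, h0, h0']
    have e2 : ∀ x, (‖G x - ∑ j, dz j (fun y => (ψ' y : ℂ)) x * g j x‖ ^ 2 +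
        (1 / 2) * ∑ j, ∑ k, ‖C j k x‖ ^ 2) * Real.exp (-ψ' x) =
        (‖η x * ew ψ (1 / 2) x * v x + ∑ j, dz j ηc x * α j x‖ ^ 2 +
        (1 / 2) * ∑ j, ∑ k, ‖dzb j ηc x * α k x - dzb k ηc x * α j x‖ ^ 2) := by
      intro x
      by_cases hx : x ∈ tsupport ηc
      · have hd : ∀ j, dz j (fun y => (ψ' y : ℂ)) x = dz j (fun y => (ψ y : ℂ)) x := fun j =>
          (dz_congr ((hev x hx).mono fun y hy => by simp [hy]) j).1
        have h1 : G x - ∑ j, dz j (fun y => (ψ' y : ℂ)) x * g j x = ew ψ (1 / 2) x *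
            (η x * ew ψ (1 / 2) x * v x + ∑ j, dz j ηc x * α j x) := by
          have h2 : ew ψ (1 / 2) x * ew ψ (1 / 2) x = ew ψ 1 x := by
            rw [ew_mul]; norm_num
          simp only [G, g, hd, ← h2, add_sub_assoc, ← Finset.sum_sub_distrib, mul_add,
            Finset.mul_sum]
          congr 1
          · simp only [hηc]; ring
          · exact Finset.sum_congr rfl fun j _ => by ring
        have h3 : ∀ j k, C j k x = ew ψ (1 / 2) x *
            (dzb j ηc x * α k x - dzb k ηc x * α j x) := fun j k => by simp only [C]; ring
        have h4 : Real.exp (1 / 2 * ψ x) ^ 2 * Real.exp (-ψ x) = 1 := by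
          rw [← Real.exp_nat_mul, ← Real.exp_add, show ((2 : ℕ) : ℝ) * (1 / 2 * ψ x) + -ψ x = 0 by
            push_cast; ring, Real.exp_zero]
        simp only [h1, h3, norm_mul, mul_pow, norm_ew, (hev x hx).self_of_nhds, ← Finset.mul_sum]
        linear_combination (‖η x * ew ψ (1 / 2) x * v x + ∑ j, dz j ηc x * α j x‖ ^ 2 +
          (1 / 2) * ∑ j, ∑ k, ‖dzb j ηc x * α k x - dzb k ηc x * α j x‖ ^ 2) * h4
      · have h0 : ηc x = 0 := image_eq_zero_of_notMem_tsupport hx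
        have h0' : η x = 0 := by simpa [hηc] using h0
        simp [G, C, g, h0, h0', fun j => (IsTest.dz_eq_zero hx j).1,
          fun j => (IsTest.dz_eq_zero hx j).2]
    simp_rw [e1, e2] at main
    exact main
  · intro χ hχ
    have tχ : IsTest V fun x => ew ψ 1 x * (ηc x * χ x) := by
      have : IsTest V fun x => ηc x * χ x := by
        simpa only [mul_comm] using hη.mul_left' hχ.smooth
      exact this.mul_left hV (contDiffOn_ew hψ _)
    have h := hdiv _ tχ
    have e : ∀ x, ∑ j, ew ψ (-1 / 2) x * α j x *
        dz j (fun x => ew ψ 1 x * (ηc x * χ x)) x =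
        ∑ j, g j x * dz j χ x + ∑ j, (ew ψ (1 / 2) x *
      (dz j (fun y => (ψ y : ℂ)) x * ηc x + dz j ηc x)) * α j x * χ x := by
      intro x
      rw [← Finset.sum_add_distrib]
      refine Finset.sum_congr rfl fun j _ => ?_
      by_cases hx : x ∈ tsupport ηc
      · have hxV := hη.subset hx
        have hψx := differentiableAt_of_contDiffOn hV hψ hxV
        have h2 : ew ψ (-1 / 2) x * ew ψ 1 x = ew ψ (1 / 2) x := by
          rw [ew_mul]; norm_num
        simp only [dz, g]
        rw [wirtingerD_mul (differentiableAt_of_contDiffOn hV (contDiffOn_ew hψ 1) hxV)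
          (f := ew ψ 1) (g := fun x => ηc x * χ x)
          ((hη.differentiable x).fun_mul (hχ.differentiable x)),
          wirtingerD_mul (hη.differentiable x) (hχ.differentiable x)]
        have h3 := dz_ew hψx 1 j
        simp only [dz] at h3
        rw [h3, ← h2]
        push_cast; ring
      · have h0 : ηc x = 0 := image_eq_zero_of_notMem_tsupport hx
        have hx' : x ∉ tsupport fun x => ew ψ 1 x * (ηc x * χ x) := fun h =>
          hx ((closure_mono fun y hy => by
            simp only [Function.mem_support] at hy ⊢
            exact fun h => hy (by simp [h])) h)
        simp [g, h0, (IsTest.dz_eq_zero hx j).1, (IsTest.dz_eq_zero hx' j).1]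
    simp_rw [e] at h
    have i1 : Integrable fun x => ∑ j, g j x * dz j χ x := integrable_finsetSum _ fun j _ =>
      integrable_mul_isTest (((tη _).memLp_mul (hα j)).1.locallyIntegrable (by norm_num)) (hχ.dz j)
    have i2 : Integrable fun x => ∑ j, (ew ψ (1 / 2) x *
      (dz j (fun y => (ψ y : ℂ)) x * ηc x + dz j ηc x)) * α j x * χ x :=
      integrable_finsetSum _ fun j _ =>
      integrable_mul_isTest (((tD j).memLp_mul (hα j)).1.locallyIntegrable (by norm_num)) hχ
    have i3 : Integrable fun x => v x * (ew ψ 1 x * (ηc x * χ x)) :=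
      integrable_mul_isTest (hv.memLp.locallyIntegrable (by norm_num)) (tχ.mono (subset_univ _))
    rw [integral_add i1 i2] at h
    rw [eq_sub_of_add_eq h, ← neg_add', ← integral_add i3 i2]
    congr 1
    refine integral_congr_ae (Eventually.of_forall fun x => ?_)
    simp only [G, add_mul, Finset.sum_mul]
    ring
  · intro j k χ hχ
    have tχ : IsTest V fun x => ηc x * χ x := by
        simpa only [mul_comm] using hη.mul_left' hχ.smooth
    have h := hcurl j k _ tχ
    have e : ∀ x, ew ψ (1 / 2) x * (α k x * dzb j (fun x => ηc x * χ x) x -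
        α j x * dzb k (fun x => ηc x * χ x) x) =
        (g k x * dzb j χ x - g j x * dzb k χ x) + C j k x * χ x := by
      intro x
      simp only [dzb, g, C]
      rw [wirtingerDbar_mul (hη.differentiable x) (hχ.differentiable x),
        wirtingerDbar_mul (hη.differentiable x) (hχ.differentiable x)]
      ring
    simp_rw [e] at h
    rw [integral_add] at h
    · exact eq_neg_of_add_eq_zero_left h
    · exact (integrable_mul_isTest (((tη _).memLp_mul (hα k)).1.locallyIntegrable (by norm_num))
        (hχ.dzb j)).sub (integrable_mul_isTest
          (((tη _).memLp_mul (hα j)).1.locallyIntegrable (by norm_num)) (hχ.dzb k))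
    · exact integrable_mul_isTest ((((tB j).memLp_mul (hα k)).1.sub
        ((tB k).memLp_mul (hα j)).1).locallyIntegrable (by norm_num)) hχ

end SingleCutoff

section Decomposition

variable {n : ℕ} {V : Set (Cn n)} {ψ : Cn n → ℝ}

/-- Square integrable forms of bidegree `(0,1)`. -/
abbrev FormL2 (n : ℕ) := PiLp 2 fun _ : Fin n => Lp ℂ 2 (volume : Measure (Cn n))

/-- The class of a square integrable form. -/
def toForm (u : Fin n → Cn n → ℂ) (hu : ∀ j, MemLp (u j) 2 volume) : FormL2 n :=
  WithLp.toLp 2 fun j => (hu j).toLp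

lemma inner_toLp {μ : Measure (Cn n)} {u w : Cn n → ℂ} (hu : MemLp u 2 μ) (hw : MemLp w 2 μ) :
    inner ℂ (hu.toLp u) (hw.toLp w) = ∫ x, (starRingEnd ℂ) (u x) * w x ∂μ := by
  rw [L2.inner_def]
  refine integral_congr_ae ?_
  filter_upwards [hu.coeFn_toLp, hw.coeFn_toLp] with x h1 h2
  rw [h1, h2, RCLike.inner_apply, mul_comm]

lemma integrable_conj_mul_of_memLp {μ : Measure (Cn n)} {u v : Cn n → ℂ} (hu : MemLp u 2 μ)
    (hv : MemLp v 2 μ) : Integrable (fun x => (starRingEnd ℂ) (u x) * v x) μ := by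
  simpa only [mul_comm] using integrable_mul_conj_of_memLp hv hu

lemma inner_toForm {u w : Fin n → Cn n → ℂ} (hu : ∀ j, MemLp (u j) 2 volume)
    (hw : ∀ j, MemLp (w j) 2 volume) :
    inner ℂ (toForm u hu) (toForm w hw) = ∫ x, ∑ j, (starRingEnd ℂ) (u j x) * w j x := by
  rw [integral_finsetSum _ fun j _ => integrable_conj_mul_of_memLp (hu j) (hw j)]
  simp only [PiLp.inner_apply, toForm, inner_toLp]

lemma toForm_coe (α : FormL2 n) : toForm (fun j => α j) (fun j => Lp.memLp (α j)) = α := by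
  refine PiLp.ext fun j => ?_
  exact Lp.toLp_coeFn _ (Lp.memLp (α j))

/-- Projection to the orthogonal complement of a set. -/
lemma exists_orthogonal_part {E : Type*} [NormedAddCommGroup E] [InnerProductSpace ℂ E]
    [CompleteSpace E] (S : Set E) (β : E) :
    ∃ α : E, (∀ s ∈ S, inner ℂ s α = 0) ∧
      ∀ w, (∀ s ∈ S, inner ℂ s w = 0) → inner ℂ w α = inner ℂ w β := by
  have memN : ∀ w, w ∈ (Submodule.span ℂ S)ᗮ ↔ ∀ s ∈ S, inner ℂ s w = 0 := by
    intro w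
    rw [Submodule.mem_orthogonal]
    refine ⟨fun h s hs => h s (Submodule.subset_span hs), fun h e he => ?_⟩
    induction he using Submodule.span_induction with
    | mem e he => exact h e he
    | zero => exact inner_zero_left _
    | add a c _ _ ha hc => rw [inner_add_left, ha, hc, add_zero]
    | smul r a _ ha => rw [inner_smul_left, ha, mul_zero]
  refine ⟨(Submodule.span ℂ S)ᗮ.starProjection β,
    (memN _).1 (Submodule.starProjection_apply_mem _ β), fun w hw => ?_⟩
  have := Submodule.sub_starProjection_mem_orthogonal (K := (Submodule.span ℂ S)ᗮ) β w
    ((memN w).2 hw)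
  rw [inner_sub_right, sub_eq_zero] at this
  exact this.symm

/-- Weakly `∂̄`-closed forms. -/
def IsWeaklyClosed (V : Set (Cn n)) (f : Fin n → Cn n → ℂ) : Prop :=
  ∀ j k χ, IsTest V χ → ∫ x, (f k x * dzb j χ x - f j x * dzb k χ x) = 0

/-- The Hodge-type decomposition of a test form. -/
theorem exists_closed_part (hV : IsOpen V) (hψ : ContDiffOn ℝ (⊤ : ℕ∞) ψ V)
    {b : Fin n → Cn n → ℂ} (hb : ∀ j, IsTest V (b j)) {f : Fin n → Cn n → ℂ}
    (hf : IsWeaklyClosed V f)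
    (hfL : ∀ j, MemLp (V.indicator fun x => ew ψ (-1 / 2) x * f j x) 2 volume) :
    ∃ α : Fin n → Cn n → ℂ, (∀ j, MemLp (α j) 2 volume) ∧
      (∀ χ, IsTest V χ → ∫ x, ∑ j, ew ψ (-1 / 2) x * α j x * dz j χ x =
        -∫ x, (∑ j, dz j (b j) x) * χ x) ∧
      (∀ j k χ, IsTest V χ →
        ∫ x, ew ψ (1 / 2) x * (α k x * dzb j χ x - α j x * dzb k χ x) = 0) ∧
      ∫ x, ∑ j, V.indicator (fun x => ew ψ (-1 / 2) x * f j x) x * (starRingEnd ℂ) (α j x) =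
        ∫ x, ∑ j, f j x * (starRingEnd ℂ) (b j x) := by
  classical
  have tm : ∀ {χ : Cn n → ℂ} (c : ℝ), IsTest V χ → IsTest V fun x => ew ψ c x * χ x :=
    fun c hχ => hχ.mul_left hV (contDiffOn_ew hψ c)
  let s : Fin n → Fin n → (Cn n → ℂ) → Fin n → Cn n → ℂ := fun j k χ i x =>
    (if i = k then (starRingEnd ℂ) (ew ψ (1 / 2) x * dzb j χ x) else 0) -
      (if i = j then (starRingEnd ℂ) (ew ψ (1 / 2) x * dzb k χ x) else 0)
  have hs : ∀ j k χ, IsTest V χ → ∀ i, MemLp (s j k χ i) 2 volume := by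
    intro j k χ hχ i
    have h1 := (tm (1 / 2) (hχ.dzb j)).conj.memLp
    have h2 := (tm (1 / 2) (hχ.dzb k)).conj.memLp
    refine MemLp.sub (f := fun x => if i = k then _ else (0 : ℂ)) ?_ ?_ <;> split_ifs
    exacts [h1, MemLp.zero', h2, MemLp.zero']
  let S : Set (FormL2 n) :=
    {e | ∃ j k χ, ∃ hχ : IsTest V χ, e = toForm (s j k χ) (hs j k χ hχ)}
  have memN : ∀ {u : Fin n → Cn n → ℂ} (hu : ∀ j, MemLp (u j) 2 volume),
      (∀ e ∈ S, inner ℂ e (toForm u hu) = 0) ↔ ∀ j k χ, IsTest V χ →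
        ∫ x, ew ψ (1 / 2) x * (u k x * dzb j χ x - u j x * dzb k χ x) = 0 := by
    intro u hu
    have key : ∀ j k χ (hχ : IsTest V χ), inner ℂ (toForm (s j k χ) (hs j k χ hχ)) (toForm u hu) =
        ∫ x, ew ψ (1 / 2) x * (u k x * dzb j χ x - u j x * dzb k χ x) := by
      intro j k χ hχ
      rw [inner_toForm]
      refine integral_congr_ae (Eventually.of_forall fun x => ?_)
      simp only [s, map_sub, apply_ite (starRingEnd ℂ), map_zero, sub_mul, ite_mul, zero_mul,
        Finset.sum_sub_distrib, Finset.sum_ite_eq', Finset.mem_univ, if_true, Complex.conj_conj]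
      ring
    constructor
    · intro h j k χ hχ
      rw [← key j k χ hχ]
      exact h _ ⟨j, k, χ, hχ, rfl⟩
    · rintro h e ⟨j, k, χ, hχ, rfl⟩
      rw [key _ _ _ hχ]; exact h j k χ hχ
  have hβ : ∀ j, MemLp (fun x => ew ψ (1 / 2) x * b j x) 2 volume := fun j => (tm _ (hb j)).memLp
  obtain ⟨α, hα, horth⟩ := exists_orthogonal_part S (toForm _ hβ)
  have hα' : toForm (fun j => α j) (fun j => Lp.memLp (α j)) = α := toForm_coe α
  refine ⟨fun j => α j, fun j => Lp.memLp (α j), ?_, (memN _).1 (hα'.symm ▸ hα), ?_⟩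
  · intro χ hχ
    have hg : ∀ j, MemLp (fun x => ew ψ (-1 / 2) x * dzb j (fun y => (starRingEnd ℂ) (χ y)) x) 2
        volume := fun j => (tm _ (hχ.conj.dzb j)).memLp
    have hgN : ∀ e ∈ S, inner ℂ e (toForm _ hg) = 0 := by
      rw [memN]
      intro j k χ' hχ'
      have e : ∀ x, ew ψ (1 / 2) x * (ew ψ (-1 / 2) x * dzb k (fun y => (starRingEnd ℂ) (χ y)) x *
          dzb j χ' x - ew ψ (-1 / 2) x * dzb j (fun y => (starRingEnd ℂ) (χ y)) x *
          dzb k χ' x) = dzb k (fun y => (starRingEnd ℂ) (χ y)) x * dzb j χ' x -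
            dzb j (fun y => (starRingEnd ℂ) (χ y)) x * dzb k χ' x := by
        intro x
        have h2 : ew ψ (1 / 2) x * ew ψ (-1 / 2) x = 1 := by
          rw [ew_mul, ← ew_zero (ψ := ψ) x]; norm_num
        linear_combination (dzb k (fun y => (starRingEnd ℂ) (χ y)) x * dzb j χ' x -
            dzb j (fun y => (starRingEnd ℂ) (χ y)) x * dzb k χ' x) * h2
      simp_rw [e]
      have hc := hχ.conj
      have i1 : ∀ i l, Integrable fun x => dzb i (fun y => (starRingEnd ℂ) (χ y)) x * dzb l χ' x :=
        fun i l => ((hχ'.dzb l).mul_left' (hc.dzb i).smooth).integrable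
      rw [integral_sub (i1 _ _) (i1 _ _),
        integral_mul_dzb isOpen_univ (hc.dzb k).smooth.contDiffOn (hχ'.mono (subset_univ _)),
        integral_mul_dzb isOpen_univ (hc.dzb j).smooth.contDiffOn (hχ'.mono (subset_univ _))]
      simp_rw [dzb_dzb_comm hc.smooth k j, sub_self]
    have h := horth _ hgN
    rw [← hα', inner_toForm, inner_toForm] at h
    have e0 : ∀ j x, (starRingEnd ℂ) (dzb j (fun y => (starRingEnd ℂ) (χ y)) x) = dz j χ x := by
      intro j x
      rw [dzb_conj hχ.differentiable]; exact Complex.conj_conj _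
    simp only [map_mul, ew_conj, e0] at h
    have e1 : ∀ x, ∑ j, ew ψ (-1 / 2) x * α j x * dz j χ x =
        ∑ j, ew ψ (-1 / 2) x * dz j χ x * α j x := fun x =>
      Finset.sum_congr rfl fun j _ => by ring
    have e2 : ∀ x, ∑ j, ew ψ (-1 / 2) x * dz j χ x * (ew ψ (1 / 2) x * b j x) =
        ∑ j, b j x * dz j χ x := fun x => Finset.sum_congr rfl fun j _ => by
      have h2 : ew ψ (-1 / 2) x * ew ψ (1 / 2) x = 1 := by
          rw [ew_mul, ← ew_zero (ψ := ψ) x]; norm_num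
      linear_combination (dz j χ x * b j x) * h2
    simp_rw [e1, h, e2, Finset.sum_mul]
    rw [integral_finsetSum _ fun j _ => ((hχ.dz j).mul_left' (hb j).smooth).integrable,
      integral_finsetSum _ fun j _ => (hχ.mul_left' ((hb j).dz j).smooth).integrable,
      ← Finset.sum_neg_distrib]
    exact Finset.sum_congr rfl fun j _ =>
      integral_mul_dz isOpen_univ (hb j).smooth.contDiffOn (hχ.mono (subset_univ _)) j
  · have hfN : ∀ e ∈ S, inner ℂ e (toForm _ hfL) = 0 := by
      rw [memN]
      intro j k χ hχ
      rw [← hf j k χ hχ]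
      refine integral_congr_ae (Eventually.of_forall fun x => ?_)
      by_cases hx : x ∈ V
      · have h2 : ew ψ (1 / 2) x * ew ψ (-1 / 2) x = 1 := by
          rw [ew_mul, ← ew_zero (ψ := ψ) x]; norm_num
        simp only [indicator_of_mem hx]
        linear_combination (f k x * dzb j χ x - f j x * dzb k χ x) * h2
      · simp [(hχ.dzb j).zero_outside hx, (hχ.dzb k).zero_outside hx]
    have h := congrArg (starRingEnd ℂ) (horth _ hfN)
    rw [← hα', inner_toForm, inner_toForm, ← integral_conj, ← integral_conj] at h
    simp only [map_sum, map_mul, Complex.conj_conj] at h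
    rw [h]
    refine integral_congr_ae (Eventually.of_forall fun x => Finset.sum_congr rfl fun j _ => ?_)
    by_cases hx : x ∈ V
    · have h2 : ew ψ (-1 / 2) x * ew ψ (1 / 2) x = 1 := by
        rw [ew_mul, ← ew_zero (ψ := ψ) x]; norm_num
      simp only [indicator_of_mem hx, ew_conj]
      linear_combination (f j x * (starRingEnd ℂ) (b j x)) * h2
    · simp [(hb j).zero_outside hx]

end Decomposition

section WeakEstimate

variable {n : ℕ} {V : Set (Cn n)} {ψ : Cn n → ℝ}

lemma contDiffOn_leviForm {F : Type*} [NormedAddCommGroup F] [NormedSpace ℂ F] {s : Set F}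
    (hs : IsOpen s) {f : F → ℂ} (hf : ContDiffOn ℝ (⊤ : ℕ∞) f s) (v w : F) :
    ContDiffOn ℝ (⊤ : ℕ∞) (fun x => leviForm f x v w) s := by
  have h1 : ContDiffOn ℝ (⊤ : ℕ∞) (fderiv ℝ f) s := hf.fderiv_of_isOpen hs (by simp)
  have h2 : ContDiffOn ℝ (⊤ : ℕ∞) (fderiv ℝ (fderiv ℝ f)) s := h1.fderiv_of_isOpen hs (by simp)
  have h3 : ∀ v w : F, ContDiffOn ℝ (⊤ : ℕ∞) (fun x => fderiv ℝ (fderiv ℝ f) x v w) s :=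
    fun v w => (h2.clm_apply contDiffOn_const).clm_apply contDiffOn_const
  unfold leviForm
  exact contDiffOn_const.mul ((((h3 v w).add (contDiffOn_const.mul (h3 v _))).sub
    (contDiffOn_const.mul (h3 _ w))).add (h3 _ _))

lemma contDiffOn_leviCoeff (hV : IsOpen V) (hψ : ContDiffOn ℝ (⊤ : ℕ∞) ψ V) (j k : Fin n) :
    ContDiffOn ℝ (⊤ : ℕ∞) (leviCoeff ψ j k) V :=
  contDiffOn_leviForm hV (contDiff_ofReal_comp hψ) _ _

lemma integrable_norm_sq {μ : Measure (Cn n)} {u : Cn n → ℂ} (hu : MemLp u 2 μ) :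
    Integrable (fun x => ‖u x‖ ^ 2) μ :=
  (memLp_two_iff_integrable_sq_norm hu.1).1 hu

lemma norm_add_sq_le {δ : ℝ} (hδ : 0 < δ) (a b : ℂ) :
    ‖a + b‖ ^ 2 ≤ (1 + δ) * ‖a‖ ^ 2 + (1 + δ⁻¹) * ‖b‖ ^ 2 := by
  have h := norm_add_le a b
  have h1 : ‖a + b‖ ^ 2 ≤ (‖a‖ + ‖b‖) ^ 2 := by gcongr
  have h2 : 0 ≤ δ⁻¹ * (δ * ‖a‖ - ‖b‖) ^ 2 := by positivity
  have h3 : δ⁻¹ * (δ * ‖a‖ - ‖b‖) ^ 2 = δ * ‖a‖ ^ 2 - 2 * ‖a‖ * ‖b‖ + δ⁻¹ * ‖b‖ ^ 2 := by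
    field_simp; ring
  nlinarith

set_option maxHeartbeats 1600000 in
theorem two_re_integral_le (hV : IsOpen V) (hψ : ContDiffOn ℝ (⊤ : ℕ∞) ψ V)
    {b : Fin n → Cn n → ℂ} (hb : ∀ j, IsTest V (b j)) {f : Fin n → Cn n → ℂ}
    (hf : IsWeaklyClosed V f)
    (hfL : ∀ j, MemLp (V.indicator fun x => ew ψ (-1 / 2) x * f j x) 2 volume)
    {F K : Cn n → ℝ} (hF0 : ∀ x ∈ V, 0 ≤ F x)
    (hFi : IntegrableOn (fun x => F x * Real.exp (-ψ x)) V) (hK : ∀ x ∈ V, 0 ≤ K x)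
    (hpt : ∀ x ∈ V, ∀ a : Fin n → ℂ, 2 * (∑ k, f k x * (starRingEnd ℂ) (a k)).re ≤
      F x + (∑ j, ∑ k, leviCoeff ψ j k x * a j * (starRingEnd ℂ) (a k)).re -
        K x * ∑ k, ‖a k‖ ^ 2)
    {η : ℕ → Cn n → ℝ} (hη : ∀ m, IsTest V fun x => (η m x : ℂ))
    (hη01 : ∀ m x, η m x ∈ Icc (0 : ℝ) 1)
    (hη1 : ∀ x ∈ V, Tendsto (fun m => η m x) atTop (𝓝 1))
    (hηd : ∀ δ : ℝ, 0 < δ → ∀ᶠ m in atTop, ∀ x ∈ V,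
      ∑ j, ‖dz j (fun y => (η m y : ℂ)) x‖ ^ 2 ≤ δ ^ 2 * (K x * η m x ^ 2 + 1)) :
    2 * (∫ x, ∑ j, f j x * (starRingEnd ℂ) (b j x)).re ≤
      (∫ x in V, F x * Real.exp (-ψ x)) +
        ∫ x, ‖∑ j, dz j (b j) x‖ ^ 2 * Real.exp (ψ x) := by
  obtain ⟨α, hα, hdiv, hcurl, hpair⟩ := exists_closed_part hV hψ hb hf hfL
  set v : Cn n → ℂ := fun x => ∑ j, dz j (b j) x with hv'
  have hv : IsTest V v := IsTest.sum _ fun j _ => (hb j).dz j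
  set fα : Cn n → ℂ := fun x =>
    ∑ j, V.indicator (fun x => ew ψ (-1 / 2) x * f j x) x * (starRingEnd ℂ) (α j x) with hfα
  have ifα : Integrable fα := integrable_finsetSum _ fun j _ =>
    integrable_mul_conj_of_memLp (hfL j) (hα j)
  have iA : Integrable fun x => ∑ j, ‖α j x‖ ^ 2 := integrable_finsetSum _ fun j _ =>
    integrable_norm_sq (hα j)
  have iF : Integrable (V.indicator fun x => F x * Real.exp (-ψ x)) :=
    (integrable_indicator_iff hV.measurableSet).2 hFi
  have hσv : IsTest V fun x => ew ψ (1 / 2) x * v x := hv.mul_left hV (contDiffOn_ew hψ _)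
  have eσv : ∀ x, ‖v x‖ ^ 2 * Real.exp (ψ x) = ‖ew ψ (1 / 2) x * v x‖ ^ 2 := by
    intro x
    rw [norm_mul, mul_pow, norm_ew, ← Real.exp_nat_mul, mul_comm]
    congr 2; push_cast; ring
  rw [integral_congr_ae (Eventually.of_forall eσv), ← hpair, ← integral_indicator hV.measurableSet]
  set A := ∫ x, ∑ j, ‖α j x‖ ^ 2
  set B := ∫ x, ‖ew ψ (1 / 2) x * v x‖ ^ 2
  set IF := ∫ x, V.indicator (fun x => F x * Real.exp (-ψ x)) x
  have iB := integrable_norm_sq hσv.memLp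
  have step : ∀ δ : ℝ, 0 < δ → δ ≤ 1 / 2 → ∀ᶠ m in atTop,
      ∫ x, 2 * (η m x ^ 2 * (fα x).re) ≤ IF + B + δ * (B + 2 * A) := by
    intro δ hδ hδ2
    filter_upwards [hηd δ hδ] with m hm
    have I := integral_levi_cutoff_le hV hψ (hη m) hv hα hdiv hcurl
    set L : Cn n → ℝ := fun x =>
      η m x ^ 2 * (∑ j, ∑ k, leviCoeff ψ j k x * α j x * (starRingEnd ℂ) (α k x)).re with hL
    set R : Cn n → ℝ := fun x => (‖η m x * ew ψ (1 / 2) x * v x +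
        ∑ j, dz j (fun y => (η m y : ℂ)) x * α j x‖ ^ 2 +
        (1 / 2) * ∑ j, ∑ k, ‖dzb j (fun y => (η m y : ℂ)) x * α k x -
          dzb k (fun y => (η m y : ℂ)) x * α j x‖ ^ 2) with hR
    have iL : Integrable L := by
      have h : ∀ j k, Integrable fun x => ((leviCoeff ψ j k x * (η m x : ℂ)) * α j x) *
          (starRingEnd ℂ) ((η m x : ℂ) * α k x) := fun j k =>
        integrable_mul_conj_of_memLp
          ((((hη m).mul_left hV (contDiffOn_leviCoeff hV hψ j k)).memLp_mul (hα j)).1)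
          (((hη m).memLp_mul (hα k)).1)
      refine (integrable_finsetSum Finset.univ fun j _ =>
        integrable_finsetSum Finset.univ fun k _ => h j k).re.congr
          (Eventually.of_forall fun x => ?_)
      change Complex.re _ = _
      simp only [hL]
      rw [← Complex.re_ofReal_mul, Finset.mul_sum]
      simp_rw [Finset.mul_sum]
      congr 1
      refine Finset.sum_congr rfl fun j _ => Finset.sum_congr rfl fun k _ => ?_
      simp only [map_mul, Complex.conj_ofReal]; push_cast; ring
    have iR : Integrable R := by
      refine (integrable_norm_sq (u := fun x => η m x * ew ψ (1 / 2) x * v x +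
        ∑ j, dz j (fun y => (η m y : ℂ)) x * α j x) ?_).add ((integrable_finsetSum _ fun j _ =>
          integrable_finsetSum _ fun k _ => integrable_norm_sq (u := fun x =>
          dzb j (fun y => (η m y : ℂ)) x * α k x - dzb k (fun y => (η m y : ℂ)) x * α j x)
          ?_).const_mul _)
      · refine MemLp.add ?_ (memLp_finsetSum _ fun j _ => (((hη m).dz j).memLp_mul (hα j)).1)
        simpa only [mul_assoc] using (hσv.mul_left' (hη m).smooth).memLp
      · exact (((hη m).dzb j).memLp_mul (hα k)).1.sub (((hη m).dzb k).memLp_mul (hα j)).1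
    have i0 : Integrable fun x => 2 * (η m x ^ 2 * (fα x).re) := by
      refine Integrable.const_mul ?_ 2
      refine ifα.re.bdd_mul (c := 1) ?_ (Eventually.of_forall fun x => ?_)
      · exact ((Complex.continuous_re.comp (hη m).smooth.continuous).pow 2).aestronglyMeasurable
      · have := hη01 m x
        rw [Real.norm_eq_abs, abs_of_nonneg (by positivity)]
        exact pow_le_one₀ this.1 this.2
    have pw : ∀ x, 2 * (η m x ^ 2 * (fα x).re) + R x ≤
        V.indicator (fun x => F x * Real.exp (-ψ x)) x + L x +
          ((1 + δ) * ‖ew ψ (1 / 2) x * v x‖ ^ 2 + 2 * δ * ∑ j, ‖α j x‖ ^ 2) := by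
      intro x
      by_cases hx : x ∈ V
      · have h01 := hη01 m x
        have hη2 : η m x ^ 2 ≤ 1 := pow_le_one₀ h01.1 h01.2
        set r := Real.exp (1 / 2 * ψ x) with hr
        have hr0 : 0 < r := Real.exp_pos _
        have hr2 : Real.exp (-ψ x) = (r ^ 2)⁻¹ := by
          rw [hr, ← Real.exp_nat_mul, ← Real.exp_neg]; congr 1; push_cast; ring
        have hrm : ew ψ (-1 / 2) x = (r : ℂ)⁻¹ := by
          rw [ew, hr, ← Complex.ofReal_inv, ← Real.exp_neg]; congr 2; ring
        have h1 := hpt x hx fun j => r * α j x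
        have e1 : (∑ k, f k x * (starRingEnd ℂ) (r * α k x)).re = r ^ 2 * (fα x).re := by
          rw [← Complex.re_ofReal_mul, hfα, Finset.mul_sum]
          congr 1
          refine Finset.sum_congr rfl fun j _ => ?_
          have : (r : ℂ) ≠ 0 := by exact_mod_cast hr0.ne'
          simp only [indicator_of_mem hx, hrm, map_mul, Complex.conj_ofReal]
          push_cast; field_simp
        have e2 : (∑ j, ∑ k, leviCoeff ψ j k x * (r * α j x) * (starRingEnd ℂ) (r * α k x)).re =
            r ^ 2 * (∑ j, ∑ k, leviCoeff ψ j k x * α j x * (starRingEnd ℂ) (α k x)).re := by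
          rw [← Complex.re_ofReal_mul]
          simp_rw [Finset.mul_sum]
          congr 1
          refine Finset.sum_congr rfl fun j _ => Finset.sum_congr rfl fun k _ => ?_
          simp only [map_mul, Complex.conj_ofReal]; push_cast; ring
        have e3 : ∑ k, ‖(r : ℂ) * α k x‖ ^ 2 = r ^ 2 * ∑ k, ‖α k x‖ ^ 2 := by
          rw [Finset.mul_sum]
          refine Finset.sum_congr rfl fun k _ => ?_
          rw [norm_mul, mul_pow, Complex.norm_real, Real.norm_eq_abs, sq_abs]
        rw [e1, e2, e3] at h1
        have h2 : 2 * (fα x).re ≤ F x * Real.exp (-ψ x) +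
            (∑ j, ∑ k, leviCoeff ψ j k x * α j x * (starRingEnd ℂ) (α k x)).re -
            K x * ∑ k, ‖α k x‖ ^ 2 := by
          have hr2' : 0 < r ^ 2 := by positivity
          rw [hr2]
          refine le_of_mul_le_mul_left ?_ hr2'
          have : r ^ 2 * (F x * (r ^ 2)⁻¹) = F x := by field_simp
          nlinarith [h1, this]
        have h3 := mul_le_mul_of_nonneg_left h2 (sq_nonneg (η m x))
        set p : Fin n → ℂ := fun j => dzb j (fun y => (η m y : ℂ)) x
        have hp : ∀ j, (starRingEnd ℂ) (p j) = dz j (fun y => (η m y : ℂ)) x := by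
          intro j
          have := congrFun (dzb_conj (hη m).differentiable j) x
          simp only [Complex.conj_ofReal] at this
          simp only [p, this, Complex.conj_conj]
        have hpn : ∑ j, ‖p j‖ ^ 2 ≤ δ ^ 2 * (K x * η m x ^ 2 + 1) := by
          refine le_trans (le_of_eq ?_) (hm x hx)
          refine Finset.sum_congr rfl fun j _ => ?_
          rw [← hp, Complex.norm_conj]
        have h4 : R x ≤ (1 + δ) * ‖ew ψ (1 / 2) x * v x‖ ^ 2 +
            (1 + δ⁻¹) * ((∑ j, ‖p j‖ ^ 2) * ∑ j, ‖α j x‖ ^ 2) := by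
          have h5 := norm_add_sq_le hδ (η m x * ew ψ (1 / 2) x * v x)
            (∑ j, (starRingEnd ℂ) (p j) * α j x)
          have h6 := half_sum_norm_sub_sq_eq p fun j => α j x
          have h7 : ‖(η m x : ℂ) * ew ψ (1 / 2) x * v x‖ ^ 2 ≤ ‖ew ψ (1 / 2) x * v x‖ ^ 2 := by
            rw [mul_assoc, norm_mul, mul_pow, Complex.norm_real, Real.norm_eq_abs, sq_abs]
            exact mul_le_of_le_one_left (by positivity) hη2
          have h8 : 0 ≤ (1 / 2) * ∑ j, ∑ k, ‖p j * α k x - p k * α j x‖ ^ 2 := by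
            positivity
          have h9 : 0 < δ⁻¹ := by positivity
          simp only [hR, ← hp]
          change _ + (1 / 2) * ∑ j, ∑ k, ‖p j * α k x - p k * α j x‖ ^ 2 ≤ _
          rw [h6] at h8 ⊢
          have h10 := mul_le_mul_of_nonneg_left h7 (by linarith : (0:ℝ) ≤ 1 + δ)
          have h11 := mul_nonneg h9.le h8
          linarith
        have hA0 : 0 ≤ ∑ j, ‖α j x‖ ^ 2 := by positivity
        have hK0 : 0 ≤ K x * η m x ^ 2 := mul_nonneg (hK x hx) (sq_nonneg _)
        have h12 : (1 + δ⁻¹) * (∑ j, ‖p j‖ ^ 2) ≤ K x * η m x ^ 2 + 2 * δ := by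
          have : (1 + δ⁻¹) * (∑ j, ‖p j‖ ^ 2) ≤
              (1 + δ⁻¹) * (δ ^ 2 * (K x * η m x ^ 2 + 1)) :=
            mul_le_mul_of_nonneg_left hpn (by positivity)
          have e : (1 + δ⁻¹) * (δ ^ 2 * (K x * η m x ^ 2 + 1)) =
              (δ ^ 2 + δ) * (K x * η m x ^ 2 + 1) := by field_simp
          have h13 : δ ^ 2 + δ ≤ 1 := by nlinarith
          have h14 : δ ^ 2 + δ ≤ 2 * δ := by nlinarith
          have h17 := mul_nonneg (sub_nonneg.2 h13) hK0
          linarith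
        have h15 := mul_le_mul_of_nonneg_right h12 hA0
        have h16 : η m x ^ 2 * (F x * Real.exp (-ψ x)) ≤ F x * Real.exp (-ψ x) :=
          mul_le_of_le_one_left (mul_nonneg (hF0 x hx) (Real.exp_pos _).le) hη2
        rw [indicator_of_mem hx]
        simp only [hL]
        linarith
      · have h0 : (η m x : ℂ) = 0 := (hη m).zero_outside hx
        have h0' : η m x = 0 := by exact_mod_cast h0
        have h1 : ∀ j, dz j (fun y => (η m y : ℂ)) x = 0 := fun j =>
          ((hη m).dz j).zero_outside hx
        have h2 : ∀ j, dzb j (fun y => (η m y : ℂ)) x = 0 := fun j =>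
          ((hη m).dzb j).zero_outside hx
        simp only [hL, hR, h0', h1, h2, indicator_of_notMem hx]
        simp only [Complex.ofReal_zero, zero_mul, Finset.sum_const_zero, add_zero, norm_zero,
          sub_zero, ne_eq, OfNat.ofNat_ne_zero, not_false_eq_true, zero_pow, mul_zero, zero_add]
        positivity
    have := integral_mono (i0.add iR) ((iF.add iL).add
      ((iB.const_mul (1 + δ)).add (iA.const_mul (2 * δ)))) pw
    have r0 : ∫ x, (2 * (η m x ^ 2 * (fα x).re) + R x) =
        (∫ x, 2 * (η m x ^ 2 * (fα x).re)) + ∫ x, R x := integral_add i0 iR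
    have r1 : ∫ x, (V.indicator (fun x => F x * Real.exp (-ψ x)) x + L x +
          ((1 + δ) * ‖ew ψ (1 / 2) x * v x‖ ^ 2 + 2 * δ * ∑ j, ‖α j x‖ ^ 2)) =
        (∫ x, (V.indicator (fun x => F x * Real.exp (-ψ x)) x + L x)) +
        ∫ x, ((1 + δ) * ‖ew ψ (1 / 2) x * v x‖ ^ 2 + 2 * δ * ∑ j, ‖α j x‖ ^ 2) :=
      integral_add (iF.add iL) ((iB.const_mul (1 + δ)).add (iA.const_mul (2 * δ)))
    have r2 : ∫ x, (V.indicator (fun x => F x * Real.exp (-ψ x)) x + L x) = IF + ∫ x, L x :=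
      integral_add iF iL
    have r3 : ∫ x, ((1 + δ) * ‖ew ψ (1 / 2) x * v x‖ ^ 2 + 2 * δ * ∑ j, ‖α j x‖ ^ 2) =
        (1 + δ) * B + 2 * δ * A := by
      rw [integral_add (iB.const_mul (1 + δ)) (iA.const_mul (2 * δ)), integral_const_mul,
        integral_const_mul]
    have h := r0.symm.trans_le (this.trans_eq r1)
    rw [r2, r3] at h
    linarith
  have lim : Tendsto (fun m => ∫ x, 2 * (η m x ^ 2 * (fα x).re)) atTop
      (𝓝 (2 * (∫ x, fα x).re)) := by
    have e : 2 * (∫ x, fα x).re = ∫ x, 2 * (fα x).re := by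
      rw [integral_const_mul]; congr 1; exact (integral_re ifα).symm
    rw [e]
    refine tendsto_integral_of_dominated_convergence (fun x => 2 * ‖fα x‖) ?_
      (ifα.norm.const_mul 2) ?_ ?_
    · intro m
      exact (((Complex.continuous_re.comp (hη m).smooth.continuous).pow 2).aestronglyMeasurable.mul
        ifα.re.1).const_mul 2
    · intro m
      refine Eventually.of_forall fun x => ?_
      have h01 := hη01 m x
      have h1 : η m x ^ 2 ≤ 1 := pow_le_one₀ h01.1 h01.2
      rw [norm_mul, norm_mul, Real.norm_eq_abs, Real.norm_eq_abs, Real.norm_eq_abs, abs_two,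
        abs_of_nonneg (sq_nonneg (η m x))]
      have := Complex.abs_re_le_norm (fα x)
      nlinarith [abs_nonneg (fα x).re]
    · refine Eventually.of_forall fun x => ?_
      by_cases hx : x ∈ V
      · simpa using (((hη1 x hx).pow 2).mul_const (fα x).re).const_mul 2
      · have : fα x = 0 := by simp [hfα, indicator_of_notMem hx]
        simp [this]
  have fin : ∀ δ : ℝ, 0 < δ → δ ≤ 1 / 2 → 2 * (∫ x, fα x).re ≤ IF + B + δ * (B + 2 * A) :=
    fun δ h1 h2 => le_of_tendsto lim (step δ h1 h2)
  have t : Tendsto (fun δ : ℝ => IF + B + δ * (B + 2 * A)) (𝓝[>] 0) (𝓝 (IF + B)) := by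
    have : Tendsto (fun δ : ℝ => IF + B + δ * (B + 2 * A)) (𝓝 0)
        (𝓝 (IF + B + 0 * (B + 2 * A))) := Continuous.tendsto (by fun_prop) 0
    simp only [zero_mul, add_zero] at this
    exact this.mono_left nhdsWithin_le_nhds
  refine ge_of_tendsto t ?_
  filter_upwards [Ioc_mem_nhdsGT (show (0 : ℝ) < 1 / 2 by norm_num)] with δ hδ
  exact fin δ hδ.1 hδ.2

end WeakEstimate

lemma leviCoeff_comp {n : ℕ} {V : Set (Cn n)} {ρ : Cn n → ℝ} (hV : IsOpen V)
    (hρ : ContDiffOn ℝ (⊤ : ℕ∞) ρ V) {h h₁ h₂ : ℝ → ℝ}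
    (hh : ContDiffOn ℝ (⊤ : ℕ∞) (fun x => h (ρ x)) V)
    (h1 : ∀ x ∈ V, HasDerivAt h (h₁ (ρ x)) (ρ x))
    (h2 : ∀ x ∈ V, HasDerivAt h₁ (h₂ (ρ x)) (ρ x)) {x : Cn n} (hx : x ∈ V) (j k : Fin n) :
    leviCoeff (fun y => h (ρ y)) j k x = h₁ (ρ x) * leviCoeff ρ j k x +
      h₂ (ρ x) * (dz j (fun y => (ρ y : ℂ)) x *
        (starRingEnd ℂ) (dz k (fun y => (ρ y : ℂ)) x)) := by
  have hd : ∀ y ∈ V, DifferentiableAt ℝ ρ y := fun y hy =>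
    ((hρ y hy).contDiffAt (hV.mem_nhds hy)).differentiableAt (by simp)
  have hsec : ∀ f : Cn n → ℝ, ContDiffOn ℝ (⊤ : ℕ∞) f V →
      DifferentiableAt ℝ (fderiv ℝ fun y => (f y : ℂ)) x := fun f hf => by
    have := ((contDiff_ofReal_comp hf) x hx).contDiffAt (hV.mem_nhds hx)
    exact (this.fderiv_right (m := 1) (by exact two_le_top)).differentiableAt (by norm_num)
  unfold leviCoeff
  rw [← wirtingerD_wirtingerDbar (hsec _ hh), ← wirtingerD_wirtingerDbar (hsec _ hρ)]
  have hloc : (fun q => wirtingerDbar (fun y => ((h (ρ y) : ℝ) : ℂ)) q (EuclideanSpace.single k 1))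
      =ᶠ[𝓝 x] fun q => ((h₁ (ρ q) : ℝ) : ℂ) *
        wirtingerDbar (fun y => (ρ y : ℂ)) q (EuclideanSpace.single k 1) := by
    filter_upwards [hV.mem_nhds hx] with q hq
    exact wirtingerDbar_comp_ofReal (hd q hq) (h1 q hq) _
  have hcong : ∀ {f g : Cn n → ℂ} (_ : f =ᶠ[𝓝 x] g) (v : Cn n),
      wirtingerD f x v = wirtingerD g x v := fun hfg v => by
    simp only [wirtingerD, hfg.fderiv_eq]
  rw [hcong hloc]
  have hdb : DifferentiableAt ℝ
      (fun q => wirtingerDbar (fun y => (ρ y : ℂ)) q (EuclideanSpace.single k 1)) x :=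
    ((contDiffOn_wirtingerDbar hV (contDiff_ofReal_comp hρ) _ x hx).contDiffAt
      (hV.mem_nhds hx)).differentiableAt (by simp)
  have hdh : DifferentiableAt ℝ (fun q => ((h₁ (ρ q) : ℝ) : ℂ)) x :=
    (hasFDerivAt_comp_ofReal (hd x hx) (h2 x hx)).differentiableAt
  rw [wirtingerD_mul (f := fun q => ((h₁ (ρ q) : ℝ) : ℂ)) hdh hdb,
    wirtingerD_comp_ofReal (hd x hx) (h2 x hx), wirtingerDbar_ofReal (hd x hx)]
  simp only [dz]
  ring

/-- The radial profile `r ↦ χ(-m²r - 1) exp(1/(mr))` of the exhausting cut-offs. -/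
def cutoffProfile (m r : ℝ) : ℝ :=
  Real.smoothTransition (-(m ^ 2 * r) - 1) * Real.exp ((m * r)⁻¹)

lemma cutoffProfile_mem {m r : ℝ} (hm : 0 < m) (hr : r < 0) : cutoffProfile m r ∈ Icc (0:ℝ) 1 := by
  have h1 := Real.smoothTransition.nonneg (-(m ^ 2 * r) - 1)
  have h2 := Real.smoothTransition.le_one (-(m ^ 2 * r) - 1)
  have h3 : Real.exp ((m * r)⁻¹) ≤ 1 := by
    rw [Real.exp_le_one_iff, inv_nonpos]; exact (mul_neg_of_pos_of_neg hm hr).le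
  exact ⟨mul_nonneg h1 (Real.exp_pos _).le, mul_le_one₀ h2 (Real.exp_pos _).le h3⟩

lemma cutoffProfile_eq_zero {m r : ℝ} (hr : -1 < m ^ 2 * r) : cutoffProfile m r = 0 := by
  rw [cutoffProfile, Real.smoothTransition.zero_of_nonpos (by linarith), zero_mul]

lemma exists_deriv_smoothTransition_bound : ∃ C : ℝ, 0 ≤ C ∧ ∀ y,
    |deriv Real.smoothTransition y| ≤ C ∧
      (y ∉ Icc (0:ℝ) 1 → deriv Real.smoothTransition y = 0) := by
  have hz : ∀ y, y ∉ Icc (0:ℝ) 1 → deriv Real.smoothTransition y = 0 := by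
    intro y hy
    rw [mem_Icc, not_and_or, not_le, not_le] at hy
    rcases hy with hy | hy
    · have : Real.smoothTransition =ᶠ[𝓝 y] fun _ => 0 := by
        filter_upwards [Iio_mem_nhds hy] with u hu
        exact Real.smoothTransition.zero_of_nonpos hu.le
      rw [this.deriv_eq, deriv_const]
    · have : Real.smoothTransition =ᶠ[𝓝 y] fun _ => 1 := by
        filter_upwards [Ioi_mem_nhds hy] with u hu
        exact Real.smoothTransition.one_of_one_le hu.le
      rw [this.deriv_eq, deriv_const]
  have hc : Continuous (deriv Real.smoothTransition) :=
    (Real.smoothTransition.contDiff (n := 1)).continuous_deriv le_rfl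
  obtain ⟨C, hC⟩ := isCompact_Icc.exists_bound_of_continuousOn (s := Icc (0:ℝ) 1) hc.continuousOn
  refine ⟨max C 0, le_max_right _ _, fun y => ⟨?_, hz y⟩⟩
  by_cases hy : y ∈ Icc (0:ℝ) 1
  · exact (hC y hy).trans (le_max_left _ _)
  · rw [hz y hy]; simp

lemma exists_deriv_cutoffProfile_bound : ∃ C : ℝ, 0 ≤ C ∧ ∀ m : ℝ, 0 < m → ∀ r : ℝ, r < 0 →
    ∃ h' : ℝ, HasDerivAt (cutoffProfile m) h' r ∧
      h' ^ 2 ≤ C * (m ^ 4 * Real.exp (-m)) +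
        2 * (m ^ 2)⁻¹ * ((r ^ 4)⁻¹ * cutoffProfile m r ^ 2) := by
  obtain ⟨C, hC0, hC⟩ := exists_deriv_smoothTransition_bound
  refine ⟨2 * C ^ 2, by positivity, fun m hm r hr => ?_⟩
  set y : ℝ := -(m ^ 2 * r) - 1
  have hT : HasDerivAt Real.smoothTransition (deriv Real.smoothTransition y) y :=
    ((Real.smoothTransition.contDiff (n := 1)).differentiable (by norm_num) y).hasDerivAt
  have h1 : HasDerivAt (fun r : ℝ => -(m ^ 2 * r) - 1) (-(m ^ 2)) r := by
    simpa using ((hasDerivAt_id r).const_mul (m ^ 2)).neg.sub_const 1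
  have hmr : m * r ≠ 0 := (mul_neg_of_pos_of_neg hm hr).ne
  have h2 : HasDerivAt (fun r : ℝ => Real.exp ((m * r)⁻¹))
      (Real.exp ((m * r)⁻¹) * (-(m * 1) / (m * r) ^ 2)) r :=
    (((hasDerivAt_id r).const_mul m).inv hmr).exp
  have h3 := (hT.comp r h1).mul h2
  refine ⟨_, h3, ?_⟩
  simp only [Function.comp_def]
  set A := deriv Real.smoothTransition y * -(m ^ 2) * Real.exp ((m * r)⁻¹)
  have hB : Real.smoothTransition y * (Real.exp ((m * r)⁻¹) * (-(m * 1) / (m * r) ^ 2)) =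
      -(cutoffProfile m r * (m * r ^ 2)⁻¹) := by
    rw [cutoffProfile]
    have : -(m * 1) / (m * r) ^ 2 = -(m * r ^ 2)⁻¹ := by field_simp
    rw [this]; ring
  have hA : A ^ 2 ≤ C ^ 2 * (m ^ 4 * Real.exp (-m)) := by
    by_cases hy : y ∈ Icc (0:ℝ) 1
    · have e1 : Real.exp ((m * r)⁻¹) ^ 2 ≤ Real.exp (-m) := by
        rw [← Real.exp_nat_mul]
        refine Real.exp_le_exp.2 ?_
        have hy2 : m ^ 2 * (-r) ≤ 2 := by have := hy.2; simp only [y] at this; linarith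
        have : m / 2 ≤ (m * (-r))⁻¹ := by
          rw [le_inv_comm₀ (half_pos hm) (mul_pos hm (neg_pos.2 hr)), inv_div,
            le_div_iff₀ hm]
          nlinarith
        have e : (m * r)⁻¹ = -(m * (-r))⁻¹ := by rw [mul_neg, inv_neg, neg_neg]
        rw [e]; push_cast; linarith
      have e2 : deriv Real.smoothTransition y ^ 2 ≤ C ^ 2 := by
        rw [← sq_abs]; exact pow_le_pow_left₀ (abs_nonneg _) (hC y).1 2
      calc A ^ 2 = deriv Real.smoothTransition y ^ 2 * (m ^ 4 * Real.exp ((m * r)⁻¹) ^ 2) := by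
            simp only [A]; ring
        _ ≤ _ := by gcongr
    · have : A = 0 := by simp only [A, (hC y).2 hy]; ring
      rw [this, zero_pow two_ne_zero]; positivity
  have e3 : (-(cutoffProfile m r * (m * r ^ 2)⁻¹)) ^ 2 =
      (m ^ 2)⁻¹ * ((r ^ 4)⁻¹ * cutoffProfile m r ^ 2) := by
    rw [neg_sq, mul_pow, inv_pow, mul_pow, mul_inv, ← pow_mul]; ring
  rw [hB]
  have : (A + -(cutoffProfile m r * (m * r ^ 2)⁻¹)) ^ 2 ≤
      2 * A ^ 2 + 2 * (-(cutoffProfile m r * (m * r ^ 2)⁻¹)) ^ 2 := by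
    linarith [sq_nonneg (A - -(cutoffProfile m r * (m * r ^ 2)⁻¹)),
      add_sq A (-(cutoffProfile m r * (m * r ^ 2)⁻¹)),
      sub_sq A (-(cutoffProfile m r * (m * r ^ 2)⁻¹))]
  rw [e3] at this
  linarith

lemma contDiffOn_cutoffProfile (m : ℝ) (hm : 0 < m) :
    ContDiffOn ℝ (⊤ : ℕ∞) (cutoffProfile m) (Iio 0) := by
  unfold cutoffProfile
  refine ContDiffOn.mul (Real.smoothTransition.contDiff.comp_contDiffOn
    (by fun_prop)) (Real.contDiff_exp.comp_contDiffOn (ContDiffOn.inv (by fun_prop) ?_))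
  intro r hr
  exact (mul_neg_of_pos_of_neg hm hr).ne

/-- A bounded open set exhausted by the sublevel sets of a smooth defining function. -/
structure IsExhaustion {n : ℕ} (ρ : Cn n → ℝ) (V : Set (Cn n)) : Prop where
  isOpen : IsOpen V
  contDiffOn : ContDiffOn ℝ (⊤ : ℕ∞) ρ V
  neg : ∀ x ∈ V, ρ x < 0
  nonneg : ∀ x ∉ V, 0 ≤ ρ x
  isCompact : ∀ ε > 0, IsCompact {x | ρ x ≤ -ε}

variable {n : ℕ} {V : Set (Cn n)} {ρ : Cn n → ℝ}

lemma IsExhaustion.isTest_cutoff (h : IsExhaustion ρ V) {m : ℝ} (hm : 0 < m) :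
    IsTest V (fun x => ((cutoffProfile m (ρ x) : ℝ) : ℂ)) := by
  have hK := h.isCompact ((m ^ 2)⁻¹) (by positivity)
  have hKV : {x | ρ x ≤ -(m ^ 2)⁻¹} ⊆ V := fun x hx => by
    by_contra hxV
    have h1 := h.nonneg x hxV
    have h2 : 0 < (m ^ 2)⁻¹ := by positivity
    have : ρ x ≤ -(m ^ 2)⁻¹ := hx
    linarith
  have hz : ∀ x, x ∉ {x | ρ x ≤ -(m ^ 2)⁻¹} → cutoffProfile m (ρ x) = 0 := fun x hx => by
    apply cutoffProfile_eq_zero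
    have h1 : -(m ^ 2)⁻¹ < ρ x := not_le.1 hx
    have h2 : 0 < m ^ 2 := by positivity
    have := mul_lt_mul_of_pos_left h1 h2
    rwa [mul_neg, mul_inv_cancel₀ h2.ne'] at this
  have hsub : tsupport (fun x => ((cutoffProfile m (ρ x) : ℝ) : ℂ)) ⊆
      {x | ρ x ≤ -(m ^ 2)⁻¹} :=
    closure_minimal (fun x hx => by
      by_contra hx'
      exact hx (by simp [hz x hx'])) hK.isClosed
  refine ⟨?_, hK.of_isClosed_subset (isClosed_tsupport _) hsub, hsub.trans hKV⟩
  rw [contDiff_iff_contDiffAt]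
  intro x
  by_cases hx : x ∈ V
  · have h1 : ContDiffOn ℝ (⊤ : ℕ∞) (fun x => cutoffProfile m (ρ x)) V :=
      (contDiffOn_cutoffProfile m hm).comp h.contDiffOn (fun x hx => h.neg x hx)
    exact (contDiff_ofReal_comp h1 x hx).contDiffAt (h.isOpen.mem_nhds hx)
  · have : (fun x => ((cutoffProfile m (ρ x) : ℝ) : ℂ)) =ᶠ[𝓝 x] fun _ => 0 := by
      filter_upwards [hK.isClosed.isOpen_compl.mem_nhds (fun h' => hx (hKV h'))] with y hy
      rw [hz y hy]; simp
    exact contDiffAt_const.congr_of_eventuallyEq this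

lemma IsExhaustion.tendsto_cutoff (h : IsExhaustion ρ V) {x : Cn n} (hx : x ∈ V) :
    Tendsto (fun m : ℕ => cutoffProfile ((m : ℝ) + 1) (ρ x)) atTop (𝓝 1) := by
  have hr := h.neg x hx
  have hm : Tendsto (fun m : ℕ => (m : ℝ) + 1) atTop atTop :=
    tendsto_atTop_add_const_right _ _ tendsto_natCast_atTop_atTop
  have h1 : Tendsto (fun m : ℕ => Real.exp ((((m : ℝ) + 1) * ρ x)⁻¹)) atTop (𝓝 1) := by
    have : Tendsto (fun m : ℕ => (((m : ℝ) + 1) * ρ x)⁻¹) atTop (𝓝 0) :=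
      tendsto_inv_atBot_zero.comp (hm.atTop_mul_const_of_neg hr)
    simpa [Function.comp_def] using (Real.continuous_exp.tendsto 0).comp this
  have h2 : ∀ᶠ m : ℕ in atTop,
      Real.smoothTransition (-(((m : ℝ) + 1) ^ 2 * ρ x) - 1) = 1 := by
    have : Tendsto (fun m : ℕ => ((m : ℝ) + 1) ^ 2 * ρ x) atTop atBot :=
      ((tendsto_pow_atTop two_ne_zero).comp hm).atTop_mul_const_of_neg hr
    filter_upwards [this.eventually_le_atBot (-2)] with m hm'
    exact Real.smoothTransition.one_of_one_le (by linarith)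
  refine h1.congr' ?_
  filter_upwards [h2] with m hm'
  rw [cutoffProfile, hm', one_mul]

lemma IsExhaustion.cutoff_gradient (h : IsExhaustion ρ V) {M : ℝ}
    (hM : ∀ x ∈ V, ∑ j, ‖dz j (fun y => (ρ y : ℂ)) x‖ ^ 2 ≤ M) {κ : ℝ} (hκ : 0 < κ) {δ : ℝ}
    (hδ : 0 < δ) : ∀ᶠ m : ℕ in atTop, ∀ x ∈ V,
      ∑ j, ‖dz j (fun y => ((cutoffProfile ((m : ℝ) + 1) (ρ y) : ℝ) : ℂ)) x‖ ^ 2 ≤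
        δ ^ 2 * (κ * (ρ x ^ 4)⁻¹ * cutoffProfile ((m : ℝ) + 1) (ρ x) ^ 2 + 1) := by
  obtain ⟨C, hC0, hC⟩ := exists_deriv_cutoffProfile_bound
  have hm : Tendsto (fun m : ℕ => (m : ℝ) + 1) atTop atTop :=
    tendsto_atTop_add_const_right _ _ tendsto_natCast_atTop_atTop
  have t1 : Tendsto (fun m : ℕ => |M| * (C * (((m : ℝ) + 1) ^ 4 * Real.exp (-((m : ℝ) + 1)))))
      atTop (𝓝 0) := by
    simpa using
      (((Real.tendsto_pow_mul_exp_neg_atTop_nhds_zero 4).comp hm).const_mul C).const_mul |M|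
  have t2 : Tendsto (fun m : ℕ => |M| * (2 * (((m : ℝ) + 1) ^ 2)⁻¹)) atTop (𝓝 0) := by
    have := (tendsto_inv_atTop_zero.comp ((tendsto_pow_atTop two_ne_zero).comp hm))
    simpa using (this.const_mul 2).const_mul |M|
  filter_upwards [t1.eventually_le_const (show (0:ℝ) < δ ^ 2 by positivity),
    t2.eventually_le_const (show (0:ℝ) < δ ^ 2 * κ by positivity)] with m h1 h2 x hx
  set μ : ℝ := (m : ℝ) + 1
  have hμ : 0 < μ := by positivity
  obtain ⟨h', hd, hb⟩ := hC μ hμ (ρ x) (h.neg x hx)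
  have hdρ : DifferentiableAt ℝ ρ x :=
    ((h.contDiffOn x hx).contDiffAt (h.isOpen.mem_nhds hx)).differentiableAt (by simp)
  have e1 : ∀ j, ‖dz j (fun y => ((cutoffProfile μ (ρ y) : ℝ) : ℂ)) x‖ ^ 2 =
      h' ^ 2 * ‖dz j (fun y => (ρ y : ℂ)) x‖ ^ 2 := fun j => by
    rw [dz, wirtingerD_comp_ofReal hdρ hd, norm_mul, mul_pow, Complex.norm_real,
      Real.norm_eq_abs, sq_abs]; rfl
  have hM' : ∑ j, ‖dz j (fun y => (ρ y : ℂ)) x‖ ^ 2 ≤ |M| := (hM x hx).trans (le_abs_self _)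
  have hr4 : 0 ≤ (ρ x ^ 4)⁻¹ * cutoffProfile μ (ρ x) ^ 2 := by positivity
  calc ∑ j, ‖dz j (fun y => ((cutoffProfile μ (ρ y) : ℝ) : ℂ)) x‖ ^ 2
      = h' ^ 2 * ∑ j, ‖dz j (fun y => (ρ y : ℂ)) x‖ ^ 2 := by
        rw [Finset.mul_sum]; exact Finset.sum_congr rfl fun j _ => e1 j
    _ ≤ h' ^ 2 * |M| := by gcongr
    _ ≤ (C * (μ ^ 4 * Real.exp (-μ)) + 2 * (μ ^ 2)⁻¹ *
          ((ρ x ^ 4)⁻¹ * cutoffProfile μ (ρ x) ^ 2)) * |M| := by gcongr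
    _ = |M| * (C * (μ ^ 4 * Real.exp (-μ))) + |M| * (2 * (μ ^ 2)⁻¹) *
          ((ρ x ^ 4)⁻¹ * cutoffProfile μ (ρ x) ^ 2) := by ring
    _ ≤ δ ^ 2 + δ ^ 2 * κ * ((ρ x ^ 4)⁻¹ * cutoffProfile μ (ρ x) ^ 2) := by gcongr
    _ = _ := by ring

lemma leviForm_add {F : Type*} [NormedAddCommGroup F] [NormedSpace ℂ F] {f g : F → ℂ} {p : F}
    (hf : ContDiffAt ℝ 2 f p) (hg : ContDiffAt ℝ 2 g p) (v w : F) :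
    leviForm (fun y => f y + g y) p v w = leviForm f p v w + leviForm g p v w := by
  have h1 : fderiv ℝ (fun y => f y + g y) =ᶠ[𝓝 p] fun y => fderiv ℝ f y + fderiv ℝ g y := by
    filter_upwards [hf.eventually (by norm_num), hg.eventually (by norm_num)] with y hy hy'
    exact fderiv_fun_add (hy.differentiableAt (by norm_num)) (hy'.differentiableAt (by norm_num))
  have h2 : fderiv ℝ (fderiv ℝ fun y => f y + g y) p =
      fderiv ℝ (fderiv ℝ f) p + fderiv ℝ (fderiv ℝ g) p := by
    rw [h1.fderiv_eq]
    exact fderiv_fun_add ((hf.fderiv_right (m := 1) (by norm_num)).differentiableAt (by norm_num))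
      ((hg.fderiv_right (m := 1) (by norm_num)).differentiableAt (by norm_num))
  simp only [leviForm, h2, add_apply]
  ring

variable {n : ℕ} {V : Set (Cn n)} {ρ φ : Cn n → ℝ}

/-- The function `ε / (-r)³`, which blows up at the boundary. -/
def barrier (ε r : ℝ) : ℝ := ε * -(r ^ 3)⁻¹

lemma barrier_nonneg {ε r : ℝ} (hε : 0 ≤ ε) (hr : r < 0) : 0 ≤ barrier ε r := by
  have : (r ^ 3)⁻¹ ≤ 0 := inv_nonpos.2 ((Odd.pow_neg (by decide) hr).le)
  exact mul_nonneg hε (neg_nonneg.2 this)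

lemma IsExhaustion.contDiffOn_barrier (h : IsExhaustion ρ V) (ε : ℝ) :
    ContDiffOn ℝ (⊤ : ℕ∞) (fun x => barrier ε (ρ x)) V := by
  unfold barrier
  exact contDiffOn_const.mul ((h.contDiffOn.pow 3).inv fun x hx =>
    pow_ne_zero 3 (h.neg x hx).ne).neg

lemma IsExhaustion.levi_barrier (h : IsExhaustion ρ V) (hφ : ContDiffOn ℝ (⊤ : ℕ∞) φ V) {c : ℝ}
    (hlev : ∀ x ∈ V, ∀ a : Fin n → ℂ, c * ∑ k, ‖a k‖ ^ 2 ≤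
      (∑ j, ∑ k, leviCoeff ρ j k x * a j * (starRingEnd ℂ) (a k)).re) {ε : ℝ} (hε : 0 < ε)
    {x : Cn n} (hx : x ∈ V) (a : Fin n → ℂ) :
    (∑ j, ∑ k, leviCoeff φ j k x * a j * (starRingEnd ℂ) (a k)).re +
        (3 * ε * c) * (ρ x ^ 4)⁻¹ * ∑ k, ‖a k‖ ^ 2 ≤
      (∑ j, ∑ k, leviCoeff (fun y => φ y + barrier ε (ρ y)) j k x * a j *
        (starRingEnd ℂ) (a k)).re := by
  have hat : ∀ f : Cn n → ℝ, ContDiffOn ℝ (⊤ : ℕ∞) f V →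
      ContDiffAt ℝ 2 (fun y => (f y : ℂ)) x := fun f hf =>
    (((contDiff_ofReal_comp hf) x hx).contDiffAt (h.isOpen.mem_nhds hx)).of_le two_le_top
  have hd : ∀ y ∈ V, ρ y ≠ 0 := fun y hy => (h.neg y hy).ne
  have e1 : ∀ j k, leviCoeff (fun y => φ y + barrier ε (ρ y)) j k x =
      leviCoeff φ j k x + (((ε * (3 * (ρ x ^ 4)⁻¹) : ℝ) : ℂ) * leviCoeff ρ j k x +
        ((ε * (-(12 * (ρ x ^ 5)⁻¹)) : ℝ) : ℂ) * (dz j (fun y => (ρ y : ℂ)) x *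
        (starRingEnd ℂ) (dz k (fun y => (ρ y : ℂ)) x))) := fun j k => by
    have := leviForm_add (hat φ hφ) (hat _ (h.contDiffOn_barrier ε))
      (EuclideanSpace.single j 1) (EuclideanSpace.single k 1)
    rw [← leviCoeff_comp (h := barrier ε) (h₁ := fun r => ε * (3 * (r ^ 4)⁻¹))
      (h₂ := fun r => ε * (-(12 * (r ^ 5)⁻¹))) h.isOpen h.contDiffOn (h.contDiffOn_barrier ε)
      (fun y hy => ?_) (fun y hy => ?_) hx]
    · simpa only [leviCoeff, Complex.ofReal_add] using this
    · have := ((((hasDerivAt_id (ρ y)).pow 3).inv (pow_ne_zero 3 (hd y hy))).neg).const_mul ε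
      refine this.congr_deriv ?_
      have := hd y hy
      simp only [id, Pi.pow_apply]
      field_simp
      norm_num [mul_comm]
    · have :=
        ((((hasDerivAt_id (ρ y)).pow 4).inv (pow_ne_zero 4 (hd y hy))).const_mul 3).const_mul ε
      refine this.congr_deriv ?_
      have := hd y hy
      simp only [id, Pi.pow_apply]
      field_simp
      norm_num [mul_comm]
  have e2 : (∑ j, ∑ k, leviCoeff (fun y => φ y + barrier ε (ρ y)) j k x * a j *
        (starRingEnd ℂ) (a k)) =
      (∑ j, ∑ k, leviCoeff φ j k x * a j * (starRingEnd ℂ) (a k)) +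
      ((ε * (3 * (ρ x ^ 4)⁻¹) : ℝ) : ℂ) *
        (∑ j, ∑ k, leviCoeff ρ j k x * a j * (starRingEnd ℂ) (a k))
      + ((ε * (-(12 * (ρ x ^ 5)⁻¹)) : ℝ) : ℂ) *
        ((‖∑ j, dz j (fun y => (ρ y : ℂ)) x * a j‖ ^ 2 : ℝ) : ℂ) := by
    have : ((‖∑ j, dz j (fun y => (ρ y : ℂ)) x * a j‖ ^ 2 : ℝ) : ℂ) =
        ∑ j, ∑ k, (dz j (fun y => (ρ y : ℂ)) x * (starRingEnd ℂ) (dz k (fun y => (ρ y : ℂ)) x))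
          * a j * (starRingEnd ℂ) (a k) := by
      rw [Complex.ofReal_pow, ← Complex.mul_conj', map_sum, Finset.sum_mul_sum]
      refine Finset.sum_congr rfl fun j _ => Finset.sum_congr rfl fun k _ => ?_
      rw [map_mul]; ring
    rw [this]
    simp only [e1, Finset.mul_sum, ← Finset.sum_add_distrib]
    refine Finset.sum_congr rfl fun j _ => Finset.sum_congr rfl fun k _ => ?_
    ring
  rw [e2, Complex.add_re, Complex.add_re, Complex.re_ofReal_mul, Complex.re_ofReal_mul,
    Complex.ofReal_re]
  have h5 : (ρ x ^ 5)⁻¹ ≤ 0 := inv_nonpos.2 ((Odd.pow_neg (by decide) (h.neg x hx)).le)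
  have h6 : 0 ≤ ε * (-(12 * (ρ x ^ 5)⁻¹)) * ‖∑ j, dz j (fun y => (ρ y : ℂ)) x * a j‖ ^ 2 :=
    mul_nonneg (mul_nonneg hε.le (by linarith)) (by positivity)
  have h7 : ε * (3 * (ρ x ^ 4)⁻¹) * (c * ∑ k, ‖a k‖ ^ 2) ≤ ε * (3 * (ρ x ^ 4)⁻¹) *
      (∑ j, ∑ k, leviCoeff ρ j k x * a j * (starRingEnd ℂ) (a k)).re :=
    mul_le_mul_of_nonneg_left (hlev x hx a) (by positivity)
  have h8 : ε * (3 * (ρ x ^ 4)⁻¹) * (c * ∑ k, ‖a k‖ ^ 2) =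
      (3 * ε * c) * (ρ x ^ 4)⁻¹ * ∑ k, ‖a k‖ ^ 2 := by ring
  linarith

/-- The dual estimate for the weight `φ + ε (-ρ)⁻³`, with the perturbation discarded on the side
where it helps. -/
lemma IsExhaustion.two_re_integral_le_barrier (h : IsExhaustion ρ V)
    (hφ : ContDiffOn ℝ (⊤ : ℕ∞) φ V) {M : ℝ}
    (hM : ∀ x ∈ V, ∑ j, ‖dz j (fun y => (ρ y : ℂ)) x‖ ^ 2 ≤ M) {c : ℝ} (hc : 0 < c)
    (hlev : ∀ x ∈ V, ∀ a : Fin n → ℂ, c * ∑ k, ‖a k‖ ^ 2 ≤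
      (∑ j, ∑ k, leviCoeff ρ j k x * a j * (starRingEnd ℂ) (a k)).re)
    {b : Fin n → Cn n → ℂ} (hb : ∀ j, IsTest V (b j)) {f : Fin n → Cn n → ℂ}
    (hf : IsWeaklyClosed V f)
    (hfL : ∀ j, MemLp (V.indicator fun x => ew φ (-1 / 2) x * f j x) 2 volume)
    {F : Cn n → ℝ} (hF0 : ∀ x ∈ V, 0 ≤ F x)
    (hFi : IntegrableOn (fun x => F x * Real.exp (-φ x)) V)
    (hpt : ∀ x ∈ V, ∀ a : Fin n → ℂ, 2 * (∑ k, f k x * (starRingEnd ℂ) (a k)).re ≤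
      F x + (∑ j, ∑ k, leviCoeff φ j k x * a j * (starRingEnd ℂ) (a k)).re)
    {ε : ℝ} (hε : 0 < ε) :
    2 * (∫ x, ∑ j, f j x * (starRingEnd ℂ) (b j x)).re ≤
      (∫ x in V, F x * Real.exp (-φ x)) +
        ∫ x, ‖∑ j, dz j (b j) x‖ ^ 2 * Real.exp (φ x + barrier ε (ρ x)) := by
  set ψ : Cn n → ℝ := fun y => φ y + barrier ε (ρ y) with hψdef
  have hB := h.contDiffOn_barrier ε
  have hψ : ContDiffOn ℝ (⊤ : ℕ∞) ψ V := hφ.add hB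
  have hVm : MeasurableSet V := h.isOpen.measurableSet
  have hBn : ∀ x ∈ V, 0 ≤ barrier ε (ρ x) := fun x hx => barrier_nonneg hε.le (h.neg x hx)
  have hψL : ∀ j, MemLp (V.indicator fun x => ew ψ (-1 / 2) x * f j x) 2 volume := fun j => by
    have e : (V.indicator fun x => ew ψ (-1 / 2) x * f j x) = fun x =>
        V.indicator (ew (fun x => barrier ε (ρ x)) (-1 / 2)) x *
          V.indicator (fun x => ew φ (-1 / 2) x * f j x) x := by
      funext x
      by_cases hx : x ∈ V
      · simp only [indicator_of_mem hx, hψdef, ew]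
        rw [← mul_assoc, ← Complex.ofReal_mul, ← Real.exp_add]
        congr 3; ring
      · simp [indicator_of_notMem hx]
    rw [e]
    refine memLp_bdd_mul (hfL j) ?_ (B := 1) fun x => ?_
    · exact (aestronglyMeasurable_indicator_iff hVm).2
        ((contDiffOn_ew hB (-1 / 2)).continuousOn.aestronglyMeasurable hVm)
    · by_cases hx : x ∈ V
      · rw [indicator_of_mem hx, norm_ew, Real.exp_le_one_iff]
        linarith [hBn x hx]
      · simp [indicator_of_notMem hx]
  have hle : ∀ x ∈ V, F x * Real.exp (-ψ x) ≤ F x * Real.exp (-φ x) := fun x hx =>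
    mul_le_mul_of_nonneg_left (Real.exp_le_exp.2 (by simp only [hψdef]; linarith [hBn x hx]))
      (hF0 x hx)
  have hψi : IntegrableOn (fun x => F x * Real.exp (-ψ x)) V := by
    have hm : AEStronglyMeasurable (fun x => Real.exp (-barrier ε (ρ x))) (volume.restrict V) :=
      (Real.continuous_exp.comp_continuousOn hB.continuousOn.neg).aestronglyMeasurable hVm
    refine (Integrable.mono' hFi (f := fun x => F x * Real.exp (-ψ x)) ?_ ?_)
    · refine (hFi.1.mul hm).congr (Eventually.of_forall fun x => ?_)
      simp only [hψdef, Pi.mul_apply]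
      rw [mul_assoc, ← Real.exp_add]; congr 2; ring
    · filter_upwards [ae_restrict_mem hVm] with x hx
      rw [Real.norm_eq_abs, abs_of_nonneg (mul_nonneg (hF0 x hx) (Real.exp_pos _).le)]
      exact hle x hx
  have main := two_re_integral_le h.isOpen hψ hb hf hψL hF0 hψi
    (K := fun x => (3 * ε * c) * (ρ x ^ 4)⁻¹) (fun x _ => by positivity) (fun x hx a => by
      have h1 := hpt x hx a
      have h2 := h.levi_barrier hφ hlev hε hx a
      linarith)
    (η := fun m x => cutoffProfile ((m : ℝ) + 1) (ρ x)) (fun m => h.isTest_cutoff (by positivity))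
    (fun m x => by
      by_cases hx : x ∈ V
      · exact cutoffProfile_mem (by positivity) (h.neg x hx)
      · have h1 : 0 ≤ ((m : ℝ) + 1) ^ 2 * ρ x := mul_nonneg (by positivity) (h.nonneg x hx)
        rw [cutoffProfile_eq_zero (by linarith)]
        exact ⟨le_rfl, zero_le_one⟩)
    (fun x hx => h.tendsto_cutoff hx)
    (fun δ hδ => h.cutoff_gradient hM (by positivity) hδ)
  have hintg : (∫ x in V, F x * Real.exp (-ψ x)) ≤ ∫ x in V, F x * Real.exp (-φ x) :=
    setIntegral_mono_on hψi hFi hVm hle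
  linarith

lemma IsTest.integrable_norm_sq_mul (hV : IsOpen V) {v : Cn n → ℂ} (hv : IsTest V v)
    {g : Cn n → ℝ} (hg : ContinuousOn g V) : Integrable fun x => ‖v x‖ ^ 2 * g x := by
  refine Continuous.integrable_of_hasCompactSupport ?_ ?_
  · rw [continuous_iff_continuousAt]
    intro x
    by_cases hx : x ∈ V
    · exact (hv.smooth.continuous.continuousAt.norm.pow 2).mul (hg.continuousAt (hV.mem_nhds hx))
    · have : (fun x => ‖v x‖ ^ 2 * g x) =ᶠ[𝓝 x] fun _ => 0 := by
        filter_upwards [(isClosed_tsupport v).isOpen_compl.mem_nhds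
          (fun h' => hx (hv.subset h'))] with y hy
        rw [image_eq_zero_of_notMem_tsupport hy]; simp
      exact (continuousAt_const (y := (0:ℝ))).congr this.symm
  · exact (hv.compact.comp_left (g := fun z : ℂ => ‖z‖ ^ 2) (by simp)).mul_right

/-- **The dual form of Hörmander's estimate** on a bounded strictly pseudoconvex domain. -/
theorem IsExhaustion.two_re_integral_le (h : IsExhaustion ρ V)
    (hφ : ContDiffOn ℝ (⊤ : ℕ∞) φ V) {M : ℝ}
    (hM : ∀ x ∈ V, ∑ j, ‖dz j (fun y => (ρ y : ℂ)) x‖ ^ 2 ≤ M) {c : ℝ} (hc : 0 < c)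
    (hlev : ∀ x ∈ V, ∀ a : Fin n → ℂ, c * ∑ k, ‖a k‖ ^ 2 ≤
      (∑ j, ∑ k, leviCoeff ρ j k x * a j * (starRingEnd ℂ) (a k)).re)
    {b : Fin n → Cn n → ℂ} (hb : ∀ j, IsTest V (b j)) {f : Fin n → Cn n → ℂ}
    (hf : IsWeaklyClosed V f)
    (hfL : ∀ j, MemLp (V.indicator fun x => ew φ (-1 / 2) x * f j x) 2 volume)
    {F : Cn n → ℝ} (hF0 : ∀ x ∈ V, 0 ≤ F x)
    (hFi : IntegrableOn (fun x => F x * Real.exp (-φ x)) V)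
    (hpt : ∀ x ∈ V, ∀ a : Fin n → ℂ, 2 * (∑ k, f k x * (starRingEnd ℂ) (a k)).re ≤
      F x + (∑ j, ∑ k, leviCoeff φ j k x * a j * (starRingEnd ℂ) (a k)).re) :
    2 * (∫ x, ∑ j, f j x * (starRingEnd ℂ) (b j x)).re ≤
      (∫ x in V, F x * Real.exp (-φ x)) +
        ∫ x, ‖∑ j, dz j (b j) x‖ ^ 2 * Real.exp (φ x) := by
  set v : Cn n → ℂ := fun x => ∑ j, dz j (b j) x with hvdef
  have hv : IsTest V v := IsTest.sum _ fun j _ => (hb j).dz j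
  have hε : Tendsto (fun m : ℕ => 1 / ((m : ℝ) + 1)) atTop (𝓝 0) :=
    tendsto_one_div_add_atTop_nhds_zero_nat
  have hlim : Tendsto (fun m : ℕ => ∫ x, ‖v x‖ ^ 2 *
      Real.exp (φ x + barrier (1 / ((m : ℝ) + 1)) (ρ x))) atTop
      (𝓝 (∫ x, ‖v x‖ ^ 2 * Real.exp (φ x))) := by
    have hcB : ∀ ε, ContinuousOn (fun x => Real.exp (φ x + barrier ε (ρ x))) V := fun ε =>
      Real.continuous_exp.comp_continuousOn
        (hφ.continuousOn.add (h.contDiffOn_barrier ε).continuousOn)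
    refine tendsto_integral_of_dominated_convergence
      (fun x => ‖v x‖ ^ 2 * Real.exp (φ x + barrier 1 (ρ x)))
      (fun m => (hv.integrable_norm_sq_mul h.isOpen (hcB _)).1)
      (hv.integrable_norm_sq_mul h.isOpen (hcB 1)) (fun m => Eventually.of_forall fun x => ?_)
      (Eventually.of_forall fun x => ?_)
    · rw [Real.norm_eq_abs, abs_of_nonneg (by positivity)]
      by_cases hx : x ∈ V
      · have h1 : 0 ≤ -(ρ x ^ 3)⁻¹ := by
          simpa [barrier] using barrier_nonneg zero_le_one (h.neg x hx)
        have h2 : 1 / ((m : ℝ) + 1) ≤ 1 := by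
          rw [div_le_one (by positivity)]; linarith [(Nat.cast_nonneg m : (0:ℝ) ≤ m)]
        have : barrier (1 / ((m : ℝ) + 1)) (ρ x) ≤ barrier 1 (ρ x) :=
          mul_le_mul_of_nonneg_right h2 h1
        gcongr
      · rw [hv.zero_outside hx]; simp
    · have h1 : Tendsto (fun m : ℕ => φ x + barrier (1 / ((m : ℝ) + 1)) (ρ x)) atTop
          (𝓝 (φ x + 0 * -(ρ x ^ 3)⁻¹)) := tendsto_const_nhds.add (hε.mul_const _)
      rw [zero_mul, add_zero] at h1
      exact ((Real.continuous_exp.tendsto _).comp h1).const_mul _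
  exact ge_of_tendsto (tendsto_const_nhds.add hlim) (Eventually.of_forall fun m =>
    h.two_re_integral_le_barrier hφ hM hc hlev hb hf hfL hF0 hFi hpt (by positivity))

section Weyl

variable {n : ℕ}

lemma measurePreserving_circle_smul (c : Circle) :
    MeasurePreserving (fun y : Cn n => (c : ℂ) • y) volume volume := by
  have hpi : MeasurePreserving (fun (a : Fin n → ℂ) i => rotation c (a i)) volume volume :=
    volume_preserving_pi fun _ => (rotation c).measurePreserving
  have hm : Measurable (EuclideanSpace.equiv (Fin n) ℂ).symm :=
    (EuclideanSpace.equiv (Fin n) ℂ).symm.continuous.measurable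
  have hs : Measurable (fun y : Cn n => (c : ℂ) • y) := (continuous_const_smul (c : ℂ)).measurable
  refine ⟨hs, ?_⟩
  change Measure.map _ (Measure.map _ volume) = Measure.map _ volume
  rw [Measure.map_map hs hm]
  conv_rhs => rw [← hpi.map_eq]
  rw [Measure.map_map hm hpi.measurable]
  congr 1

lemma integral_circle_smul (c : Circle) (g : Cn n → ℂ) :
    ∫ y, g ((c : ℂ) • y) = ∫ y, g y := by
  have hc : (c : ℂ) ≠ 0 := c.coe_ne_zero
  exact (measurePreserving_circle_smul c).integral_comp
    (Homeomorph.smulOfNeZero (c : ℂ) hc).measurableEmbedding g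

lemma mollify_congr {m : ℕ} {f g : Cn n → ℂ} {x : Cn n}
    (h : EqOn f g (closedBall x (1 / ((m : ℝ) + 1)))) : mollify m f x = mollify m g x := by
  refine integral_congr_ae (Eventually.of_forall fun t => ?_)
  by_cases ht : t ∈ closedBall x (1 / ((m : ℝ) + 1))
  · simp only [h ht]
  · have : moll n m (x - t) = 0 := moll_eq_zero (by
      rw [mem_closedBall, dist_comm, dist_eq_norm, not_le] at ht; exact ht.le)
    simp [this]

lemma mollify_eq_of_bounded {m : ℕ} {h : Cn n → ℂ} {x : Cn n} {V : Set (Cn n)} {C : ℝ}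
    (hV : IsOpen V) (hx : closedBall x (1 / ((m : ℝ) + 1)) ⊆ V) (hh : DifferentiableOn ℂ h V)
    (hc : Continuous h) (hC : ∀ y, ‖h y‖ ≤ C) : mollify m h x = h x := by
  set F : ℝ → Cn n → ℂ := fun θ y => h (x - circleMap 0 1 θ • y) * moll n m y with hF
  have h0 : ∀ θ, ∫ y, F θ y = mollify m h x := by
    intro θ
    have e1 : mollify m h x = ∫ y, h (x - y) * moll n m y := by
      rw [mollify, ← integral_sub_left_eq_self (fun t => h t * moll n m (x - t)) volume x]
      simp
    rw [e1, ← integral_circle_smul (Circle.exp θ) (fun y => h (x - y) * moll n m y)]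
    refine integral_congr_ae (Eventually.of_forall fun y => ?_)
    simp only [hF, circleMap, Circle.coe_exp]
    have : moll n m (Complex.exp (θ * I) • y) = moll n m y :=
      moll_congr_norm m (by rw [norm_smul, Complex.norm_exp_ofReal_mul_I, one_mul])
    simp [this]
  have hFc : Continuous (Function.uncurry F) := by
    have hm : Continuous (moll n m) := (moll_contDiff m).continuous
    simp only [hF, Function.uncurry_def]
    have := continuous_circleMap 0 1
    fun_prop
  have hintg : Integrable (Function.uncurry F)
      ((volume.restrict (Ioc 0 (2 * Real.pi))).prod volume) := by
    have hb : Integrable (fun p : ℝ × Cn n => C * ‖moll n m p.2‖)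
        ((volume.restrict (Ioc 0 (2 * Real.pi))).prod volume) :=
      ((((moll_isTest m).integrable).norm).const_mul C).comp_snd _
    refine hb.mono' hFc.aestronglyMeasurable (Eventually.of_forall fun p => ?_)
    simp only [hF, Function.uncurry_def, norm_mul]
    exact mul_le_mul_of_nonneg_right (hC _) (norm_nonneg _)
  have hsw := integral_integral_swap hintg
  have hmean : ∀ y, ∫ θ in Ioc 0 (2 * Real.pi), F θ y = (2 * Real.pi : ℝ) * (h x * moll n m y) := by
    intro y
    by_cases hy : 1 / ((m : ℝ) + 1) ≤ ‖y‖
    · simp [hF, moll_eq_zero hy]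
    push Not at hy
    have hd : DiffContOnCl ℂ (fun l : ℂ => h (x - l • y)) (ball 0 |(1 : ℝ)|) := by
      refine DifferentiableOn.diffContOnCl ?_
      rw [abs_one, closure_ball _ one_ne_zero]
      intro l hl
      have hmem : x - l • y ∈ V := by
        refine hx ?_
        rw [mem_closedBall, dist_eq_norm, sub_sub_cancel_left, norm_neg, norm_smul]
        rw [mem_closedBall, dist_zero_right] at hl
        nlinarith [norm_nonneg y, norm_nonneg l]
      refine DifferentiableAt.differentiableWithinAt ?_
      refine DifferentiableAt.comp l ((hh _ hmem).differentiableAt (hV.mem_nhds hmem)) ?_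
      fun_prop
    have := hd.circleAverage
    rw [Real.circleAverage, intervalIntegral.integral_of_le Real.two_pi_pos.le] at this
    simp only [zero_smul, sub_zero] at this
    simp only [hF]
    rw [integral_mul_const, ← this, Complex.real_smul, ← mul_assoc, ← mul_assoc,
      ← Complex.ofReal_mul, mul_inv_cancel₀ Real.two_pi_pos.ne', Complex.ofReal_one, one_mul]
  simp only [h0, hmean] at hsw
  rw [integral_const, integral_const_mul, integral_const_mul, moll_integral, mul_one] at hsw
  simp only [measureReal_restrict_apply_univ, Real.volume_real_Ioc, sub_zero,
    max_eq_left Real.two_pi_pos.le, Complex.real_smul] at hsw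
  exact mul_left_cancel₀ (by exact_mod_cast Real.two_pi_pos.ne') hsw

lemma mollify_eq_of_differentiableOn {m : ℕ} {h : Cn n → ℂ} {x : Cn n} {V : Set (Cn n)}
    (hV : IsOpen V) (hx : closedBall x (1 / ((m : ℝ) + 1)) ⊆ V) (hh : DifferentiableOn ℂ h V) :
    mollify m h x = h x := by
  obtain ⟨κ, hκ, hκc, hκV, hκ1, -⟩ :=
    exists_cutoff (isCompact_closedBall x (1 / ((m : ℝ) + 1))) hV hx
  obtain ⟨O, hO, hKO, hO1⟩ := eventually_nhdsSet_iff_exists.1 hκ1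
  have hE : EqOn (fun y => (κ y : ℂ) * h y) h O := fun y hy => by simp [hO1 y hy]
  have hc : Continuous (fun y => (κ y : ℂ) * h y) := by
    rw [continuous_iff_continuousAt]
    intro y
    by_cases hy : y ∈ tsupport κ
    · exact (Complex.continuous_ofReal.comp hκ.continuous).continuousAt.mul
        ((hh y (hκV hy)).differentiableAt (hV.mem_nhds (hκV hy))).continuousAt
    · have : (fun y => (κ y : ℂ) * h y) =ᶠ[𝓝 y] fun _ => 0 := by
        filter_upwards [notMem_tsupport_iff_eventuallyEq.1 hy] with w hw
        simp [hw]
      exact continuousAt_const.congr this.symm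
  have hcs : HasCompactSupport (fun y => (κ y : ℂ) * h y) := by
    refine hκc.mono fun y hy => ?_
    contrapose! hy
    simp only [Function.mem_support, not_not] at hy ⊢
    simp [hy]
  obtain ⟨C, hC⟩ := hcs.exists_bound_of_continuous hc
  have hd : DifferentiableOn ℂ (fun y => (κ y : ℂ) * h y) (O ∩ V) :=
    (hh.mono inter_subset_right).congr fun y hy => hE hy.1
  rw [← mollify_congr (f := fun y => (κ y : ℂ) * h y) (fun y hy => hE (hKO hy)),
    mollify_eq_of_bounded (hO.inter hV) (subset_inter hKO hx) hd hc hC]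
  exact hE (hKO (mem_closedBall_self (by positivity)))

lemma differentiableAt_of_dzb_eq_zero {f : Cn n → ℂ} {x : Cn n} (hf : DifferentiableAt ℝ f x)
    (h : ∀ j, dzb j f x = 0) : DifferentiableAt ℂ f x := by
  rw [differentiableAt_iff_restrictScalars ℝ hf]
  have hI : ∀ j, fderiv ℝ f x (I • EuclideanSpace.single j 1) =
      I * fderiv ℝ f x (EuclideanSpace.single j 1) := by
    intro j
    have := h j
    rw [dzb, wirtingerDbar] at this
    have h2 : fderiv ℝ f x (EuclideanSpace.single j 1) +
        I * fderiv ℝ f x (I • EuclideanSpace.single j 1) = 0 := by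
      rcases mul_eq_zero.1 this with h' | h'
      · norm_num at h'
      · exact h'
    linear_combination (-I) * h2 + (fderiv ℝ f x (I • EuclideanSpace.single j 1)) * I_mul_I
  let L : Cn n →L[ℂ] ℂ := ∑ j, (fderiv ℝ f x (EuclideanSpace.single j 1)) •
    (EuclideanSpace.proj (𝕜 := ℂ) j)
  refine ⟨L, ?_⟩
  ext v
  have hv : v = ∑ j, (v j) • EuclideanSpace.single j (1 : ℂ) := by
    ext i
    simp [Finset.sum_apply, Pi.single_apply]
  conv_rhs => rw [hv, map_sum]
  simp only [L, ContinuousLinearMap.coe_restrictScalars', sum_apply,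
    smul_apply, smul_eq_mul]
  refine Finset.sum_congr rfl fun j _ => ?_
  rw [complex_smul_eq (v j), map_add, map_smul, map_smul, hI j, Complex.real_smul,
    Complex.real_smul]
  have : (EuclideanSpace.proj (𝕜 := ℂ) j) v = v j := rfl
  rw [this]
  conv_lhs => rw [← Complex.re_add_im (v j)]
  ring

lemma dzb_eq_zero_of_differentiableAt {f : Cn n → ℂ} {x : Cn n} (hf : DifferentiableAt ℂ f x)
    (j : Fin n) : dzb j f x = 0 := by
  rw [dzb, wirtingerDbar, hf.fderiv_restrictScalars ℝ]
  simp only [ContinuousLinearMap.coe_restrictScalars', map_smul, smul_eq_mul]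
  rw [← mul_assoc, I_mul_I]; ring

lemma contDiffOn_of_differentiableOn {h : Cn n → ℂ} {V : Set (Cn n)} (hV : IsOpen V)
    (hh : DifferentiableOn ℂ h V) : ContDiffOn ℝ (⊤ : ℕ∞) h V := by
  intro x hx
  obtain ⟨r, hr, hrV⟩ := Metric.isOpen_iff.1 hV x hx
  obtain ⟨m, hm⟩ := exists_nat_one_div_lt (half_pos hr)
  have hcb : ∀ y ∈ ball x (r / 2), closedBall y (1 / ((m : ℝ) + 1)) ⊆ ball x r := by
    intro y hy w hw
    rw [mem_ball] at hy ⊢; rw [mem_closedBall] at hw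
    linarith [dist_triangle w y x]
  obtain ⟨κ, hκ, hκc, hκV, hκ1, -⟩ :=
    exists_cutoff (isCompact_closedBall x (r * (7/8))) hV
      ((closedBall_subset_ball (by linarith)).trans hrV)
  have hc : Continuous (fun y => (κ y : ℂ) * h y) := by
    rw [continuous_iff_continuousAt]
    intro y
    by_cases hy : y ∈ tsupport κ
    · exact (Complex.continuous_ofReal.comp hκ.continuous).continuousAt.mul
        ((hh y (hκV hy)).differentiableAt (hV.mem_nhds (hκV hy))).continuousAt
    · have : (fun y => (κ y : ℂ) * h y) =ᶠ[𝓝 y] fun _ => 0 := by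
        filter_upwards [notMem_tsupport_iff_eventuallyEq.1 hy] with w hw
        simp [hw]
      exact continuousAt_const.congr this.symm
  have hsm := mollify_contDiff m (f := fun y => (κ y : ℂ) * h y) hc.locallyIntegrable
  refine (hsm.contDiffAt.congr_of_eventuallyEq ?_).contDiffWithinAt
  filter_upwards [ball_mem_nhds x (show 0 < r / 4 by linarith)] with y hy
  have hyb : y ∈ ball x (r / 2) := ball_subset_ball (by linarith) hy
  rw [← mollify_eq_of_differentiableOn hV ((hcb y hyb).trans hrV) hh]
  refine mollify_congr fun w hw => ?_
  have : κ w = 1 := by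
    refine (eventually_nhdsSet_iff_forall.1 hκ1 w ?_).self_of_nhds
    rw [mem_closedBall] at hw ⊢; rw [mem_ball] at hy
    linarith [dist_triangle w y x]
  simp [this]

lemma integral_mul_dzb_eq_zero {h : Cn n → ℂ} {V : Set (Cn n)} (hV : IsOpen V)
    (hh : DifferentiableOn ℂ h V) {χ : Cn n → ℂ} (hχ : IsTest V χ) (j : Fin n) :
    ∫ x, h x * dzb j χ x = 0 := by
  rw [integral_mul_dzb hV (contDiffOn_of_differentiableOn hV hh) hχ, neg_eq_zero]
  refine integral_eq_zero_of_ae (Eventually.of_forall fun x => ?_)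
  by_cases hx : x ∈ V
  · simp [dzb_eq_zero_of_differentiableAt ((hh x hx).differentiableAt (hV.mem_nhds hx))]
  · simp [hχ.zero_outside hx]

/-- **Weyl's lemma** for the Cauchy-Riemann system, in the square integrable case. -/
theorem exists_holomorphic_of_weak {f : Cn n → ℂ} {V : Set (Cn n)} (hV : IsOpen V)
    (hf : MemLp f 2 volume) (hc : HasCompactSupport f)
    (hw : ∀ j χ, IsTest V χ → ∫ x, f x * dzb j χ x = 0) :
    ∃ h : Cn n → ℂ, DifferentiableOn ℂ h V ∧ f =ᵐ[volume.restrict V] h := by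
  have hloc : LocallyIntegrable f := hf.locallyIntegrable (by norm_num)
  have hhol : ∀ (m : ℕ) x, closedBall x (1 / ((m : ℝ) + 1)) ⊆ V →
      DifferentiableAt ℂ (mollify m f) x := by
    intro m x hx
    refine differentiableAt_of_dzb_eq_zero
      ((mollify_contDiff m hloc).differentiable (by simp) x) fun j => ?_
    rw [dzb_mollify m hloc, hw j _ (moll_translate_isTest m x hx), neg_zero]
  have hT := tendstoL2_mollify hf hc
  have hlim : ∀ (m' : ℕ) x, closedBall x (2 / ((m' : ℝ) + 1)) ⊆ V →
      Tendsto (fun m => mollify m f x) atTop (𝓝 (mollify m' f x)) := by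
    intro m' x hx
    have hmt : IsTest univ (fun t => moll n m' (x - t)) :=
      moll_translate_isTest m' x (subset_univ _)
    have hG : TendstoL2 (fun _ => fun t => (starRingEnd ℂ) (moll n m' (x - t)))
        (fun t => (starRingEnd ℂ) (moll n m' (x - t))) :=
      ⟨fun _ => hmt.conj.memLp, hmt.conj.memLp, by simp⟩
    have h1 := hT.integral_mul_conj hG
    simp only [Complex.conj_conj] at h1
    refine h1.congr' ?_
    filter_upwards [eventually_gt_atTop m'] with m hm
    have hmm : 1 / ((m : ℝ) + 1) < 1 / ((m' : ℝ) + 1) :=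
      one_div_lt_one_div_of_lt (by positivity) (by exact_mod_cast Nat.succ_lt_succ hm)
    have h2 : 2 / ((m' : ℝ) + 1) = 1 / ((m' : ℝ) + 1) + 1 / ((m' : ℝ) + 1) := by ring
    set R := 2 / ((m' : ℝ) + 1) - 1 / ((m : ℝ) + 1) with hR
    refine mollify_eq_of_differentiableOn (V := ball x R) isOpen_ball
      (closedBall_subset_ball (by linarith)) fun y hy =>
        (hhol m y fun w hwy => hx ?_).differentiableWithinAt
    rw [mem_closedBall] at hwy ⊢; rw [mem_ball] at hy
    linarith [dist_triangle w y x]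
  choose! h hh using fun x (hx : ∃ m' : ℕ, closedBall x (2 / ((m' : ℝ) + 1)) ⊆ V) =>
    (⟨_, hlim _ x hx.choose_spec⟩ : ∃ l, Tendsto (fun m => mollify m f x) atTop (𝓝 l))
  have hex : ∀ x ∈ V, ∃ m' : ℕ, ∀ y ∈ ball x (1 / ((m' : ℝ) + 1)),
      closedBall y (2 / ((m' : ℝ) + 1)) ⊆ V := by
    intro x hx
    obtain ⟨r, hr, hrV⟩ := Metric.isOpen_iff.1 hV x hx
    obtain ⟨m, hm⟩ := exists_nat_one_div_lt (show 0 < r / 3 by linarith)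
    refine ⟨m, fun y hy w hw => hrV ?_⟩
    have h2 : 2 / ((m : ℝ) + 1) = 1 / ((m : ℝ) + 1) + 1 / ((m : ℝ) + 1) := by ring
    rw [mem_ball] at hy ⊢; rw [mem_closedBall] at hw
    linarith [dist_triangle w y x]
  refine ⟨h, fun x hx => ?_, ?_⟩
  · obtain ⟨m', hm'⟩ := hex x hx
    have hpos : 0 < 1 / ((m' : ℝ) + 1) := by positivity
    refine DifferentiableAt.differentiableWithinAt ?_
    have hd := hhol m' x ((closedBall_subset_closedBall
      (by gcongr; norm_num)).trans (hm' x (mem_ball_self hpos)))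
    refine hd.congr_of_eventuallyEq ?_
    filter_upwards [ball_mem_nhds x hpos] with y hy
    exact tendsto_nhds_unique (hh y ⟨m', hm' y hy⟩) (hlim m' y (hm' y hy))
  · obtain ⟨ns, hns, hae⟩ := (tendstoInMeasure_of_tendsto_eLpNorm two_ne_zero
      (fun m => (hT.seq_mem m).1) hf.1 hT.tendsto).exists_seq_tendsto_ae
    rw [EventuallyEq, ae_restrict_iff' hV.measurableSet]
    filter_upwards [hae] with x hx hxV
    obtain ⟨m', hm'⟩ := hex x hxV
    exact tendsto_nhds_unique hx
      ((hh x ⟨m', hm' x (mem_ball_self (by positivity))⟩).comp hns.tendsto_atTop)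

end Weyl

section WeightedSpace

lemma norm_sub_starProjection_orthogonal_sq_le {H : Type*} [NormedAddCommGroup H]
    [InnerProductSpace ℂ H] [CompleteSpace H] (S : Submodule ℂ H) (g : H) (C : ℝ)
    (h : ∀ s ∈ S, 2 * (inner ℂ s g).re ≤ C + ‖s‖ ^ 2) :
    ‖g - Sᗮ.starProjection g‖ ^ 2 ≤ C := by
  set q := g - Sᗮ.starProjection g with hq
  have hmem : q ∈ closure (S : Set H) := by
    rw [← Submodule.topologicalClosure_coe, ← Submodule.orthogonal_orthogonal_eq_closure]
    exact Submodule.sub_starProjection_mem_orthogonal g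
  have hcl : IsClosed {s : H | 2 * (inner ℂ s g).re ≤ C + ‖s‖ ^ 2} := by
    refine isClosed_le ?_ (by fun_prop)
    exact continuous_const.mul
      (Complex.continuous_re.comp (continuous_id.inner continuous_const))
  have h1 : 2 * (inner ℂ q g).re ≤ C + ‖q‖ ^ 2 := closure_minimal h hcl hmem
  have h2 : inner ℂ q (Sᗮ.starProjection g) = 0 :=
    Submodule.starProjection_inner_eq_zero g _ (Submodule.starProjection_apply_mem _ g)
  have h3 : inner ℂ q g = (‖q‖ ^ 2 : ℂ) := by
    have : inner ℂ q g = inner ℂ q q + inner ℂ q (Sᗮ.starProjection g) := by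
      rw [← inner_add_right, hq, sub_add_cancel]
    rw [this, h2, add_zero, inner_self_eq_norm_sq_to_K]; rfl
  rw [h3] at h1
  have h4 : ((‖q‖ : ℂ) ^ 2).re = ‖q‖ ^ 2 := by rw [← Complex.ofReal_pow, Complex.ofReal_re]
  linarith [h4 ▸ h1]

variable {n : ℕ} {V : Set (Cn n)} {φ : Cn n → ℝ}

/-- The measure `e^{-φ} dλ` on `V`. -/
def wm (V : Set (Cn n)) (φ : Cn n → ℝ) : Measure (Cn n) :=
  (volume.restrict V).withDensity fun x => ENNReal.ofReal (Real.exp (-φ x))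

/-- A smooth bounded weight on a bounded open set. -/
structure IsWeight (V : Set (Cn n)) (φ : Cn n → ℝ) : Prop where
  isOpen : IsOpen V
  bounded : Bornology.IsBounded V
  contDiffOn : ContDiffOn ℝ (⊤ : ℕ∞) φ V
  exists_bound : ∃ B, ∀ x ∈ V, |φ x| ≤ B

lemma IsWeight.aemeasurable (h : IsWeight V φ) :
    AEMeasurable (fun x => ENNReal.ofReal (Real.exp (-φ x))) (volume.restrict V) :=
  (Real.continuous_exp.comp_continuousOn h.contDiffOn.continuousOn.neg).aemeasurable
    h.isOpen.measurableSet |>.ennreal_ofReal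

lemma IsWeight.isFiniteMeasure_restrict (h : IsWeight V φ) :
    IsFiniteMeasure (volume.restrict V) :=
  ⟨by rw [Measure.restrict_apply_univ]; exact h.bounded.measure_lt_top⟩

lemma wm_absolutelyContinuous : wm V φ ≪ volume.restrict V :=
  withDensity_absolutelyContinuous _ _

lemma IsWeight.integral_wm (h : IsWeight V φ) (f : Cn n → ℂ) :
    ∫ x, f x ∂(wm V φ) = ∫ x in V, f x * (Real.exp (-φ x) : ℂ) := by
  rw [wm, integral_withDensity_eq_integral_toReal_smul₀ h.aemeasurable (by simp)]
  refine integral_congr_ae (Eventually.of_forall fun x => ?_)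
  simp only [ENNReal.toReal_ofReal (Real.exp_pos _).le, Complex.real_smul]
  ring

lemma IsWeight.wm_le (h : IsWeight V φ) : ∃ c : ℝ≥0∞, c ≠ ∞ ∧ wm V φ ≤ c • volume.restrict V := by
  obtain ⟨B, hB⟩ := h.exists_bound
  refine ⟨ENNReal.ofReal (Real.exp B), by simp, ?_⟩
  rw [← withDensity_const, wm]
  refine withDensity_mono ?_
  filter_upwards [ae_restrict_mem h.isOpen.measurableSet] with x hx
  gcongr
  exact (neg_le_abs _).trans (hB x hx)

lemma IsWeight.le_wm (h : IsWeight V φ) : ∃ c : ℝ≥0∞, c ≠ ∞ ∧ volume.restrict V ≤ c • wm V φ := by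
  obtain ⟨B, hB⟩ := h.exists_bound
  refine ⟨ENNReal.ofReal (Real.exp B), by simp, ?_⟩
  rw [wm, ← withDensity_smul' _ _ (by simp)]
  conv_lhs => rw [← withDensity_one (μ := volume.restrict V)]
  refine withDensity_mono ?_
  filter_upwards [ae_restrict_mem h.isOpen.measurableSet] with x hx
  simp only [Pi.one_apply, Pi.smul_apply, smul_eq_mul]
  rw [← ENNReal.ofReal_mul (Real.exp_pos _).le, ← Real.exp_add, ← ENNReal.ofReal_one]
  refine ENNReal.ofReal_le_ofReal (Real.one_le_exp ?_)
  linarith [(le_abs_self _).trans (hB x hx)]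

lemma IsWeight.memLp_wm_iff (h : IsWeight V φ) {g : Cn n → ℂ} :
    MemLp g 2 (wm V φ) ↔ MemLp g 2 (volume.restrict V) := by
  obtain ⟨c, hc, hc'⟩ := h.wm_le
  obtain ⟨d, hd, hd'⟩ := h.le_wm
  exact ⟨fun hg => hg.of_measure_le_smul hd hd', fun hg => hg.of_measure_le_smul hc hc'⟩

lemma IsWeight.ae_wm_iff (h : IsWeight V φ) {p : Cn n → Prop} :
    (∀ᵐ x ∂(wm V φ), p x) ↔ ∀ᵐ x ∂(volume.restrict V), p x := by
  obtain ⟨d, hd, hd'⟩ := h.le_wm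
  refine ⟨fun hp => ?_, fun hp => wm_absolutelyContinuous.ae_le hp⟩
  exact (Measure.absolutelyContinuous_of_le_smul hd').ae_le hp

lemma IsTest.memLp_wm (h : IsWeight V φ) {f : Cn n → ℂ} (hf : IsTest V f) :
    MemLp f 2 (wm V φ) :=
  h.memLp_wm_iff.2 (hf.memLp.restrict V)

/-- The range of `∂_φ^*` on compactly supported smooth forms, in the weighted `L²` space. -/
def testRange (V : Set (Cn n)) (φ : Cn n → ℝ) : Submodule ℂ (Lp ℂ 2 (wm V φ)) where
  carrier := {s | ∃ b : Fin n → Cn n → ℂ, (∀ j, IsTest V (b j)) ∧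
    s =ᵐ[wm V φ] fun x => ew φ 1 x * ∑ j, dz j (b j) x}
  zero_mem' := ⟨fun _ _ => 0, fun _ => IsTest.zero, by
    filter_upwards [Lp.coeFn_zero ℂ 2 (wm V φ)] with x hx
    rw [hx]
    simp [dz, wirtingerD]⟩
  add_mem' := by
    rintro s t ⟨b, hb, hs⟩ ⟨c, hc, ht⟩
    refine ⟨fun j x => b j x + c j x, fun j => (hb j).add (hc j), ?_⟩
    filter_upwards [Lp.coeFn_add s t, hs, ht] with x h1 h2 h3
    rw [h1, Pi.add_apply, h2, h3, ← mul_add, ← Finset.sum_add_distrib]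
    congr 1
    refine Finset.sum_congr rfl fun j _ => ?_
    exact (wirtingerD_add ((hb j).differentiable x) ((hc j).differentiable x) _).symm
  smul_mem' := by
    rintro a s ⟨b, hb, hs⟩
    refine ⟨fun j x => a * b j x, fun j => (hb j).const_mul a, ?_⟩
    filter_upwards [Lp.coeFn_smul a s, hs] with x h1 h2
    rw [h1, Pi.smul_apply, h2, smul_eq_mul, mul_left_comm, Finset.mul_sum]
    congr 1
    refine Finset.sum_congr rfl fun j _ => ?_
    rw [dz, dz, wirtingerD, wirtingerD, fderiv_const_mul ((hb j).differentiable x)]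
    simp only [smul_apply, smul_eq_mul]
    ring

/-- The weighted Bergman space, as the orthogonal complement of the range of `∂_φ^*`. -/
abbrev bergmanSub (V : Set (Cn n)) (φ : Cn n → ℝ) : Submodule ℂ (Lp ℂ 2 (wm V φ)) :=
  (testRange V φ)ᗮ

lemma IsWeight.isTest_testRange (h : IsWeight V φ) {b : Fin n → Cn n → ℂ}
    (hb : ∀ j, IsTest V (b j)) : IsTest V (fun x => ew φ 1 x * ∑ j, dz j (b j) x) :=
  (IsTest.sum Finset.univ fun j _ => (hb j).dz j).mul_left h.isOpen
    (contDiffOn_ew h.contDiffOn 1)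

lemma IsWeight.inner_testRange (h : IsWeight V φ) {b : Fin n → Cn n → ℂ}
    (hb : ∀ j, IsTest V (b j)) {g : Cn n → ℂ} (hg : MemLp g 2 (wm V φ)) :
    inner ℂ (((h.isTest_testRange hb).memLp_wm h).toLp _) (hg.toLp g) =
      ∫ x in V, g x * ∑ j, dzb j (fun y => (starRingEnd ℂ) (b j y)) x := by
  rw [inner_toLp, h.integral_wm]
  refine integral_congr_ae (Eventually.of_forall fun x => ?_)
  simp only [map_mul, map_sum, ew_conj]
  simp_rw [fun j => dzb_conj (hb j).differentiable j]
  have : ew φ 1 x * (Real.exp (-φ x) : ℂ) = 1 := by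
    rw [ew, ← Complex.ofReal_mul, ← Real.exp_add]; simp
  linear_combination (g x * ∑ j, (starRingEnd ℂ) (dz j (b j) x)) * this

lemma IsWeight.mem_bergmanSub_iff (h : IsWeight V φ) (g : Lp ℂ 2 (wm V φ)) :
    g ∈ bergmanSub V φ ↔ ∃ u : Cn n → ℂ, DifferentiableOn ℂ u V ∧ g =ᵐ[wm V φ] u := by
  constructor
  · intro hg
    have hgm : MemLp g 2 (wm V φ) := Lp.memLp g
    have hgm' : MemLp g 2 (volume.restrict V) := h.memLp_wm_iff.1 hgm
    have hf : MemLp (V.indicator g) 2 volume := (memLp_indicator_iff_restrict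
      h.isOpen.measurableSet).2 hgm'
    have hcs : HasCompactSupport (V.indicator g) := by
      refine HasCompactSupport.of_support_subset_isCompact (K := closure V)
        h.bounded.isCompact_closure ?_
      exact (Set.support_indicator_subset).trans subset_closure
    obtain ⟨u, hu, hae⟩ := exists_holomorphic_of_weak h.isOpen hf hcs fun j χ hχ => by
      classical
      set b : Fin n → Cn n → ℂ := fun k => if k = j then fun x => (starRingEnd ℂ) (χ x)
        else fun _ => 0 with hbdef
      have hb : ∀ k, IsTest V (b k) := by
        intro k
        by_cases hk : k = j
        · simp only [hbdef, hk, if_true]; exact hχ.conj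
        · simp only [hbdef, hk, if_false]; exact IsTest.zero
      have h1 := h.inner_testRange hb hgm
      have hz : inner ℂ (((h.isTest_testRange hb).memLp_wm h).toLp _) (hgm.toLp g) = 0 := by
        rw [Lp.toLp_coeFn]
        exact (Submodule.mem_orthogonal _ _).1 hg _ ⟨b, hb, MemLp.coeFn_toLp _⟩
      rw [hz] at h1
      rw [← integral_indicator h.isOpen.measurableSet] at h1
      rw [h1]
      refine integral_congr_ae (Eventually.of_forall fun x => ?_)
      simp only [indicator]
      split_ifs with hx
      · congr 1
        rw [Finset.sum_eq_single j]
        · simp [hbdef]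
        · intro k _ hk
          simp [hbdef, hk, dzb, wirtingerDbar]
        · simp
      · simp
    refine ⟨u, hu, ?_⟩
    rw [EventuallyEq, h.ae_wm_iff]
    filter_upwards [hae, ae_restrict_mem h.isOpen.measurableSet] with x hx hxV
    rw [← hx, indicator_of_mem hxV]
  · rintro ⟨u, hu, hgu⟩
    have hum : MemLp u 2 (wm V φ) := (memLp_congr_ae hgu).1 (Lp.memLp g)
    have hgu' : g = hum.toLp u := by
      rw [← Lp.toLp_coeFn g (Lp.memLp g)]
      exact MemLp.toLp_congr _ _ hgu
    rw [bergmanSub, Submodule.mem_orthogonal]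
    rintro s ⟨b, hb, hs⟩
    have hs' : s = ((h.isTest_testRange hb).memLp_wm h).toLp _ := by
      rw [← Lp.toLp_coeFn s (Lp.memLp s)]
      exact MemLp.toLp_congr _ _ hs
    rw [hgu', hs', h.inner_testRange hb hum]
    have hi : ∀ j, Integrable (fun x => u x * dzb j (fun y => (starRingEnd ℂ) (b j y)) x) :=
      fun j => (((hb j).conj.dzb j).mul_left h.isOpen
        (contDiffOn_of_differentiableOn h.isOpen hu)).integrable
    rw [setIntegral_eq_integral_of_forall_compl_eq_zero]
    · simp_rw [Finset.mul_sum]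
      rw [integral_finsetSum _ fun j _ => hi j]
      exact Finset.sum_eq_zero fun j _ => integral_mul_dzb_eq_zero h.isOpen hu (hb j).conj j
    · intro x hx
      rw [Finset.sum_eq_zero, mul_zero]
      intro j _
      exact ((hb j).conj.dzb j).zero_outside hx

end WeightedSpace

section HormanderProjection

variable {n : ℕ} {V : Set (Cn n)} {φ ρ : Cn n → ℝ} {g : Cn n → ℂ}

lemma isWeaklyClosed_dzb (hV : IsOpen V) (hg : ContDiffOn ℝ (⊤ : ℕ∞) g V) :
    IsWeaklyClosed V (fun j => dzb j g) := by
  intro j k χ hχ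
  have hi : ∀ k j, Integrable (fun x => dzb k g x * dzb j χ x) := fun k j =>
    ((hχ.dzb j).mul_left hV (contDiffOn_wirtingerDbar hV hg _)).integrable
  have h1 : ∀ k j, ∫ x, dzb k g x * dzb j χ x = -∫ x, g x * dzb k (dzb j χ) x := fun k j => by
    rw [integral_mul_dzb hV hg (hχ.dzb j) k, neg_neg]
  rw [integral_sub (hi k j) (hi j k), h1 k j, h1 j k, sub_eq_zero]
  congr 1
  refine integral_congr_ae (Eventually.of_forall fun x => ?_)
  simp only [dzb_dzb_comm hχ.smooth j k x]

/-- Hörmander's estimate, for the component of `g` orthogonal to the holomorphic functions. -/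
theorem IsWeight.norm_sub_starProjection_sq_le (h : IsWeight V φ) (hex : IsExhaustion ρ V)
    {M c : ℝ} (hM : ∀ x ∈ V, ∑ j, ‖dz j (fun y => (ρ y : ℂ)) x‖ ^ 2 ≤ M) (hc : 0 < c)
    (hlev : ∀ x ∈ V, ∀ a : Fin n → ℂ, c * ∑ k, ‖a k‖ ^ 2 ≤
      (∑ j, ∑ k, leviCoeff ρ j k x * a j * (starRingEnd ℂ) (a k)).re)
    (hg : ContDiffOn ℝ (⊤ : ℕ∞) g V) (hgm : MemLp g 2 (wm V φ))
    (hfm : ∀ j, MemLp (dzb j g) 2 (volume.restrict V))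
    {F : Cn n → ℝ} (hF0 : ∀ x ∈ V, 0 ≤ F x)
    (hFi : IntegrableOn (fun x => F x * Real.exp (-φ x)) V)
    (hpt : ∀ x ∈ V, ∀ a : Fin n → ℂ, 2 * (∑ k, dzb k g x * (starRingEnd ℂ) (a k)).re ≤
      F x + (∑ j, ∑ k, leviCoeff φ j k x * a j * (starRingEnd ℂ) (a k)).re) :
    ‖hgm.toLp g - (bergmanSub V φ).starProjection (hgm.toLp g)‖ ^ 2 ≤
      ∫ x in V, F x * Real.exp (-φ x) := by
  refine norm_sub_starProjection_orthogonal_sq_le (testRange V φ) _ _ ?_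
  rintro s ⟨b, hb, hs⟩
  have hs' : s = ((h.isTest_testRange hb).memLp_wm h).toLp _ := by
    rw [← Lp.toLp_coeFn s (Lp.memLp s)]
    exact MemLp.toLp_congr _ _ hs
  have hb' : ∀ j, IsTest V (fun x => -b j x) := fun j => by
    simpa using (hb j).const_mul (-1)
  have hdz : ∀ j x, dz j (fun x => -b j x) x = -dz j (b j) x := fun j x => by
    simp only [dz, wirtingerD, fderiv_fun_neg, neg_apply]
    ring
  have hfL : ∀ j, MemLp (V.indicator fun x => ew φ (-1 / 2) x * dzb j g x) 2 volume := by
    intro j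
    rw [memLp_indicator_iff_restrict h.isOpen.measurableSet]
    obtain ⟨B, hB⟩ := h.exists_bound
    have hm : AEStronglyMeasurable (fun x => ew φ (-1 / 2) x * dzb j g x) (volume.restrict V) :=
      (((contDiffOn_ew h.contDiffOn _).mul
        (contDiffOn_wirtingerDbar h.isOpen hg _)).continuousOn).aestronglyMeasurable
        h.isOpen.measurableSet
    refine (hfm j).of_le_mul (c := Real.exp (B / 2)) hm ?_
    filter_upwards [ae_restrict_mem h.isOpen.measurableSet] with x hx
    rw [norm_mul]
    refine mul_le_mul_of_nonneg_right ?_ (norm_nonneg _)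
    rw [norm_ew]
    refine Real.exp_le_exp.2 ?_
    have := (neg_le_abs _).trans (hB x hx)
    linarith
  have key := hex.two_re_integral_le h.contDiffOn hM hc hlev hb'
    (isWeaklyClosed_dzb h.isOpen hg) hfL hF0 hFi hpt
  have hE : (inner ℂ s (hgm.toLp g)).re =
      (∫ x, ∑ j, dzb j g x * (starRingEnd ℂ) (-b j x)).re := by
    rw [hs', h.inner_testRange hb hgm]
    congr 1
    have hi : ∀ j, Integrable (fun x => g x * dzb j (fun y => (starRingEnd ℂ) (b j y)) x) :=
      fun j => (((hb j).conj.dzb j).mul_left h.isOpen hg).integrable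
    have hi2 : ∀ j, Integrable (fun x => dzb j g x * (starRingEnd ℂ) (-b j x)) :=
      fun j => ((hb' j).conj.mul_left h.isOpen (contDiffOn_wirtingerDbar h.isOpen hg _)).integrable
    rw [setIntegral_eq_integral_of_forall_compl_eq_zero]
    · simp_rw [Finset.mul_sum]
      rw [integral_finsetSum _ fun j _ => hi j, integral_finsetSum _ fun j _ => hi2 j]
      refine Finset.sum_congr rfl fun j _ => ?_
      rw [integral_mul_dzb h.isOpen hg (hb j).conj j, ← integral_neg]
      simp
    · intro x hx
      rw [Finset.sum_eq_zero, mul_zero]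
      intro j _
      exact ((hb j).conj.dzb j).zero_outside hx
  have hN : ‖s‖ ^ 2 = ∫ x, ‖∑ j, dz j (fun x => -b j x) x‖ ^ 2 * Real.exp (φ x) := by
    have h1 : ((‖s‖ ^ 2 : ℝ) : ℂ) = inner ℂ s s := by
      rw [inner_self_eq_norm_sq_to_K]; norm_cast
    have h2 : inner ℂ s s =
        ((∫ x in V, ‖∑ j, dz j (fun x => -b j x) x‖ ^ 2 * Real.exp (φ x) : ℝ) : ℂ) := by
      rw [hs', inner_toLp, h.integral_wm, ← integral_complex_ofReal]
      refine integral_congr_ae (Eventually.of_forall fun x => ?_)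
      simp only [hdz, Finset.sum_neg_distrib, norm_neg, map_mul, ew_conj]
      push_cast
      rw [← Complex.conj_mul']
      have e : ew φ 1 x = Complex.exp (φ x) := by simp [ew]
      rw [e]
      have : Complex.exp (φ x) * Complex.exp (-φ x) = 1 := by rw [← Complex.exp_add]; simp
      linear_combination ((starRingEnd ℂ) (∑ j, dz j (b j) x) * (∑ j, dz j (b j) x) *
        Complex.exp (φ x)) * this
    have h3 := Complex.ofReal_injective (h1.trans h2)
    rw [h3]
    refine setIntegral_eq_integral_of_forall_compl_eq_zero fun x hx => ?_
    rw [Finset.sum_eq_zero]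
    · simp
    · intro j _
      exact ((hb' j).dz j).zero_outside hx
  rw [hE, hN]
  exact key

end HormanderProjection

section SmoothFamily

open scoped BoundedContinuousFunction

variable {E : Type*} [NormedAddCommGroup E] [NormedSpace ℂ E] {F : ℂ × E → ℂ}

/-- A compactly supported smooth family of functions on `E`, parametrised by `ℂ`. -/
structure IsFamily (F : ℂ × E → ℂ) : Prop where
  smooth : ContDiff ℝ (⊤ : ℕ∞) F
  compact : HasCompactSupport F

lemma IsFamily.fderiv_apply (hF : IsFamily F) (v : ℂ × E) :
    IsFamily (fun p => fderiv ℝ F p v) where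
  smooth := (hF.smooth.fderiv_right (m := (⊤ : ℕ∞)) le_rfl).clm_apply contDiff_const
  compact := hF.compact.fderiv_apply ℝ v

lemma IsFamily.wirtingerD (hF : IsFamily F) (v : ℂ × E) :
    IsFamily (fun p => wirtingerD F p v) where
  smooth := contDiff_wirtingerD hF.smooth v
  compact := by
    refine (((hF.fderiv_apply v).compact).sub
      (((hF.fderiv_apply (I • v)).compact).mul_left (f := fun _ => I))).mul_left
        (f := fun _ => 1 / 2)

lemma IsFamily.wirtingerDbar (hF : IsFamily F) (v : ℂ × E) :
    IsFamily (fun p => wirtingerDbar F p v) where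
  smooth := contDiff_wirtingerDbar hF.smooth v
  compact := by
    refine (((hF.fderiv_apply v).compact).add
      (((hF.fderiv_apply (I • v)).compact).mul_left (f := fun _ => I))).mul_left
        (f := fun _ => 1 / 2)

/-- The member of a family at the parameter `s`. -/
def IsFamily.slice (hF : IsFamily F) (s : ℂ) : E →ᵇ ℂ :=
  BoundedContinuousFunction.ofNormedAddCommGroup (fun ζ => F (s, ζ))
    (hF.smooth.continuous.comp (by fun_prop))
    (hF.compact.exists_bound_of_continuous hF.smooth.continuous).choose
    fun ζ => (hF.compact.exists_bound_of_continuous hF.smooth.continuous).choose_spec (s, ζ)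

@[simp] lemma IsFamily.slice_apply (hF : IsFamily F) (s : ℂ) (ζ : E) :
    hF.slice s ζ = F (s, ζ) := rfl

/-- The derivative of a family with respect to the parameter. -/
def IsFamily.sliceDeriv (hF : IsFamily F) (s : ℂ) : ℂ →L[ℝ] (E →ᵇ ℂ) :=
  reCLM.smulRight ((hF.fderiv_apply (1, 0)).slice s) +
    imCLM.smulRight ((hF.fderiv_apply (I, 0)).slice s)

lemma IsFamily.sliceDeriv_apply (hF : IsFamily F) (s c : ℂ) (ζ : E) :
    hF.sliceDeriv s c ζ = fderiv ℝ F (s, ζ) (c, 0) := by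
  have : ((c, 0) : ℂ × E) = c.re • ((1 : ℂ), (0 : E)) + c.im • ((I : ℂ), (0 : E)) := by
    ext <;> simp
  rw [this, map_add, map_smul, map_smul]
  rfl

lemma IsFamily.hasFDerivAt_slice (hF : IsFamily F) (s : ℂ) :
    HasFDerivAt hF.slice (hF.sliceDeriv s) s := by
  obtain ⟨C, hC⟩ :=
    (hF.smooth.fderiv_right (m := (⊤ : ℕ∞)) le_rfl).lipschitzWith_of_hasCompactSupport
    (hF.compact.fderiv (𝕜 := ℝ)) (by simp)
  have key : ∀ c : ℂ, ‖hF.slice (s + c) - hF.slice s - hF.sliceDeriv s c‖ ≤ C * ‖c‖ * ‖c‖ := by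
    intro c
    refine (BoundedContinuousFunction.norm_le (by positivity)).2 fun ζ => ?_
    simp only [BoundedContinuousFunction.coe_sub, Pi.sub_apply, hF.slice_apply,
      hF.sliceDeriv_apply]
    have hmv := (convex_closedBall ((s, ζ) : ℂ × E) ‖c‖).norm_image_sub_le_of_norm_fderiv_le'
      (𝕜 := ℝ) (f := F) (C := C * ‖c‖) (φ := fderiv ℝ F (s, ζ))
      (fun p _ => hF.smooth.differentiable (by simp) p)
      (fun p hp => ?_) (mem_closedBall_self (norm_nonneg c))
      (y := (s + c, ζ)) (by simp [mem_closedBall, dist_eq_norm])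
    · have e : ((s + c, ζ) : ℂ × E) - (s, ζ) = (c, 0) := by simp
      rw [e] at hmv
      simpa [Prod.norm_def] using hmv
    · rw [← dist_eq_norm]
      refine (hC.dist_le_mul _ _).trans ?_
      exact mul_le_mul_of_nonneg_left (mem_closedBall.1 hp) C.2
  rw [hasFDerivAt_iff_isLittleO_nhds_zero]
  refine Asymptotics.IsLittleO.of_bound fun ε hε => ?_
  have hpos : 0 < ε / (C + 1) := by positivity
  filter_upwards [ball_mem_nhds (0 : ℂ) hpos] with c hc
  refine (key c).trans (mul_le_mul_of_nonneg_right ?_ (norm_nonneg c))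
  rw [mem_ball_zero_iff, lt_div_iff₀ (by positivity)] at hc
  nlinarith [norm_nonneg c]

lemma IsFamily.contDiff_slice (hF : IsFamily F) : ContDiff ℝ (⊤ : ℕ∞) hF.slice := by
  rw [contDiff_infty]
  intro m
  induction m generalizing F with
  | zero =>
    refine contDiff_zero.2 (continuous_iff_continuousAt.2 fun s => ?_)
    exact (hF.hasFDerivAt_slice s).continuousAt
  | succ m ih =>
    rw [Nat.cast_succ, contDiff_succ_iff_fderiv]
    refine ⟨fun s => (hF.hasFDerivAt_slice s).differentiableAt, by simp, ?_⟩
    have : fderiv ℝ hF.slice = fun s => reCLM.smulRight ((hF.fderiv_apply (1, 0)).slice s) +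
        imCLM.smulRight ((hF.fderiv_apply (I, 0)).slice s) :=
      funext fun s => (hF.hasFDerivAt_slice s).fderiv
    rw [this]
    exact (contDiff_const.smulRight (ih _)).add (contDiff_const.smulRight (ih _))

variable (Λ : (E →ᵇ ℂ) →L[ℂ] ℂ)

lemma IsFamily.fderiv_comp_slice (hF : IsFamily F) (s c : ℂ) :
    fderiv ℝ (fun s => Λ (hF.slice s)) s c = Λ (hF.sliceDeriv s c) := by
  have := (Λ.restrictScalars ℝ).hasFDerivAt.comp s (hF.hasFDerivAt_slice s)
  exact congrArg (fun L => L c) this.fderiv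

lemma IsFamily.contDiff_comp_slice (hF : IsFamily F) :
    ContDiff ℝ (⊤ : ℕ∞) (fun s => Λ (hF.slice s)) :=
  (Λ.restrictScalars ℝ).contDiff.comp hF.contDiff_slice

lemma IsFamily.wirtingerD_comp_slice (hF : IsFamily F) (s : ℂ) :
    Berndtsson.wirtingerD (fun s => Λ (hF.slice s)) s 1 =
      Λ ((hF.wirtingerD (1, 0)).slice s) := by
  rw [Berndtsson.wirtingerD, hF.fderiv_comp_slice, hF.fderiv_comp_slice, ← smul_eq_mul,
    ← smul_eq_mul I, ← map_smul, ← map_sub, ← map_smul]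
  congr 1
  ext ζ
  simp [hF.sliceDeriv_apply, Berndtsson.wirtingerD]

lemma IsFamily.wirtingerDbar_comp_slice (hF : IsFamily F) (s : ℂ) :
    Berndtsson.wirtingerDbar (fun s => Λ (hF.slice s)) s 1 =
      Λ ((hF.wirtingerDbar (1, 0)).slice s) := by
  rw [Berndtsson.wirtingerDbar, hF.fderiv_comp_slice, hF.fderiv_comp_slice, ← smul_eq_mul,
    ← smul_eq_mul I, ← map_smul, ← map_add, ← map_smul]
  congr 1
  ext ζ
  simp [hF.sliceDeriv_apply, Berndtsson.wirtingerDbar]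
  ring

end SmoothFamily

section SecondDerivative

lemma iteratedFDeriv_two_nonneg_of_isLocalMin {E : Type*} [NormedAddCommGroup E] [NormedSpace ℝ E]
    {f : E → ℝ} {x : E} (hf : ContDiffAt ℝ 2 f x) (hmin : IsLocalMin f x) (v : E) :
    0 ≤ iteratedFDeriv ℝ 2 f x ![v, v] := by
  set g : ℝ → ℝ := fun r => f (x + r • v) with hg
  have hline : ∀ r : ℝ, HasDerivAt (fun r : ℝ => x + r • v) v r := fun r => by
    simpa using ((hasDerivAt_id r).smul_const v).const_add x
  have hcont : Tendsto (fun r : ℝ => x + r • v) (𝓝 0) (𝓝 x) := by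
    have := (hline 0).continuousAt.tendsto
    simpa using this
  have hd1 : ∀ᶠ y in 𝓝 x, DifferentiableAt ℝ f y :=
    (hf.eventually (by simp)).mono fun y hy => hy.differentiableAt (by norm_num)
  have hg1 : deriv g =ᶠ[𝓝 0] fun r => fderiv ℝ f (x + r • v) v := by
    filter_upwards [hcont.eventually hd1] with r hr
    exact (hr.hasFDerivAt.comp_hasDerivAt r (hline r)).deriv
  have hd2 : DifferentiableAt ℝ (fderiv ℝ f) x :=
    (hf.fderiv_right (m := 1) (by norm_num)).differentiableAt (by norm_num)
  have hg2 : deriv (deriv g) 0 = fderiv ℝ (fderiv ℝ f) x v v := by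
    rw [hg1.deriv_eq]
    have hx : x + (0 : ℝ) • v = x := by simp
    have h1 : HasDerivAt (fun r : ℝ => fderiv ℝ f (x + r • v)) (fderiv ℝ (fderiv ℝ f) x v) 0 :=
      HasFDerivAt.comp_hasDerivAt (0 : ℝ) (by rw [hx]; exact hd2.hasFDerivAt) (hline 0)
    simpa using (h1.clm_apply (hasDerivAt_const (0 : ℝ) v)).deriv
  have hgmin : IsLocalMin g 0 := by
    have : ∀ᶠ r in 𝓝 (0 : ℝ), f x ≤ f (x + r • v) := hcont.eventually hmin
    filter_upwards [this] with r hr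
    simpa [hg] using hr
  have hgc : ContinuousAt g 0 := by
    have : ContinuousAt f (x + (0 : ℝ) • v) := by simpa using hf.continuousAt
    exact ContinuousAt.comp (f := fun r : ℝ => x + r • v) this (hline 0).continuousAt
  rw [iteratedFDeriv_two_apply]
  simp only [Matrix.cons_val_zero, Matrix.cons_val_one]
  rw [← hg2]
  by_contra! hneg
  have hmax := isLocalMax_of_deriv_deriv_neg hneg hgmin.deriv_eq_zero hgc
  have hconst : g =ᶠ[𝓝 0] fun _ => g 0 := by
    filter_upwards [hgmin, hmax] with r h1 h2
    exact le_antisymm h2 h1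
  have hz : deriv (deriv g) 0 = 0 := by
    have h1 : deriv g =ᶠ[𝓝 0] fun _ => 0 := by
      have := hconst.deriv
      simpa using this
    rw [h1.deriv_eq]; simp
  exact hneg.ne hz

lemma iteratedFDeriv_two_re {Q : ℂ → ℂ} {t : ℂ} (hQ : ContDiffAt ℝ 2 Q t) :
    (1 / 4) * (iteratedFDeriv ℝ 2 (fun s => (Q s).re) t ![1, 1] +
      iteratedFDeriv ℝ 2 (fun s => (Q s).re) t ![I, I]) = (leviForm Q t 1 1).re := by
  have h : ∀ v : ℂ, iteratedFDeriv ℝ 2 (fun s => (Q s).re) t ![v, v] =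
      (fderiv ℝ (fderiv ℝ Q) t v v).re := by
    intro v
    have := reCLM.iteratedFDeriv_comp_left hQ (i := 2) le_rfl
    have h2 := congrArg (fun L => L ![v, v]) this
    simp only [ContinuousLinearMap.compContinuousMultilinearMap_coe, Function.comp_apply,
      iteratedFDeriv_two_apply (f := Q)] at h2
    exact h2
  have hs : fderiv ℝ (fderiv ℝ Q) t 1 I = fderiv ℝ (fderiv ℝ Q) t I 1 :=
    (hQ.isSymmSndFDerivAt (by simp)) 1 I
  rw [h, h, leviForm]
  simp only [smul_eq_mul, mul_one, hs]
  have : (1 / 4 : ℂ) = ((1 / 4 : ℝ) : ℂ) := by norm_num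
  rw [this, Complex.re_ofReal_mul]
  simp

end SecondDerivative

section OperatorFamily

open scoped BoundedContinuousFunction

variable {E : Type*} [NormedAddCommGroup E] [NormedSpace ℂ E] [MeasurableSpace E] [BorelSpace E]
  [SecondCountableTopology E] (μ : Measure E) [IsFiniteMeasure μ]

/-- Multiplication by bounded continuous functions on `L²`. -/
def mulOp : (E →ᵇ ℂ) →L[ℂ] (Lp ℂ 2 μ →L[ℂ] Lp ℂ 2 μ) :=
  ((ContinuousLinearMap.mul ℂ ℂ).holderL μ ∞ 2 2).comp
    (BoundedContinuousFunction.toLp ∞ μ ℂ)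

variable {μ}

lemma coeFn_mulOp (f : E →ᵇ ℂ) (g : Lp ℂ 2 μ) : mulOp μ f g =ᵐ[μ] fun x => f x * g x := by
  have h1 := ContinuousLinearMap.coeFn_holder (r := 2) (ContinuousLinearMap.mul ℂ ℂ)
    (BoundedContinuousFunction.toLp ∞ μ ℂ f) g
  have h2 := BoundedContinuousFunction.coeFn_toLp ∞ μ ℂ f
  filter_upwards [h1, h2] with x hx hx2
  change (ContinuousLinearMap.holder 2 (ContinuousLinearMap.mul ℂ ℂ)
    (BoundedContinuousFunction.toLp ∞ μ ℂ f) g) x = _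
  rw [hx, hx2]; rfl

lemma inner_mulOp (f : E →ᵇ ℂ) (x y : Lp ℂ 2 μ) :
    inner ℂ x (mulOp μ f y) = ∫ ζ, f ζ * ((starRingEnd ℂ) (x ζ) * y ζ) ∂μ := by
  rw [L2.inner_def]
  refine integral_congr_ae ?_
  filter_upwards [coeFn_mulOp f y] with ζ hζ
  rw [hζ, RCLike.inner_apply]
  ring

lemma inner_mulOp_comm {f g : E →ᵇ ℂ} (h : ∀ ζ, g ζ = (starRingEnd ℂ) (f ζ)) (x y : Lp ℂ 2 μ) :
    inner ℂ x (mulOp μ g y) = (starRingEnd ℂ) (inner ℂ y (mulOp μ f x)) := by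
  rw [inner_mulOp, inner_mulOp, ← integral_conj]
  refine integral_congr_ae (Eventually.of_forall fun ζ => ?_)
  simp only [h, map_mul, Complex.conj_conj]
  ring

lemma re_inner_mulOp_nonneg {f : E →ᵇ ℂ} {g : E → ℝ} (h : ∀ ζ, f ζ = g ζ) (hg : ∀ ζ, 0 ≤ g ζ)
    (x : Lp ℂ 2 μ) : 0 ≤ (inner ℂ x (mulOp μ f x)).re := by
  have : inner ℂ x (mulOp μ f x) = ((∫ ζ, g ζ * ‖x ζ‖ ^ 2 ∂μ : ℝ) : ℂ) := by
    rw [inner_mulOp, ← integral_complex_ofReal]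
    refine integral_congr_ae (Eventually.of_forall fun ζ => ?_)
    simp only [h, Complex.conj_mul']
    push_cast
    ring
  rw [this, Complex.ofReal_re]
  exact integral_nonneg fun ζ => mul_nonneg (hg ζ) (sq_nonneg _)

lemma mulOp_eq_one {f : E →ᵇ ℂ} (h : ∀ᵐ ζ ∂μ, f ζ = 1) : mulOp μ f = 1 := by
  ext1 g
  refine Lp.ext ?_
  filter_upwards [coeFn_mulOp f g, h] with ζ h1 h2
  rw [h1, h2, one_mul]; rfl

end OperatorFamily

/-- Solutions of a smooth family of compressed linear equations depend smoothly on the parameter. -/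
theorem contDiffAt_of_compression {E H : Type*} [NormedAddCommGroup E] [NormedSpace ℝ E]
    [NormedAddCommGroup H] [InnerProductSpace ℂ H] [CompleteSpace H] (S : Submodule ℂ H)
    [S.HasOrthogonalProjection] {T : E → H →L[ℂ] H} (hT : ContDiff ℝ (⊤ : ℕ∞) T) {t : E}
    (h1 : T t = 1) (hsym : ∀ s x y, inner ℂ x (T s y) = (starRingEnd ℂ) (inner ℂ y (T s x)))
    {k : E → H} (hkt : k t ∈ S)
    (hk : ∀ᶠ s in 𝓝 t, k s ∈ S ∧ ∀ h ∈ S, inner ℂ (k s) (T s h) = inner ℂ (k t) h) :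
    ContDiffAt ℝ (⊤ : ℕ∞) k t := by
  set P : H →L[ℂ] H := S.starProjection with hP
  set A : E → H →L[ℂ] H := fun s => P * T s * P + (1 - P) with hA
  have hPP : P * P = P := by
    ext x
    exact Submodule.starProjection_eq_self_iff.2 (Submodule.starProjection_apply_mem S x)
  have hA1 : A t = 1 := by simp [hA, h1, hPP]
  have hAc : ContDiff ℝ (⊤ : ℕ∞) A :=
    ((contDiff_const.mul hT).mul contDiff_const).add contDiff_const
  have hAk : ∀ᶠ s in 𝓝 t, A s (k s) = k t := by
    filter_upwards [hk] with s hs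
    have e1 : P (k s) = k s := Submodule.starProjection_eq_self_iff.2 hs.1
    have e2 : P (T s (k s)) = k t := by
      refine Submodule.eq_starProjection_of_mem_of_inner_eq_zero hkt fun w hw => ?_
      have := hsym s w (k s)
      rw [hs.2 w hw] at this
      have h3 : inner ℂ (T s (k s)) w = inner ℂ (k t) w := by
        rw [← inner_conj_symm, this, Complex.conj_conj]
      rw [inner_sub_left, h3, sub_self]
    simp [hA, e1, e2]
  have hunit : ∀ᶠ s in 𝓝 t, IsUnit (A s) :=
    hAc.continuous.continuousAt.eventually (Units.isOpen.mem_nhds (by simp [hA1]))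
  have hinv : ContDiffAt ℝ (⊤ : ℕ∞) (fun s => Ring.inverse (A s)) t := by
    have h0 : ContDiffAt ℝ (⊤ : ℕ∞) Ring.inverse (A t) := by
      have := contDiffAt_ringInverse ℝ (n := (⊤ : ℕ∞)) (1 : (H →L[ℂ] H)ˣ)
      rwa [Units.val_one, ← hA1] at this
    exact h0.comp t hAc.contDiffAt
  have hfin : ContDiffAt ℝ (⊤ : ℕ∞) (fun s => Ring.inverse (A s) (k t)) t := by
    have := ((ContinuousLinearMap.apply ℂ H (k t)).restrictScalars ℝ).contDiff.contDiffAt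
      (x := Ring.inverse (A t)) (n := (⊤ : ℕ∞))
    exact this.comp t hinv
  refine hfin.congr_of_eventuallyEq ?_
  filter_upwards [hAk, hunit] with s hs hu
  rw [← hs]
  change k s = (Ring.inverse (A s) * A s) (k s)
  rw [Ring.inverse_mul_cancel _ hu]; rfl

/-- The variational lower bound for the solution of a compressed equation. -/
lemma two_re_inner_sub_le {H : Type*} [NormedAddCommGroup H] [InnerProductSpace ℂ H]
    {T : H →L[ℂ] H} (hsym : ∀ x y, inner ℂ x (T y) = (starRingEnd ℂ) (inner ℂ y (T x)))
    (hpos : ∀ x, 0 ≤ (inner ℂ x (T x)).re) {k k₀ h : H}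
    (hk : inner ℂ k (T k) = inner ℂ k₀ k) (hh : inner ℂ k (T h) = inner ℂ k₀ h) :
    2 * (inner ℂ k₀ h).re - (inner ℂ h (T h)).re ≤ (inner ℂ k₀ k).re := by
  have h0 := hpos (h - k)
  rw [map_sub, inner_sub_left, inner_sub_right, inner_sub_right, hsym h k, hk, hh] at h0
  simp only [Complex.sub_re, Complex.conj_re] at h0
  linarith

section LowerBound

open scoped BoundedContinuousFunction

lemma wirtingerD_sub_const_self (t s : ℂ) : wirtingerD (fun s => s - t) s 1 = 1 := by
  have h : fderiv ℝ (fun s : ℂ => s - t) s = ContinuousLinearMap.id ℝ ℂ :=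
    ((hasFDerivAt_id s).sub_const t).fderiv
  simp [wirtingerD, h]; norm_num

lemma wirtingerDbar_sub_const_self (t s : ℂ) : wirtingerDbar (fun s => s - t) s 1 = 0 := by
  have h : fderiv ℝ (fun s : ℂ => s - t) s = ContinuousLinearMap.id ℝ ℂ :=
    ((hasFDerivAt_id s).sub_const t).fderiv
  simp [wirtingerDbar, h]

lemma wirtingerD_conj_sub_const_self (t s : ℂ) :
    wirtingerD (fun s => (starRingEnd ℂ) (s - t)) s 1 = 0 := by
  rw [wirtingerD_conj (by fun_prop), wirtingerDbar_sub_const_self, map_zero]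

lemma wirtingerDbar_conj_sub_const_self (t s : ℂ) :
    wirtingerDbar (fun s => (starRingEnd ℂ) (s - t)) s 1 = 1 := by
  rw [wirtingerDbar_conj (by fun_prop), wirtingerD_sub_const_self, map_one]

/-- The Levi form of a sesquilinear expression in an affine holomorphic section. -/
lemma leviForm_sesquilinear {m₀ m₁ m₂ m₃ : ℂ → ℂ} (t A B : ℂ)
    (h₀ : ContDiff ℝ (⊤ : ℕ∞) m₀) (h₁ : ContDiff ℝ (⊤ : ℕ∞) m₁)
    (h₂ : ContDiff ℝ (⊤ : ℕ∞) m₂) (h₃ : ContDiff ℝ (⊤ : ℕ∞) m₃) :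
    leviForm (fun s => A + (s - t) * B - (m₀ s + (s - t) * m₁ s +
        (starRingEnd ℂ) (s - t) * (m₂ s + (s - t) * m₃ s))) t 1 1 =
      -(leviForm m₀ t 1 1 + wirtingerDbar m₁ t 1 + wirtingerD m₂ t 1 + m₃ t) := by
  have hl : ContDiff ℝ (⊤ : ℕ∞) (fun s : ℂ => s - t) := by fun_prop
  have hcl : ContDiff ℝ (⊤ : ℕ∞) (fun s : ℂ => (starRingEnd ℂ) (s - t)) :=
    Complex.conjCLE.contDiff.comp hl
  have d : ∀ {f : ℂ → ℂ}, ContDiff ℝ (⊤ : ℕ∞) f → ∀ s, DifferentiableAt ℝ f s :=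
    fun hf s => hf.differentiable (by simp) s
  have hc23 := h₂.add (hl.mul h₃)
  have hQ : ContDiff ℝ (⊤ : ℕ∞) (fun s => A + (s - t) * B - (m₀ s + (s - t) * m₁ s +
      (starRingEnd ℂ) (s - t) * (m₂ s + (s - t) * m₃ s))) :=
    (contDiff_const.add (hl.mul contDiff_const)).sub ((h₀.add (hl.mul h₁)).add (hcl.mul hc23))
  have db : ∀ s, wirtingerDbar (fun s => A + (s - t) * B - (m₀ s + (s - t) * m₁ s +
      (starRingEnd ℂ) (s - t) * (m₂ s + (s - t) * m₃ s))) s 1 =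
      -(wirtingerDbar m₀ s 1 + (s - t) * wirtingerDbar m₁ s 1 + (m₂ s + (s - t) * m₃ s) +
        (starRingEnd ℂ) (s - t) * (wirtingerDbar m₂ s 1 + (s - t) * wirtingerDbar m₃ s 1)) := by
    intro s
    have hconst : ∀ c : ℂ, wirtingerDbar (fun _ : ℂ => c) s 1 = 0 := fun c => by
      simp [wirtingerDbar]
    rw [wirtingerDbar_sub (f := fun s => A + (s - t) * B)
        (g := fun s => m₀ s + (s - t) * m₁ s + (starRingEnd ℂ) (s - t) * (m₂ s + (s - t) * m₃ s))
        (d (contDiff_const.add (hl.mul contDiff_const)) s)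
        (d ((h₀.add (hl.mul h₁)).add (hcl.mul hc23)) s),
      wirtingerDbar_add (f := fun _ => A) (g := fun s => (s - t) * B) (d contDiff_const s)
        (d (hl.mul contDiff_const) s),
      wirtingerDbar_mul (f := fun s => s - t) (g := fun _ => B) (d hl s) (d contDiff_const s),
      wirtingerDbar_add (f := fun s => m₀ s + (s - t) * m₁ s)
        (g := fun s => (starRingEnd ℂ) (s - t) * (m₂ s + (s - t) * m₃ s))
        (d (h₀.add (hl.mul h₁)) s) (d (hcl.mul hc23) s),
      wirtingerDbar_add (f := m₀) (g := fun s => (s - t) * m₁ s) (d h₀ s) (d (hl.mul h₁) s),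
      wirtingerDbar_mul (f := fun s => s - t) (g := m₁) (d hl s) (d h₁ s),
      wirtingerDbar_mul (f := fun s => (starRingEnd ℂ) (s - t))
        (g := fun s => m₂ s + (s - t) * m₃ s) (d hcl s) (d hc23 s),
      wirtingerDbar_add (f := m₂) (g := fun s => (s - t) * m₃ s) (d h₂ s) (d (hl.mul h₃) s),
      wirtingerDbar_mul (f := fun s => s - t) (g := m₃) (d hl s) (d h₃ s),
      wirtingerDbar_sub_const_self, wirtingerDbar_conj_sub_const_self, hconst, hconst]
    ring
  have c0 := contDiff_wirtingerDbar h₀ 1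
  have c1 := contDiff_wirtingerDbar h₁ 1
  have c2 := contDiff_wirtingerDbar h₂ 1
  have c3 := contDiff_wirtingerDbar h₃ 1
  have d2 : ∀ {f : ℂ → ℂ}, ContDiff ℝ (⊤ : ℕ∞) f → DifferentiableAt ℝ (fderiv ℝ f) t :=
    fun hf => (hf.fderiv_right (m := (⊤ : ℕ∞)) le_rfl).differentiable (by simp) t
  rw [← wirtingerD_wirtingerDbar (d2 hQ), ← wirtingerD_wirtingerDbar (d2 h₀)]
  simp only [db]
  have hneg : ∀ {f : ℂ → ℂ}, wirtingerD (fun s => -f s) t 1 = -wirtingerD f t 1 := by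
    intro f
    simp only [wirtingerD, fderiv_fun_neg, neg_apply]
    ring
  have cc := c2.add (hl.mul c3)
  rw [hneg,
    wirtingerD_add (f := fun s => wirtingerDbar m₀ s 1 + (s - t) * wirtingerDbar m₁ s 1 +
        (m₂ s + (s - t) * m₃ s))
      (g := fun s => (starRingEnd ℂ) (s - t) *
        (wirtingerDbar m₂ s 1 + (s - t) * wirtingerDbar m₃ s 1))
      (d ((c0.add (hl.mul c1)).add hc23) t) (d (hcl.mul cc) t),
    wirtingerD_add (f := fun s => wirtingerDbar m₀ s 1 + (s - t) * wirtingerDbar m₁ s 1)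
      (g := fun s => m₂ s + (s - t) * m₃ s) (d (c0.add (hl.mul c1)) t) (d hc23 t),
    wirtingerD_add (f := fun s => wirtingerDbar m₀ s 1)
      (g := fun s => (s - t) * wirtingerDbar m₁ s 1) (d c0 t) (d (hl.mul c1) t),
    wirtingerD_mul (f := fun s => s - t) (g := fun s => wirtingerDbar m₁ s 1) (d hl t) (d c1 t),
    wirtingerD_add (f := m₂) (g := fun s => (s - t) * m₃ s) (d h₂ t) (d (hl.mul h₃) t),
    wirtingerD_mul (f := fun s => s - t) (g := m₃) (d hl t) (d h₃ t),
    wirtingerD_mul (f := fun s => (starRingEnd ℂ) (s - t))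
      (g := fun s => wirtingerDbar m₂ s 1 + (s - t) * wirtingerDbar m₃ s 1) (d hcl t) (d cc t),
    wirtingerD_sub_const_self, wirtingerD_conj_sub_const_self]
  simp
  ring

variable {E : Type*} [NormedAddCommGroup E] [NormedSpace ℂ E] [MeasurableSpace E] [BorelSpace E]
  [SecondCountableTopology E] {μ : Measure E} [IsFiniteMeasure μ]

/-- The bounded functional `f ↦ ⟪x, f y⟫`. -/
def mulForm (x y : Lp ℂ 2 μ) : (E →ᵇ ℂ) →L[ℂ] ℂ :=
  (innerSL ℂ x).comp ((ContinuousLinearMap.apply ℂ (Lp ℂ 2 μ) y).comp (mulOp μ))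

lemma mulForm_apply (x y : Lp ℂ 2 μ) (f : E →ᵇ ℂ) :
    mulForm x y f = inner ℂ x (mulOp μ f y) := rfl

variable {G : ℂ × E → ℝ} (hG : IsFamily fun p => (G p : ℂ)) (S : Submodule ℂ (Lp ℂ 2 μ))
  [S.HasOrthogonalProjection] {t : ℂ} {k : ℂ → Lp ℂ 2 μ}

lemma IsFamily.contDiffAt_kernel (h1 : ∀ᵐ ζ ∂μ, G (t, ζ) = 1) (hkt : k t ∈ S)
    (hk : ∀ᶠ s in 𝓝 t, k s ∈ S ∧ ∀ h ∈ S,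
      inner ℂ (k s) (mulOp μ (hG.slice s) h) = inner ℂ (k t) h) :
    ContDiffAt ℝ (⊤ : ℕ∞) (fun s => (inner ℂ (k t) (k s)).re) t := by
  have hT : ContDiff ℝ (⊤ : ℕ∞) (fun s => mulOp μ (hG.slice s)) :=
    ((mulOp μ).restrictScalars ℝ).contDiff.comp hG.contDiff_slice
  have hone : mulOp μ (hG.slice t) = 1 := mulOp_eq_one (h1.mono fun ζ hζ => by simp [hζ])
  have := contDiffAt_of_compression S hT hone
    (fun s x y => inner_mulOp_comm (fun ζ => by simp) x y) hkt hk
  have hL : ContDiff ℝ (⊤ : ℕ∞) (fun y : Lp ℂ 2 μ => (inner ℂ (k t) y).re) :=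
    (reCLM.comp ((innerSL ℂ (k t)).restrictScalars ℝ)).contDiff
  exact hL.contDiffAt.comp t this

set_option maxHeartbeats 800000 in
/-- The curvature lower bound for the diagonal kernel of a family of weighted norms. -/
theorem IsFamily.levi_kernel_ge (hG0 : ∀ p, 0 ≤ G p) (h1 : ∀ᵐ ζ ∂μ, G (t, ζ) = 1)
    (hkt : k t ∈ S) (hk : ∀ᶠ s in 𝓝 t, k s ∈ S ∧ ∀ h ∈ S,
      inner ℂ (k s) (mulOp μ (hG.slice s) h) = inner ℂ (k t) h) :
    ‖S.starProjection (mulOp μ ((hG.wirtingerD (1, 0)).slice t) (k t))‖ ^ 2 -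
        (inner ℂ (k t) (mulOp μ
          (((hG.wirtingerDbar (1, 0)).wirtingerD (1, 0)).slice t) (k t))).re ≤
      (1 / 4) * (iteratedFDeriv ℝ 2 (fun s => (inner ℂ (k t) (k s)).re) t ![1, 1] +
        iteratedFDeriv ℝ 2 (fun s => (inner ℂ (k t) (k s)).re) t ![I, I]) := by
  set b := mulOp μ ((hG.wirtingerD (1, 0)).slice t) (k t) with hb
  set a := -S.starProjection b with ha
  have haS : a ∈ S := S.neg_mem (Submodule.starProjection_apply_mem S b)
  set T : ℂ → (Lp ℂ 2 μ →L[ℂ] Lp ℂ 2 μ) := fun s => mulOp μ (hG.slice s) with hT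
  have hone : T t = 1 := mulOp_eq_one (h1.mono fun ζ hζ => by simp [hζ])
  set Q : ℂ → ℂ := fun s => 2 * inner ℂ (k t) (k t) + (s - t) * (2 * inner ℂ (k t) a) -
    (mulForm (k t) (k t) (hG.slice s) + (s - t) * mulForm (k t) a (hG.slice s) +
      (starRingEnd ℂ) (s - t) * (mulForm a (k t) (hG.slice s) +
        (s - t) * mulForm a a (hG.slice s))) with hQ
  have hQs : ∀ s, (Q s).re = 2 * (inner ℂ (k t) (k t + (s - t) • a)).re -
      (inner ℂ (k t + (s - t) • a) (T s (k t + (s - t) • a))).re := by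
    intro s
    have h2 : ∀ z : ℂ, 2 * z.re = (2 * z).re := fun z => by simp
    rw [h2, ← Complex.sub_re]
    congr 1
    simp only [hQ, hT, mulForm_apply, map_add, map_smul, inner_add_left, inner_add_right,
      inner_smul_left, inner_smul_right]
    ring
  have hm : ∀ x y : Lp ℂ 2 μ, ContDiff ℝ (⊤ : ℕ∞) (fun s => mulForm x y (hG.slice s)) :=
    fun x y => hG.contDiff_comp_slice _
  have hQc : ContDiff ℝ (⊤ : ℕ∞) Q := by
    have hl : ContDiff ℝ (⊤ : ℕ∞) (fun s : ℂ => s - t) := by fun_prop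
    have hcl : ContDiff ℝ (⊤ : ℕ∞) (fun s : ℂ => (starRingEnd ℂ) (s - t)) :=
      Complex.conjCLE.contDiff.comp hl
    exact (contDiff_const.add (hl.mul contDiff_const)).sub
      (((hm _ _).add (hl.mul (hm _ _))).add (hcl.mul ((hm _ _).add (hl.mul (hm _ _)))))
  have hkc := (hG.contDiffAt_kernel S h1 hkt hk).of_le two_le_top
  have hQr : ContDiffAt ℝ 2 (fun s => (Q s).re) t :=
    (Complex.reCLM.contDiff.comp hQc).contDiffAt.of_le two_le_top
  have hmin : IsLocalMin (fun s => (inner ℂ (k t) (k s)).re - (Q s).re) t := by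
    filter_upwards [hk] with s hs
    have h0 : (Q t).re = (inner ℂ (k t) (k t)).re := by
      rw [hQs, hone]; simp; ring
    simp only [h0, sub_self, hQs, sub_nonneg]
    exact two_re_inner_sub_le (fun x y => inner_mulOp_comm (fun ζ => by simp) x y)
      (fun x => re_inner_mulOp_nonneg (fun ζ => rfl) (fun ζ => hG0 _) x)
      (hs.2 _ hs.1) (hs.2 _ (S.add_mem hkt (S.smul_mem _ haS)))
  have hdiff : ∀ v : ℂ, iteratedFDeriv ℝ 2 (fun s => (Q s).re) t ![v, v] ≤
      iteratedFDeriv ℝ 2 (fun s => (inner ℂ (k t) (k s)).re) t ![v, v] := by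
    intro v
    have h3 := iteratedFDeriv_two_nonneg_of_isLocalMin (hkc.sub hQr) hmin v
    have h4 := iteratedFDeriv_sub_apply (i := 2) hkc hQr
    change iteratedFDeriv ℝ 2 (fun s => (inner ℂ (k t) (k s)).re - (Q s).re) t = _ at h4
    rw [h4] at h3
    simpa using h3
  have hlevi := iteratedFDeriv_two_re (hQc.contDiffAt (x := t) |>.of_le two_le_top)
  have hLQ : leviForm Q t 1 1 = _ := leviForm_sesquilinear t _ _ (hm _ _) (hm _ _) (hm _ _) (hm _ _)
  have d2 : DifferentiableAt ℝ (fderiv ℝ fun s => mulForm (k t) (k t) (hG.slice s)) t :=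
    ((hm _ _).fderiv_right (m := (⊤ : ℕ∞)) le_rfl).differentiable (by simp) t
  rw [← wirtingerD_wirtingerDbar d2, hG.wirtingerDbar_comp_slice, hG.wirtingerD_comp_slice] at hLQ
  simp_rw [hG.wirtingerDbar_comp_slice] at hLQ
  rw [(hG.wirtingerDbar (1, 0)).wirtingerD_comp_slice] at hLQ
  simp only [mulForm_apply] at hLQ
  have hcross : inner ℂ (k t) (mulOp μ ((hG.wirtingerDbar (1, 0)).slice t) a) =
      (starRingEnd ℂ) (inner ℂ a b) := by
    refine inner_mulOp_comm (fun ζ => ?_) _ _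
    have hGd : DifferentiableAt ℝ G (t, ζ) := by
      have := (hG.smooth.differentiable (by simp) (t, ζ))
      exact Complex.reCLM.differentiableAt.comp (t, ζ) this
    exact wirtingerDbar_ofReal hGd _
  have hab : inner ℂ a b = -(‖S.starProjection b‖ ^ 2 : ℂ) := by
    rw [ha, inner_neg_left]
    congr 1
    have h5 : inner ℂ (S.starProjection b) (b - S.starProjection b) = 0 := by
      rw [← inner_conj_symm, Submodule.starProjection_inner_eq_zero b _
        (Submodule.starProjection_apply_mem S b), map_zero]
    rw [inner_sub_right, sub_eq_zero] at h5
    rw [h5, inner_self_eq_norm_sq_to_K]; rfl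
  have haa : inner ℂ a (mulOp μ (hG.slice t) a) = (‖S.starProjection b‖ ^ 2 : ℂ) := by
    have : mulOp μ (hG.slice t) a = a := by
      change T t a = a
      rw [hone]; rfl
    rw [this, inner_self_eq_norm_sq_to_K, ha, norm_neg]; rfl
  rw [hcross, ← hb, hab, haa] at hLQ
  rw [hLQ] at hlevi
  have hre : ((‖S.starProjection b‖ : ℂ) ^ 2).re = ‖S.starProjection b‖ ^ 2 := by
    rw [← Complex.ofReal_pow, Complex.ofReal_re]
  simp only [Complex.neg_re, Complex.add_re, Complex.conj_re, hre] at hlevi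
  have := hdiff 1
  have := hdiff I
  linarith

end LowerBound

section Domain

variable {F : Type*} [NormedAddCommGroup F] [NormedSpace ℂ F]

lemma leviForm_sum_smul {ι : Type*} [Fintype ι] (f : F → ℂ) (p : F) (a b : ι → ℂ) (v : ι → F) :
    leviForm f p (∑ j, a j • v j) (∑ k, b k • v k) =
      ∑ j, ∑ k, leviForm f p (v j) (v k) * a j * (starRingEnd ℂ) (b k) := by
  rw [leviForm_sum_left]
  refine Finset.sum_congr rfl fun j _ => ?_
  rw [leviForm_smul_left, leviForm_sum_right, Finset.mul_sum]
  refine Finset.sum_congr rfl fun k _ => ?_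
  rw [leviForm_smul_right]
  ring

lemma contDiffAt_two_of_contDiffOn {s : Set F} {f : F → ℝ} (hs : IsOpen s)
    (hf : ContDiffOn ℝ (⊤ : ℕ∞) f s) {p : F} (hp : p ∈ s) : ContDiffAt ℝ 2 f p :=
  (hf.contDiffAt (hs.mem_nhds hp)).of_le two_le_top

lemma StrictPlurisubharmonicOn.leviForm_pos {s : Set F} {f : F → ℝ}
    (h : StrictPlurisubharmonicOn f s) (hs : IsOpen s) (hf : ContDiffOn ℝ (⊤ : ℕ∞) f s) {p : F}
    (hp : p ∈ s) {v : F} (hv : v ≠ 0) : 0 < (leviForm (fun y => (f y : ℂ)) p v v).re := by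
  rw [leviForm_self (contDiffAt_two_of_contDiffOn hs hf hp), Complex.ofReal_re]
  linarith [h p hp v hv]

lemma euclidean_eq_sum_single {n : ℕ} (a : Cn n) :
    a = ∑ j, a j • (EuclideanSpace.single j (1 : ℂ) : Cn n) := by
  ext i
  simp [Finset.sum_apply, Pi.single_apply]

lemma leviForm_eq_sum_leviCoeff {n : ℕ} (ψ : Cn n → ℝ) (x a : Cn n) :
    leviForm (fun y => (ψ y : ℂ)) x a a =
      ∑ j, ∑ k, leviCoeff ψ j k x * a j * (starRingEnd ℂ) (a k) := by
  conv_lhs => rw [euclidean_eq_sum_single a, leviForm_sum_smul]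
  rfl

/-- On compact sets the Levi form of a strictly plurisubharmonic function is bounded below. -/
lemma StrictPlurisubharmonicOn.exists_lower_bound {n : ℕ} {W : Set (Cn n)} {ψ : Cn n → ℝ}
    (h : StrictPlurisubharmonicOn ψ W) (hW : IsOpen W) (hψ : ContDiffOn ℝ (⊤ : ℕ∞) ψ W)
    {L : Set (Cn n)} (hL : IsCompact L) (hLW : L ⊆ W) :
    ∃ c > 0, ∀ x ∈ L, ∀ a : Fin n → ℂ, c * ∑ k, ‖a k‖ ^ 2 ≤
      (∑ j, ∑ k, leviCoeff ψ j k x * a j * (starRingEnd ℂ) (a k)).re := by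
  have hcont : ContinuousOn (fun p : Cn n × Cn n =>
      (∑ j, ∑ k, leviCoeff ψ j k p.1 * p.2 j * (starRingEnd ℂ) (p.2 k)).re)
      (L ×ˢ sphere (0 : Cn n) 1) := by
    refine Complex.continuous_re.comp_continuousOn ?_
    refine continuousOn_finsetSum _ fun j _ => continuousOn_finsetSum _ fun k _ => ?_
    refine (ContinuousOn.mul ?_ (by fun_prop)).mul (Continuous.continuousOn (by fun_prop))
    exact (((contDiffOn_leviCoeff hW hψ j k).continuousOn.mono hLW).comp continuousOn_fst
      fun p hp => hp.1)
  have key : ∃ c > 0, ∀ x ∈ L, ∀ a ∈ sphere (0 : Cn n) 1, c ≤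
      (∑ j, ∑ k, leviCoeff ψ j k x * a j * (starRingEnd ℂ) (a k)).re := by
    rcases (L ×ˢ sphere (0 : Cn n) 1).eq_empty_or_nonempty with he | hne
    · refine ⟨1, one_pos, fun x hx a ha => ?_⟩
      exact absurd (show (x, a) ∈ L ×ˢ sphere (0 : Cn n) 1 from ⟨hx, ha⟩) (by simp [he])
    · obtain ⟨p, hp, hmin⟩ := (hL.prod (isCompact_sphere _ _)).exists_isMinOn hne hcont
      refine ⟨(∑ j, ∑ k, leviCoeff ψ j k p.1 * p.2 j * (starRingEnd ℂ) (p.2 k)).re, ?_,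
        fun x hx a ha => isMinOn_iff.1 hmin (x, a) ⟨hx, ha⟩⟩
      have hp2 : p.2 ≠ 0 := fun h0 => by
        have := hp.2
        simp [h0] at this
      rw [← leviForm_eq_sum_leviCoeff]
      exact h.leviForm_pos hW hψ (hLW hp.1) hp2
  obtain ⟨c, hc, hmin⟩ := key
  refine ⟨c, hc, fun x hx a => ?_⟩
  set b : Cn n := WithLp.toLp 2 a with hb
  have hba : ∀ k, b k = a k := fun k => rfl
  have hnb : ∑ k, ‖a k‖ ^ 2 = ‖b‖ ^ 2 := by rw [EuclideanSpace.norm_sq_eq]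
  simp only [← hba]
  simp only [← hba] at hnb
  rw [← leviForm_eq_sum_leviCoeff, hnb]
  rcases eq_or_ne b 0 with h0 | h0
  · rw [h0]; simp [leviForm]
  have hpos : 0 < ‖b‖ := norm_pos_iff.2 h0
  have hu := hmin x hx (((‖b‖⁻¹ : ℝ) : ℂ) • b) (by
    rw [mem_sphere_zero_iff_norm, norm_smul, Complex.norm_real, norm_inv, norm_norm,
      inv_mul_cancel₀ hpos.ne'])
  rw [← leviForm_eq_sum_leviCoeff, leviForm_smul_left, leviForm_smul_right, Complex.conj_ofReal,
    Complex.re_ofReal_mul, Complex.re_ofReal_mul] at hu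
  have h2 : 0 < ‖b‖ ^ 2 := by positivity
  calc c * ‖b‖ ^ 2 ≤ (‖b‖⁻¹ * (‖b‖⁻¹ * (leviForm (fun y => (ψ y : ℂ)) x b b).re)) * ‖b‖ ^ 2 :=
        mul_le_mul_of_nonneg_right hu h2.le
    _ = _ := by field_simp

lemma isExhaustion_of_defining {n : ℕ} {V W : Set (Cn n)} {ρ : Cn n → ℝ} (hW : IsOpen W)
    (hVW : closure V ⊆ W) (hρ : ContDiffOn ℝ (⊤ : ℕ∞) ρ W) (hV : V = {ζ | ρ ζ < 0})
    (hVbd : Bornology.IsBounded V) : IsExhaustion ρ V where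
  isOpen := by
    have h := hρ.continuousOn.isOpen_inter_preimage hW (isOpen_Iio (a := (0 : ℝ)))
    have : W ∩ ρ ⁻¹' Iio 0 = V := by
      rw [hV] at hVW ⊢
      exact inter_eq_right.2 fun x hx => hVW (subset_closure hx)
    rwa [this] at h
  contDiffOn := hρ.mono (subset_closure.trans hVW)
  neg x hx := by rw [hV] at hx; exact hx
  nonneg x hx := by rw [hV] at hx; exact not_lt.1 hx
  isCompact ε hε := by
    have h := (hρ.continuousOn.mono hVW).preimage_isClosed_of_isClosed isClosed_closure
      (isClosed_Iic (a := -ε))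
    have h' : closure V ∩ ρ ⁻¹' Iic (-ε) = {x | ρ x ≤ -ε} := by
      refine inter_eq_right.2 fun x hx => subset_closure ?_
      rw [hV]
      have : ρ x ≤ -ε := hx
      change ρ x < 0
      linarith
    rw [← h']
    exact hVbd.isCompact_closure.of_isClosed_subset h inter_subset_left

lemma exists_bound_grad {n : ℕ} {V W : Set (Cn n)} {ρ : Cn n → ℝ} (hW : IsOpen W)
    (hVW : closure V ⊆ W) (hρ : ContDiffOn ℝ (⊤ : ℕ∞) ρ W) (hVbd : Bornology.IsBounded V) :
    ∃ M, ∀ x ∈ V, ∑ j, ‖dz j (fun y => (ρ y : ℂ)) x‖ ^ 2 ≤ M := by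
  have hc : ContinuousOn (fun x => ∑ j, ‖dz j (fun y => (ρ y : ℂ)) x‖ ^ 2) (closure V) :=
    continuousOn_finsetSum _ fun j _ => (((contDiffOn_wirtingerD hW
      (contDiff_ofReal_comp hρ) _).continuousOn.mono hVW).norm.pow 2)
  obtain ⟨M, hM⟩ := hVbd.isCompact_closure.bddAbove_image hc
  exact ⟨M, fun x hx => hM ⟨x, subset_closure hx, rfl⟩⟩

end Domain

section Schur

variable {n : ℕ} {W : Set (ℂ × Cn n)} {φ : ℂ × Cn n → ℝ} {p : ℂ × Cn n}

lemma contDiffOn_ofReal {F : Type*} [NormedAddCommGroup F] [NormedSpace ℝ F] {s : Set F}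
    {f : F → ℝ} (hf : ContDiffOn ℝ (⊤ : ℕ∞) f s) :
    ContDiffOn ℝ (⊤ : ℕ∞) (fun y => (f y : ℂ)) s :=
  Complex.ofRealCLM.contDiff.comp_contDiffOn hf

lemma differentiableAt_fderiv_ofReal {F : Type*} [NormedAddCommGroup F] [NormedSpace ℂ F]
    {s : Set F} {f : F → ℝ} (hs : IsOpen s) (hf : ContDiffOn ℝ (⊤ : ℕ∞) f s) {p : F}
    (hp : p ∈ s) : DifferentiableAt ℝ (fderiv ℝ fun y => (f y : ℂ)) p :=
  differentiableAt_of_contDiffOn hs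
    ((contDiffOn_ofReal hf).fderiv_of_isOpen (m := (⊤ : ℕ∞)) hs le_rfl) hp

lemma hessTTbar_eq (hW : IsOpen W) (hφ : ContDiffOn ℝ (⊤ : ℕ∞) φ W) (hp : p ∈ W) :
    hessTTbar n φ p = leviForm (fun q => (φ q : ℂ)) p (dirT n) (dirT n) :=
  wirtingerD_wirtingerDbar (differentiableAt_fderiv_ofReal hW hφ hp) _ _

lemma hessTZbar_eq (hW : IsOpen W) (hφ : ContDiffOn ℝ (⊤ : ℕ∞) φ W) (hp : p ∈ W) (k : Fin n) :
    hessTZbar n φ k p = leviForm (fun q => (φ q : ℂ)) p (dirT n) (dirZ n k) :=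
  wirtingerD_wirtingerDbar (differentiableAt_fderiv_ofReal hW hφ hp) _ _

lemma hessZZbar_eq (hW : IsOpen W) (hφ : ContDiffOn ℝ (⊤ : ℕ∞) φ W) (hp : p ∈ W) (j k : Fin n) :
    hessZZbar n φ p j k = leviForm (fun q => (φ q : ℂ)) p (dirZ n j) (dirZ n k) :=
  wirtingerD_wirtingerDbar (differentiableAt_fderiv_ofReal hW hφ hp) _ _

lemma sum_smul_dirZ (a : Fin n → ℂ) : ∑ k, a k • dirZ n k = (0, WithLp.toLp 2 a) := by
  have : (WithLp.toLp 2 a : Cn n) = ∑ j, a j • (EuclideanSpace.single j (1 : ℂ) : Cn n) :=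
    euclidean_eq_sum_single _
  rw [this]
  ext1
  · simp [dirZ, Prod.fst_sum]
  · simp [dirZ, Prod.snd_sum]

lemma isUnit_det_hessZZbar (hW : IsOpen W) (hφ : ContDiffOn ℝ (⊤ : ℕ∞) φ W)
    (hsp : StrictPlurisubharmonicOn φ W) (hp : p ∈ W) : IsUnit (hessZZbar n φ p).det := by
  rw [isUnit_iff_ne_zero]
  intro h0
  obtain ⟨v, hv, hMv⟩ := Matrix.exists_vecMul_eq_zero_iff.2 h0
  have hA : ∑ k, v k • dirZ n k ≠ 0 := by
    rw [sum_smul_dirZ]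
    intro h
    apply hv
    have h2 := congrArg Prod.snd h
    simpa using h2
  have := hsp.leviForm_pos hW hφ hp hA
  rw [leviForm_sum_smul, Finset.sum_comm] at this
  simp_rw [← hessZZbar_eq hW hφ hp] at this
  have hz : ∀ k, ∑ j, hessZZbar n φ p j k * v j * (starRingEnd ℂ) (v k) = 0 := by
    intro k
    have := congrFun hMv k
    simp only [Matrix.vecMul, dotProduct, Pi.zero_apply] at this
    rw [← Finset.sum_mul]
    simp_rw [mul_comm _ (v _)]
    rw [this, zero_mul]
  simp [hz] at this

/-- The vector `X` with `L(X, ∂_{z_l}) = φ_{t z̄_l}` for all `l`. -/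
lemma exists_schur_vector (hW : IsOpen W) (hφ : ContDiffOn ℝ (⊤ : ℕ∞) φ W)
    (hsp : StrictPlurisubharmonicOn φ W) (hp : p ∈ W) :
    ∃ x : Fin n → ℂ,
      (∀ l, leviForm (fun q => (φ q : ℂ)) p (∑ k, x k • dirZ n k) (dirZ n l) =
        hessTZbar n φ l p) ∧
      bigD n φ p = leviForm (fun q => (φ q : ℂ)) p (dirT n) (dirT n) -
        leviForm (fun q => (φ q : ℂ)) p (∑ k, x k • dirZ n k) (dirT n) := by
  have hu := isUnit_det_hessZZbar hW hφ hsp hp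
  set v : Fin n → ℂ := fun k => hessTZbar n φ k p with hv
  refine ⟨Matrix.vecMul v (hessZZbar n φ p)⁻¹, fun l => ?_, ?_⟩
  · rw [leviForm_sum_left]
    simp_rw [leviForm_smul_left, ← hessZZbar_eq hW hφ hp]
    have : Matrix.vecMul (Matrix.vecMul v (hessZZbar n φ p)⁻¹) (hessZZbar n φ p) l = v l := by
      rw [Matrix.vecMul_vecMul, Matrix.nonsing_inv_mul _ hu, Matrix.vecMul_one]
    exact this
  · rw [bigD, hessTTbar_eq hW hφ hp, leviForm_sum_left, Finset.sum_comm]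
    congr 1
    refine Finset.sum_congr rfl fun k _ => ?_
    rw [leviForm_smul_left, Matrix.vecMul, dotProduct, Finset.sum_mul]
    refine Finset.sum_congr rfl fun j _ => ?_
    rw [hessTZbar_eq hW hφ hp k, leviForm_conj (contDiffAt_two_of_contDiffOn hW hφ hp)]
    simp only [hv]
    ring

lemma StrictPlurisubharmonicOn.leviForm_nonneg {F : Type*} [NormedAddCommGroup F]
    [NormedSpace ℂ F] {s : Set F} {f : F → ℝ}
    (h : StrictPlurisubharmonicOn f s) (hs : IsOpen s) (hf : ContDiffOn ℝ (⊤ : ℕ∞) f s) {p : F}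
    (hp : p ∈ s) (v : F) : 0 ≤ (leviForm (fun y => (f y : ℂ)) p v v).re := by
  rcases eq_or_ne v 0 with rfl | hv
  · simp [leviForm]
  · exact (h.leviForm_pos hs hf hp hv).le

lemma leviForm_sub_self {F : Type*} [NormedAddCommGroup F] [NormedSpace ℂ F] {f : F → ℝ} {p : F}
    (hf : ContDiffAt ℝ 2 f p) (v w : F) :
    (leviForm (fun y => (f y : ℂ)) p (v - w) (v - w)).re =
      (leviForm (fun y => (f y : ℂ)) p v v).re + (leviForm (fun y => (f y : ℂ)) p w w).re -
        2 * (leviForm (fun y => (f y : ℂ)) p v w).re := by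
  have h1 : v - w = v + (-1 : ℂ) • w := by simp [sub_eq_add_neg]
  rw [h1, leviForm_add_left, leviForm_add_right, leviForm_add_right, leviForm_smul_left,
    leviForm_smul_left, leviForm_smul_right, leviForm_smul_right, ← leviForm_conj hf v w]
  simp
  ring

theorem bigD_re_nonneg (hW : IsOpen W) (hφ : ContDiffOn ℝ (⊤ : ℕ∞) φ W)
    (hsp : StrictPlurisubharmonicOn φ W) (hp : p ∈ W) : 0 ≤ (bigD n φ p).re := by
  obtain ⟨x, hx, hD⟩ := exists_schur_vector hW hφ hsp hp
  have hc := contDiffAt_two_of_contDiffOn hW hφ hp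
  have h := hsp.leviForm_nonneg hW hφ hp (dirT n - ∑ k, x k • dirZ n k)
  rw [leviForm_sub_self hc] at h
  have h1 : leviForm (fun q => (φ q : ℂ)) p (∑ k, x k • dirZ n k) (∑ k, x k • dirZ n k) =
      leviForm (fun q => (φ q : ℂ)) p (dirT n) (∑ k, x k • dirZ n k) := by
    rw [leviForm_sum_right, leviForm_sum_right]
    simp_rw [leviForm_smul_right, hx, hessTZbar_eq hW hφ hp]
  have h2 : (leviForm (fun q => (φ q : ℂ)) p (dirT n) (∑ k, x k • dirZ n k)).re =
      (leviForm (fun q => (φ q : ℂ)) p (∑ k, x k • dirZ n k) (dirT n)).re := by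
    rw [← leviForm_conj hc, Complex.conj_re]
  rw [h1] at h
  rw [hD, Complex.sub_re]
  linarith

/-- The Cauchy inequality for the fiberwise Levi form. -/
theorem two_re_sum_hessTZbar_le (hW : IsOpen W) (hφ : ContDiffOn ℝ (⊤ : ℕ∞) φ W)
    (hsp : StrictPlurisubharmonicOn φ W) (hp : p ∈ W) (u : ℂ) (a : Fin n → ℂ) :
    2 * (∑ k, u * hessTZbar n φ k p * (starRingEnd ℂ) (a k)).re ≤
      ‖u‖ ^ 2 * ((hessTTbar n φ p).re - (bigD n φ p).re) +
        (∑ j, ∑ k, hessZZbar n φ p j k * a j * (starRingEnd ℂ) (a k)).re := by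
  obtain ⟨x, hx, hD⟩ := exists_schur_vector hW hφ hsp hp
  have hc := contDiffAt_two_of_contDiffOn hW hφ hp
  have h := hsp.leviForm_nonneg hW hφ hp (u • ∑ k, x k • dirZ n k - ∑ k, a k • dirZ n k)
  rw [leviForm_sub_self hc] at h
  have h1 : leviForm (fun q => (φ q : ℂ)) p (∑ k, x k • dirZ n k) (∑ k, x k • dirZ n k) =
      leviForm (fun q => (φ q : ℂ)) p (dirT n) (∑ k, x k • dirZ n k) := by
    rw [leviForm_sum_right, leviForm_sum_right]
    simp_rw [leviForm_smul_right, hx, hessTZbar_eq hW hφ hp]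
  have h2 : (leviForm (fun q => (φ q : ℂ)) p (dirT n) (∑ k, x k • dirZ n k)).re =
      (leviForm (fun q => (φ q : ℂ)) p (∑ k, x k • dirZ n k) (dirT n)).re := by
    rw [← leviForm_conj hc, Complex.conj_re]
  have h3 : leviForm (fun q => (φ q : ℂ)) p (u • ∑ k, x k • dirZ n k) (∑ k, a k • dirZ n k) =
      ∑ k, u * hessTZbar n φ k p * (starRingEnd ℂ) (a k) := by
    rw [leviForm_smul_left, leviForm_sum_right, Finset.mul_sum]
    refine Finset.sum_congr rfl fun k _ => ?_
    rw [leviForm_smul_right, hx]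
    ring
  have h4 : leviForm (fun q => (φ q : ℂ)) p (∑ k, a k • dirZ n k) (∑ k, a k • dirZ n k) =
      ∑ j, ∑ k, hessZZbar n φ p j k * a j * (starRingEnd ℂ) (a k) := by
    rw [leviForm_sum_smul]
    simp_rw [hessZZbar_eq hW hφ hp]
  have h5 : (leviForm (fun q => (φ q : ℂ)) p (u • ∑ k, x k • dirZ n k)
      (u • ∑ k, x k • dirZ n k)).re = ‖u‖ ^ 2 * ((hessTTbar n φ p).re - (bigD n φ p).re) := by
    rw [leviForm_smul_left, leviForm_smul_right, ← mul_assoc, Complex.mul_conj,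
      Complex.normSq_eq_norm_sq, Complex.re_ofReal_mul, h1, h2, hD, hessTTbar_eq hW hφ hp,
      Complex.sub_re]
    ring
  rw [h3, h4, h5] at h
  linarith

lemma bigD_re_le (hW : IsOpen W) (hφ : ContDiffOn ℝ (⊤ : ℕ∞) φ W)
    (hsp : StrictPlurisubharmonicOn φ W) (hp : p ∈ W) :
    (bigD n φ p).re ≤ (hessTTbar n φ p).re := by
  have h := two_re_sum_hessTZbar_le hW hφ hsp hp 1 0
  simp at h
  exact h

/-- Restriction of Wirtinger derivatives to a fiber. -/
lemma wirtinger_comp_fiber {E : Type*} [NormedAddCommGroup E] [NormedSpace ℂ E]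
    {f : ℂ × E → ℂ} {t : ℂ} {ζ : E} (hf : DifferentiableAt ℝ f (t, ζ)) (v : E) :
    wirtingerD (fun y => f (t, y)) ζ v = wirtingerD f (t, ζ) (0, v) ∧
    wirtingerDbar (fun y => f (t, y)) ζ v = wirtingerDbar f (t, ζ) (0, v) := by
  have h1 : HasFDerivAt (fun y : E => ((t, y) : ℂ × E)) (ContinuousLinearMap.inr ℝ ℂ E) ζ :=
    hasFDerivAt_prodMk_right t ζ
  have h2 := (hf.hasFDerivAt.comp ζ h1).fderiv
  change fderiv ℝ (fun y => f (t, y)) ζ = _ at h2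
  have hI : I • ((0, v) : ℂ × E) = (0, I • v) := by simp
  simp only [wirtingerD, wirtingerDbar, h2, hI]
  simp

lemma leviCoeff_fiber (hW : IsOpen W) (hφ : ContDiffOn ℝ (⊤ : ℕ∞) φ W) {t : ℂ} {ζ : Cn n}
    (hp : (t, ζ) ∈ W) (j k : Fin n) :
    leviCoeff (fun y => φ (t, y)) j k ζ = hessZZbar n φ (t, ζ) j k := by
  have hcont : Continuous fun y : Cn n => ((t, y) : ℂ × Cn n) := by fun_prop
  have hs : IsOpen ((fun y : Cn n => ((t, y) : ℂ × Cn n)) ⁻¹' W) := hW.preimage hcont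
  have hψ : ContDiffOn ℝ (⊤ : ℕ∞) (fun y => φ (t, y))
      ((fun y : Cn n => ((t, y) : ℂ × Cn n)) ⁻¹' W) :=
    hφ.comp (contDiff_prodMk_right t).contDiffOn fun y hy => hy
  have hφc := contDiffOn_ofReal hφ
  rw [leviCoeff, ← wirtingerD_wirtingerDbar (differentiableAt_fderiv_ofReal hs hψ hp)]
  have he : (fun q => wirtingerDbar (fun y => (φ (t, y) : ℂ)) q (EuclideanSpace.single k 1))
      =ᶠ[𝓝 ζ] fun q => (fun x => wirtingerDbar (fun x => (φ x : ℂ)) x (dirZ n k)) (t, q) := by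
    filter_upwards [hs.mem_nhds hp] with q hq
    exact (wirtinger_comp_fiber (f := fun x => (φ x : ℂ))
      (differentiableAt_of_contDiffOn hW hφc hq) _).2
  rw [wirtingerD, he.fderiv_eq]
  exact (wirtinger_comp_fiber (f := fun x => wirtingerDbar (fun x => (φ x : ℂ)) x (dirZ n k))
    (differentiableAt_of_contDiffOn hW (contDiffOn_wirtingerDbar hW hφc _) hp) _).1

end Schur

section Family

variable {n : ℕ} {V : Set (Cn n)} {W : Set (ℂ × Cn n)} {φ : ℂ × Cn n → ℝ} {t : ℂ}

lemma IsWeight.isFiniteMeasure_wm {ψ : Cn n → ℝ} (h : IsWeight V ψ) :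
    IsFiniteMeasure (wm V ψ) := by
  obtain ⟨c, hc, hle⟩ := h.wm_le
  have := h.isFiniteMeasure_restrict
  exact ⟨(hle univ).trans_lt (by
    rw [Measure.smul_apply, smul_eq_mul]
    exact ENNReal.mul_lt_top hc.lt_top (measure_lt_top _ _))⟩

/-- The family of quotients of the weights `e^{-φ^s}` by the weight `e^{-φ^t}`, cut off. -/
lemma exists_isFamily (hVbd : Bornology.IsBounded V) (hW : IsOpen W)
    (hφ : ContDiffOn ℝ (⊤ : ℕ∞) φ W) (htW : {t} ×ˢ closure V ⊆ W) :
    ∃ G : ℂ × Cn n → ℝ, (IsFamily fun p => (G p : ℂ)) ∧ (∀ p, 0 ≤ G p) ∧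
      ∀ᶠ p in 𝓝ˢ ({t} ×ˢ closure V), G p = Real.exp (φ (t, p.2) - φ p) := by
  set W₂ : Set (ℂ × Cn n) := W ∩ (fun p : ℂ × Cn n => ((t, p.2) : ℂ × Cn n)) ⁻¹' W with hW₂
  have hsl : ContDiff ℝ (⊤ : ℕ∞) (fun p : ℂ × Cn n => ((t, p.2) : ℂ × Cn n)) := by fun_prop
  have hW₂o : IsOpen W₂ := hW.inter (hW.preimage hsl.continuous)
  have hK : IsCompact ({t} ×ˢ closure V) := isCompact_singleton.prod hVbd.isCompact_closure
  have hKW : {t} ×ˢ closure V ⊆ W₂ := by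
    rintro ⟨s, ζ⟩ ⟨hs, hζ⟩
    rw [mem_singleton_iff] at hs
    subst hs
    exact ⟨htW ⟨rfl, hζ⟩, htW ⟨rfl, hζ⟩⟩
  obtain ⟨κ, hκ, hκc, hκW, hκ1, hκ0⟩ := exists_cutoff hK hW₂o hKW
  have hH : ContDiffOn ℝ (⊤ : ℕ∞) (fun p => Real.exp (φ (t, p.2) - φ p)) W₂ :=
    Real.contDiff_exp.comp_contDiffOn ((hφ.comp hsl.contDiffOn fun p hp => hp.2).sub
      (hφ.mono inter_subset_left))
  refine ⟨fun p => κ p * Real.exp (φ (t, p.2) - φ p), ⟨?_, ?_⟩,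
    fun p => mul_nonneg (hκ0 p).1 (Real.exp_pos _).le, ?_⟩
  · refine Complex.ofRealCLM.contDiff.comp (contDiff_iff_contDiffAt.2 fun p => ?_)
    by_cases hp : p ∈ W₂
    · exact hκ.contDiffAt.mul (hH.contDiffAt (hW₂o.mem_nhds hp))
    · have : (fun p => κ p * Real.exp (φ (t, p.2) - φ p)) =ᶠ[𝓝 p] fun _ => 0 := by
        filter_upwards [(isClosed_tsupport κ).isOpen_compl.mem_nhds fun h => hp (hκW h)] with q hq
        rw [image_eq_zero_of_notMem_tsupport hq, zero_mul]
      exact contDiffAt_const.congr_of_eventuallyEq this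
  · exact hκc.mul_right.comp_left (g := fun r : ℝ => (r : ℂ)) Complex.ofReal_zero
  · filter_upwards [hκ1] with p hp
    rw [hp, one_mul]

lemma eventually_fiber_of_nhdsSet {P : ℂ × Cn n → Prop} (hVbd : Bornology.IsBounded V)
    (h : ∀ᶠ p in 𝓝ˢ ({t} ×ˢ closure V), P p) : ∀ᶠ s in 𝓝 t, ∀ ζ ∈ V, P (s, ζ) := by
  rw [isCompact_singleton.nhdsSet_prod_eq hVbd.isCompact_closure, nhdsSet_singleton,
    eventually_prod_iff] at h
  obtain ⟨pa, ha, pb, hb, hab⟩ := h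
  filter_upwards [ha] with s hs ζ hζ
  exact hab hs (subset_of_mem_nhdsSet hb (subset_closure hζ))

lemma isWeight_fiber (hVo : IsOpen V) (hVbd : Bornology.IsBounded V)
    (hφ : ContDiffOn ℝ (⊤ : ℕ∞) φ W) (htW : {t} ×ˢ closure V ⊆ W) :
    IsWeight V fun ζ => φ (t, ζ) where
  isOpen := hVo
  bounded := hVbd
  contDiffOn := hφ.comp (contDiff_prodMk_right t).contDiffOn fun ζ hζ =>
    htW ⟨rfl, subset_closure hζ⟩
  exists_bound := by
    have hc : ContinuousOn (fun ζ => φ (t, ζ)) (closure V) :=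
      hφ.continuousOn.comp (Continuous.continuousOn (by fun_prop)) fun ζ hζ => htW ⟨rfl, hζ⟩
    obtain ⟨B, hB⟩ := hVbd.isCompact_closure.exists_bound_of_continuousOn hc
    exact ⟨B, fun x hx => hB x (subset_closure hx)⟩

lemma IsWeight.memLp_iff_integrableOn {ψ : Cn n → ℝ} (h : IsWeight V ψ) {f : Cn n → ℂ}
    (hf : DifferentiableOn ℂ f V) : MemLp f 2 (volume.restrict V) ↔
      IntegrableOn (fun ζ => ‖f ζ‖ ^ 2 * Real.exp (-ψ ζ)) V := by
  have hfm : AEStronglyMeasurable f (volume.restrict V) :=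
    hf.continuousOn.aestronglyMeasurable h.isOpen.measurableSet
  have hem : AEStronglyMeasurable (fun ζ => Real.exp (-ψ ζ)) (volume.restrict V) :=
    (Real.continuous_exp.comp_continuousOn h.contDiffOn.continuousOn.neg).aestronglyMeasurable
      h.isOpen.measurableSet
  obtain ⟨B, hB⟩ := h.exists_bound
  rw [memLp_two_iff_integrable_sq_norm hfm]
  constructor
  · intro hi
    refine Integrable.mono' (hi.mul_const (Real.exp B)) ((hfm.norm.pow 2).mul hem) ?_
    refine (ae_restrict_iff' h.isOpen.measurableSet).2 (Eventually.of_forall fun ζ hζ => ?_)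
    rw [Real.norm_of_nonneg (by positivity)]
    gcongr
    linarith [neg_le_of_abs_le (hB ζ hζ)]
  · intro hi
    refine Integrable.mono' (hi.mul_const (Real.exp B)) (hfm.norm.pow 2) ?_
    refine (ae_restrict_iff' h.isOpen.measurableSet).2 (Eventually.of_forall fun ζ hζ => ?_)
    rw [Real.norm_of_nonneg (by positivity), mul_assoc, ← Real.exp_add]
    refine le_mul_of_one_le_right (by positivity) (Real.one_le_exp ?_)
    linarith [le_of_abs_le (hB ζ hζ)]

lemma IsWeight.memA2_iff {ψ : Cn n → ℝ} (h : IsWeight V ψ) {f : Cn n → ℂ} :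
    MemA2 V ψ f ↔ DifferentiableOn ℂ f V ∧ MemLp f 2 (volume.restrict V) :=
  ⟨fun hf => ⟨hf.1, (h.memLp_iff_integrableOn hf.1).2 hf.2⟩,
    fun hf => ⟨hf.1, (h.memLp_iff_integrableOn hf.1).1 hf.2⟩⟩

lemma IsWeight.memLp_kernel {ψ ψ' : Cn n → ℝ} (h : IsWeight V ψ) (h' : IsWeight V ψ')
    {z : Cn n} {k : Cn n → ℂ} (hk : IsBergmanKernelAt V ψ' z k) : MemLp k 2 (wm V ψ) :=
  h.memLp_wm_iff.2 (h'.memA2_iff.1 hk.1).2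

open Classical in
/-- The class in `L²(V, e^{-ψ})` of a function (zero if the function is not in the space). -/
def toL2 (V : Set (Cn n)) (ψ : Cn n → ℝ) (f : Cn n → ℂ) : Lp ℂ 2 (wm V ψ) :=
  if h : MemLp f 2 (wm V ψ) then h.toLp f else 0

lemma toL2_of_memLp {ψ : Cn n → ℝ} {f : Cn n → ℂ} (h : MemLp f 2 (wm V ψ)) :
    toL2 V ψ f = h.toLp f := dif_pos h

/-- The reproducing property for the weight `e^{-ψ'}`, in the Hilbert space of the weight
`e^{-ψ}`. -/
lemma IsWeight.inner_toL2_kernel {ψ ψ' : Cn n → ℝ} (h : IsWeight V ψ) (h' : IsWeight V ψ')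
    [IsFiniteMeasure (wm V ψ)] {z : Cn n} {k : Cn n → ℂ} (hk : IsBergmanKernelAt V ψ' z k)
    {g : BoundedContinuousFunction (Cn n) ℂ}
    (hg : ∀ ζ ∈ V, g ζ = (Real.exp (ψ ζ - ψ' ζ) : ℂ)) {x : Lp ℂ 2 (wm V ψ)} {u : Cn n → ℂ}
    (hu : DifferentiableOn ℂ u V) (hxu : x =ᵐ[wm V ψ] u) :
    inner ℂ (toL2 V ψ k) (mulOp _ g x) = u z := by
  have hkm := h.memLp_kernel h' hk
  have hum : MemLp u 2 (volume.restrict V) := h.memLp_wm_iff.1 ((memLp_congr_ae hxu).1 (Lp.memLp x))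
  rw [← hk.2 u (h'.memA2_iff.2 ⟨hu, hum⟩), toL2_of_memLp hkm, inner_mulOp]
  have : ∫ ζ, g ζ * ((starRingEnd ℂ) (hkm.toLp k ζ) * x ζ) ∂(wm V ψ) =
      ∫ ζ, g ζ * ((starRingEnd ℂ) (k ζ) * u ζ) ∂(wm V ψ) := by
    refine integral_congr_ae ?_
    filter_upwards [hkm.coeFn_toLp, hxu] with ζ h1 h2
    rw [h1, h2]
  rw [this, h.integral_wm]
  refine setIntegral_congr_fun h.isOpen.measurableSet fun ζ hζ => ?_
  simp only [hg ζ hζ]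
  have : Real.exp (-ψ' ζ) = Real.exp (ψ ζ - ψ' ζ) * Real.exp (-ψ ζ) := by
    rw [← Real.exp_add]; congr 1; ring
  rw [this, Complex.ofReal_mul]
  ring

lemma IsWeight.toL2_kernel_mem {ψ ψ' : Cn n → ℝ} (h : IsWeight V ψ) (h' : IsWeight V ψ')
    {z : Cn n} {k : Cn n → ℂ} (hk : IsBergmanKernelAt V ψ' z k) :
    toL2 V ψ k ∈ bergmanSub V ψ := by
  have hkm := h.memLp_kernel h' hk
  rw [h.mem_bergmanSub_iff, toL2_of_memLp hkm]
  exact ⟨k, hk.1.1, hkm.coeFn_toLp⟩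

end Family

section BaseDerivatives

lemma wirtinger_congr {F : Type*} [NormedAddCommGroup F] [NormedSpace ℂ F] {f g : F → ℂ} {x : F}
    (h : f =ᶠ[𝓝 x] g) (v : F) :
    wirtingerD f x v = wirtingerD g x v ∧ wirtingerDbar f x v = wirtingerDbar g x v := by
  simp only [wirtingerD, wirtingerDbar, h.fderiv_eq, and_self]

/-- Restriction of Wirtinger derivatives to the base. -/
lemma wirtinger_comp_base {E : Type*} [NormedAddCommGroup E] [NormedSpace ℂ E]
    {f : ℂ × E → ℂ} {t : ℂ} {ζ : E} (hf : DifferentiableAt ℝ f (t, ζ)) (v : ℂ) :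
    wirtingerD (fun s => f (s, ζ)) t v = wirtingerD f (t, ζ) (v, 0) ∧
    wirtingerDbar (fun s => f (s, ζ)) t v = wirtingerDbar f (t, ζ) (v, 0) := by
  have h1 : HasFDerivAt (fun s : ℂ => ((s, ζ) : ℂ × E)) (ContinuousLinearMap.inl ℝ ℂ E) t :=
    hasFDerivAt_prodMk_left t ζ
  have h2 := (hf.hasFDerivAt.comp t h1).fderiv
  change fderiv ℝ (fun s => f (s, ζ)) t = _ at h2
  have hI : I • ((v, 0) : ℂ × E) = (I • v, 0) := by simp
  simp only [wirtingerD, wirtingerDbar, h2, hI]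
  simp

lemma wirtinger_comp_base_two {E : Type*} [NormedAddCommGroup E] [NormedSpace ℂ E]
    {f : ℂ × E → ℂ} {W : Set (ℂ × E)} (hW : IsOpen W) (hf : ContDiffOn ℝ (⊤ : ℕ∞) f W)
    {t : ℂ} {ζ : E} (ht : (t, ζ) ∈ W) :
    wirtingerD (fun q => wirtingerDbar (fun s => f (s, ζ)) q 1) t 1 =
      wirtingerD (fun p => wirtingerDbar f p (1, 0)) (t, ζ) (1, 0) := by
  have hcont : Continuous fun s : ℂ => ((s, ζ) : ℂ × E) := by fun_prop
  have he : (fun q => wirtingerDbar (fun s => f (s, ζ)) q 1) =ᶠ[𝓝 t]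
      fun q => (fun p => wirtingerDbar f p (1, 0)) (q, ζ) := by
    filter_upwards [(hW.preimage hcont).mem_nhds ht] with q hq
    exact (wirtinger_comp_base (differentiableAt_of_contDiffOn hW hf hq) 1).2
  rw [(wirtinger_congr he 1).1]
  exact (wirtinger_comp_base (f := fun p => wirtingerDbar f p (1, 0))
    (differentiableAt_of_contDiffOn hW (contDiffOn_wirtingerDbar hW hf _) ht) 1).1

lemma wirtinger_exp_sub {f : ℂ → ℝ} {s : Set ℂ} {t : ℂ} (hs : IsOpen s)
    (hf : ContDiffOn ℝ (⊤ : ℕ∞) f s) (ht : t ∈ s) {g : ℂ → ℂ}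
    (hg : g =ᶠ[𝓝 t] fun q => (Real.exp (f t - f q) : ℂ)) :
    wirtingerD g t 1 = -wirtingerD (fun q => (f q : ℂ)) t 1 ∧
    wirtingerD (fun q => wirtingerDbar g q 1) t 1 =
      (‖wirtingerD (fun q => (f q : ℂ)) t 1‖ ^ 2 : ℂ) -
        wirtingerD (fun q => wirtingerDbar (fun q => (f q : ℂ)) q 1) t 1 := by
  have hexp : ∀ r : ℝ, HasDerivAt (fun r => Real.exp (f t - r)) (-Real.exp (f t - r)) r :=
    fun r => by
      have := ((hasDerivAt_id r).const_sub (f t)).exp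
      simpa using this
  have hd : ∀ q ∈ s, DifferentiableAt ℝ f q := fun q hq => differentiableAt_of_contDiffOn hs hf hq
  have hD : wirtingerD (fun q => (Real.exp (f t - f q) : ℂ)) t 1 =
      -wirtingerD (fun q => (f q : ℂ)) t 1 := by
    have := wirtingerD_comp_ofReal (hd t ht) (hexp (f t)) 1
    simpa using this
  refine ⟨by rw [(wirtinger_congr hg 1).1, hD], ?_⟩
  have he : (fun q => wirtingerDbar g q 1) =ᶠ[𝓝 t]
      fun q => (-Real.exp (f t - f q) : ℂ) * wirtingerDbar (fun q => (f q : ℂ)) q 1 := by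
    filter_upwards [hg.eventuallyEq_nhds, hs.mem_nhds ht] with q hq hqs
    rw [(wirtinger_congr hq 1).2, wirtingerDbar_comp_ofReal (hd q hqs) (hexp (f q)) 1]
    simp
  have hcf := contDiffOn_ofReal hf
  have d1 : DifferentiableAt ℝ (fun q => (Real.exp (f t - f q) : ℂ)) t :=
    Complex.ofRealCLM.differentiableAt.comp t
      (Real.differentiable_exp.differentiableAt.comp t ((hd t ht).const_sub (f t)))
  have d2 : DifferentiableAt ℝ (fun q => wirtingerDbar (fun q => (f q : ℂ)) q 1) t :=
    differentiableAt_of_contDiffOn hs (contDiffOn_wirtingerDbar hs hcf 1) ht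
  have hneg : wirtingerD (fun q => (-Real.exp (f t - f q) : ℂ)) t 1 =
      wirtingerD (fun q => (f q : ℂ)) t 1 := by
    have : wirtingerD (fun q => (-Real.exp (f t - f q) : ℂ)) t 1 =
        -wirtingerD (fun q => (Real.exp (f t - f q) : ℂ)) t 1 := by
      simp only [wirtingerD, fderiv_fun_neg, neg_apply]
      ring
    rw [this, hD, neg_neg]
  rw [(wirtinger_congr he 1).1, wirtingerD_mul (f := fun q => (-Real.exp (f t - f q) : ℂ))
    (g := fun q => wirtingerDbar (fun q => (f q : ℂ)) q 1) d1.neg d2, hneg,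
    wirtingerDbar_ofReal (hd t ht), Complex.mul_conj, Complex.normSq_eq_norm_sq]
  simp
  ring

end BaseDerivatives

section Variation

variable {n : ℕ} {V : Set (Cn n)} {W : Set (ℂ × Cn n)} {φ : ℂ × Cn n → ℝ} {t : ℂ} {U : Set ℂ}
  {z : Cn n} {K : ℂ → Cn n → ℂ}

lemma exists_kernel_family (hVo : IsOpen V) (hVbd : Bornology.IsBounded V) (hW : IsOpen W)
    (hφ : ContDiffOn ℝ (⊤ : ℕ∞) φ W) (hU : IsOpen U) (hUW : ∀ s ∈ U, {s} ×ˢ closure V ⊆ W)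
    (hK : ∀ s ∈ U, IsBergmanKernelAt V (fun ζ => φ (s, ζ)) z (K s)) (ht : t ∈ U)
    [IsFiniteMeasure (wm V fun ζ => φ (t, ζ))] :
    ∃ (G : ℂ × Cn n → ℝ) (hG : IsFamily fun p => (G p : ℂ)), (∀ p, 0 ≤ G p) ∧
      (∀ᶠ p in 𝓝ˢ ({t} ×ˢ closure V), G p = Real.exp (φ (t, p.2) - φ p)) ∧
      (∀ᵐ ζ ∂(wm V fun ζ => φ (t, ζ)), G (t, ζ) = 1) ∧
      (∀ᶠ s in 𝓝 t, toL2 V (fun ζ => φ (t, ζ)) (K s) ∈ bergmanSub V (fun ζ => φ (t, ζ)) ∧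
        ∀ h ∈ bergmanSub V (fun ζ => φ (t, ζ)),
          inner ℂ (toL2 V (fun ζ => φ (t, ζ)) (K s)) (mulOp _ (hG.slice s) h) =
            inner ℂ (toL2 V (fun ζ => φ (t, ζ)) (K t)) h) ∧
      ∀ᶠ s in 𝓝 t, K s z = inner ℂ (toL2 V (fun ζ => φ (t, ζ)) (K t))
        (toL2 V (fun ζ => φ (t, ζ)) (K s)) := by
  obtain ⟨G, hG, hG0, hG1⟩ := exists_isFamily hVbd hW hφ (hUW t ht)
  have hw : ∀ s ∈ U, IsWeight V fun ζ => φ (s, ζ) := fun s hs =>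
    isWeight_fiber hVo hVbd hφ (hUW s hs)
  have hG2 := eventually_fiber_of_nhdsSet hVbd hG1
  have h1 : ∀ᵐ ζ ∂(wm V fun ζ => φ (t, ζ)), G (t, ζ) = 1 := by
    rw [(hw t ht).ae_wm_iff, ae_restrict_iff' hVo.measurableSet]
    exact Eventually.of_forall fun ζ hζ => by simpa using hG2.self_of_nhds ζ hζ
  have hone : ∀ h, mulOp (wm V fun ζ => φ (t, ζ)) (hG.slice t) h = h := fun h => by
    rw [mulOp_eq_one (h1.mono fun ζ hζ => by simp [hζ])]; rfl
  have hrep : ∀ s ∈ U, (∀ ζ ∈ V, G (s, ζ) = Real.exp (φ (t, ζ) - φ (s, ζ))) →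
      ∀ {x : Lp ℂ 2 (wm V fun ζ => φ (t, ζ))} {u : Cn n → ℂ}, DifferentiableOn ℂ u V →
      x =ᵐ[wm V fun ζ => φ (t, ζ)] u →
      inner ℂ (toL2 V (fun ζ => φ (t, ζ)) (K s)) (mulOp _ (hG.slice s) x) = u z := by
    intro s hs hGs x u hu hxu
    refine (hw t ht).inner_toL2_kernel (hw s hs) (hK s hs) (fun ζ hζ => ?_) hu hxu
    rw [IsFamily.slice_apply, hGs ζ hζ]
  have hrept : ∀ {x : Lp ℂ 2 (wm V fun ζ => φ (t, ζ))} {u : Cn n → ℂ}, DifferentiableOn ℂ u V →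
      x =ᵐ[wm V fun ζ => φ (t, ζ)] u →
      inner ℂ (toL2 V (fun ζ => φ (t, ζ)) (K t)) x = u z := by
    intro x u hu hxu
    rw [← hrep t ht hG2.self_of_nhds hu hxu, hone]
  refine ⟨G, hG, hG0, hG1, h1, ?_, ?_⟩
  · filter_upwards [hG2, hU.mem_nhds ht] with s hGs hs
    refine ⟨(hw t ht).toL2_kernel_mem (hw s hs) (hK s hs), fun h hh => ?_⟩
    obtain ⟨u, hu, hhu⟩ := ((hw t ht).mem_bergmanSub_iff h).1 hh
    rw [hrep s hs hGs hu hhu, hrept hu hhu]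
  · filter_upwards [hU.mem_nhds ht] with s hs
    have hm := (hw t ht).memLp_kernel (hw s hs) (hK s hs)
    refine (hrept (hK s hs).1.1 ?_).symm
    rw [toL2_of_memLp hm]
    exact hm.coeFn_toLp

theorem contDiffAt_bergmanKernel (hVo : IsOpen V) (hVbd : Bornology.IsBounded V) (hW : IsOpen W)
    (hφ : ContDiffOn ℝ (⊤ : ℕ∞) φ W) (hU : IsOpen U) (hUW : ∀ s ∈ U, {s} ×ˢ closure V ⊆ W)
    (hK : ∀ s ∈ U, IsBergmanKernelAt V (fun ζ => φ (s, ζ)) z (K s)) (ht : t ∈ U) :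
    ContDiffAt ℝ (⊤ : ℕ∞) (fun s => (K s z).re) t := by
  have hw := isWeight_fiber hVo hVbd hφ (hUW t ht)
  have := hw.isFiniteMeasure_wm
  obtain ⟨G, hG, -, -, h1, hk, hKz⟩ := exists_kernel_family hVo hVbd hW hφ hU hUW hK ht
  exact (hG.contDiffAt_kernel _ h1 hk.self_of_nhds.1 hk).congr_of_eventuallyEq
    (hKz.mono fun s hs => by simp only [hs])

lemma norm_toLp_sq {μ : Measure (Cn n)} {f : Cn n → ℂ}
    (hf : MemLp f 2 μ) : ((‖hf.toLp f‖ ^ 2 : ℝ) : ℂ) = ∫ x, ((‖f x‖ ^ 2 : ℝ) : ℂ) ∂μ := by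
  have h := inner_toLp hf hf
  rw [inner_self_eq_norm_sq_to_K] at h
  push_cast
  refine h.trans (integral_congr_ae (Eventually.of_forall fun x => ?_))
  simp only
  rw [← Complex.normSq_eq_conj_mul_self, Complex.normSq_eq_norm_sq, Complex.ofReal_pow]

set_option maxHeartbeats 800000 in
theorem levi_bergmanKernel_ge (hVo : IsOpen V) (hVbd : Bornology.IsBounded V) (hW : IsOpen W)
    (hφ : ContDiffOn ℝ (⊤ : ℕ∞) φ W) (hU : IsOpen U) (hUW : ∀ s ∈ U, {s} ×ˢ closure V ⊆ W)
    (hK : ∀ s ∈ U, IsBergmanKernelAt V (fun ζ => φ (s, ζ)) z (K s)) (ht : t ∈ U)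
    (hg : MemLp (fun ζ => -wirtingerD (fun p => (φ p : ℂ)) (t, ζ) (dirT n) * K t ζ) 2
      (wm V fun ζ => φ (t, ζ))) :
    (∫ ζ in V, (hessTTbar n φ (t, ζ)).re * ‖K t ζ‖ ^ 2 * Real.exp (-φ (t, ζ))) -
        ‖hg.toLp _ - (bergmanSub V fun ζ => φ (t, ζ)).starProjection (hg.toLp _)‖ ^ 2 ≤
      (1 / 4) * (iteratedFDeriv ℝ 2 (fun s => (K s z).re) t ![1, 1] +
        iteratedFDeriv ℝ 2 (fun s => (K s z).re) t ![I, I]) := by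
  have hw := isWeight_fiber hVo hVbd hφ (hUW t ht)
  have := hw.isFiniteMeasure_wm
  obtain ⟨G, hG, hG0, hG1, h1, hk, hKz⟩ := exists_kernel_family hVo hVbd hW hφ hU hUW hK ht
  have hkm := hw.memLp_kernel hw (hK t ht)
  have main := hG.levi_kernel_ge _ hG0 h1 hk.self_of_nhds.1 hk
  have hev : (fun s => (K s z).re) =ᶠ[𝓝 t] fun s =>
      (inner ℂ (toL2 V (fun ζ => φ (t, ζ)) (K t)) (toL2 V (fun ζ => φ (t, ζ)) (K s))).re :=
    hKz.mono fun s hs => by simp only [hs]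
  rw [(hev.iteratedFDeriv ℝ 2).self_of_nhds]
  refine le_trans (le_of_eq ?_) main
  rw [toL2_of_memLp hkm]
  have hder : ∀ ζ ∈ V,
      wirtingerD (fun p => (G p : ℂ)) (t, ζ) (1, 0) =
        -wirtingerD (fun p => (φ p : ℂ)) (t, ζ) (dirT n) ∧
      wirtingerD (fun p => wirtingerDbar (fun p => (G p : ℂ)) p (1, 0)) (t, ζ) (1, 0) =
        (‖wirtingerD (fun p => (φ p : ℂ)) (t, ζ) (dirT n)‖ ^ 2 : ℂ) - hessTTbar n φ (t, ζ) := by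
    intro ζ hζ
    have hp : (t, ζ) ∈ W := hUW t ht ⟨rfl, subset_closure hζ⟩
    have hcont : Continuous fun s : ℂ => ((s, ζ) : ℂ × Cn n) := by fun_prop
    have hev : (fun s => (G (s, ζ) : ℂ)) =ᶠ[𝓝 t]
        fun s => (Real.exp (φ (t, ζ) - φ (s, ζ)) : ℂ) := by
      have h2 : ∀ᶠ p in 𝓝 ((t, ζ) : ℂ × Cn n), G p = Real.exp (φ (t, p.2) - φ p) :=
        hG1.filter_mono
        (nhds_le_nhdsSet (show ((t, ζ) : ℂ × Cn n) ∈ {t} ×ˢ closure V from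
          ⟨rfl, subset_closure hζ⟩))
      filter_upwards [hcont.continuousAt.eventually h2] with s hs
      rw [hs]
    have hfs : ContDiffOn ℝ (⊤ : ℕ∞) (fun s => φ (s, ζ))
        ((fun s : ℂ => ((s, ζ) : ℂ × Cn n)) ⁻¹' W) :=
      hφ.comp (contDiff_prodMk_left ζ).contDiffOn fun s hs => hs
    obtain ⟨e1, e2⟩ := wirtinger_exp_sub (hW.preimage hcont) hfs hp hev
    have hcφ := contDiffOn_ofReal hφ
    rw [(wirtinger_comp_base (f := fun p => (G p : ℂ))
      (hG.smooth.differentiable (by simp) _) 1).1,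
      (wirtinger_comp_base (f := fun p => (φ p : ℂ))
        (differentiableAt_of_contDiffOn hW hcφ hp) 1).1] at e1
    rw [wirtinger_comp_base_two (f := fun p => (G p : ℂ)) isOpen_univ hG.smooth.contDiffOn
        (mem_univ _),
      (wirtinger_comp_base (f := fun p => (φ p : ℂ))
        (differentiableAt_of_contDiffOn hW hcφ hp) 1).1,
      wirtinger_comp_base_two (f := fun p => (φ p : ℂ)) hW hcφ hp] at e2
    exact ⟨e1, e2⟩
  have hderae : ∀ᵐ ζ ∂(wm V fun ζ => φ (t, ζ)), ζ ∈ V := by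
    rw [hw.ae_wm_iff]
    exact ae_restrict_mem hVo.measurableSet
  have hb : mulOp (wm V fun ζ => φ (t, ζ)) ((hG.wirtingerD (1, 0)).slice t) (hkm.toLp _) =
      hg.toLp _ := by
    refine Lp.ext ?_
    filter_upwards [coeFn_mulOp ((hG.wirtingerD (1, 0)).slice t) (hkm.toLp _), hkm.coeFn_toLp,
      hg.coeFn_toLp, hderae] with ζ h2 h3 h4 h5
    rw [h2, h3, h4, IsFamily.slice_apply, (hder ζ h5).1]
  rw [hb]
  set P := (bergmanSub V fun ζ => φ (t, ζ)).starProjection (hg.toLp _) with hP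
  have hpyth : ‖hg.toLp _ - P‖ ^ 2 = ‖hg.toLp _‖ ^ 2 - ‖P‖ ^ 2 := by
    have h6 : inner ℂ P (hg.toLp _ - P) = 0 := by
      rw [← inner_conj_symm, Submodule.starProjection_inner_eq_zero _ _
        (Submodule.starProjection_apply_mem _ _), map_zero]
    have h7 := norm_add_sq_eq_norm_sq_add_norm_sq_of_inner_eq_zero P (hg.toLp _ - P) h6
    rw [add_sub_cancel] at h7
    linarith
  set T := mulOp (wm V fun ζ => φ (t, ζ))
    (((hG.wirtingerDbar (1, 0)).wirtingerD (1, 0)).slice t) (hkm.toLp _) with hT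
  have hin : inner ℂ (hkm.toLp _) T = ((‖hg.toLp _‖ ^ 2 : ℝ) : ℂ) -
      ∫ ζ, hessTTbar n φ (t, ζ) * ((‖K t ζ‖ ^ 2 : ℝ) : ℂ) ∂(wm V fun ζ => φ (t, ζ)) := by
    have i1 : Integrable (fun ζ => inner ℂ (hkm.toLp (K t) ζ) (T ζ))
        (wm V fun ζ => φ (t, ζ)) := L2.integrable_inner _ _
    have i2 : Integrable (fun ζ =>
        ((‖-wirtingerD (fun p => (φ p : ℂ)) (t, ζ) (dirT n) * K t ζ‖ ^ 2 : ℝ) : ℂ))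
        (wm V fun ζ => φ (t, ζ)) := (integrable_norm_sq hg).ofReal
    rw [L2.inner_def, norm_toLp_sq, eq_sub_iff_add_eq, ← eq_sub_iff_add_eq',
      ← integral_sub i2 i1]
    refine integral_congr_ae ?_
    filter_upwards [coeFn_mulOp (((hG.wirtingerDbar (1, 0)).wirtingerD (1, 0)).slice t)
      (hkm.toLp _), hkm.coeFn_toLp, hderae] with ζ h2 h3 h5
    rw [hT, h2, h3, IsFamily.slice_apply, (hder ζ h5).2, norm_mul, norm_neg]
    have h6 : inner ℂ (K t ζ) (((‖wirtingerD (fun p => (φ p : ℂ)) (t, ζ) (dirT n)‖ ^ 2 : ℂ) -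
        hessTTbar n φ (t, ζ)) * K t ζ) =
        ((‖wirtingerD (fun p => (φ p : ℂ)) (t, ζ) (dirT n)‖ ^ 2 : ℂ) -
          hessTTbar n φ (t, ζ)) * ((‖K t ζ‖ ^ 2 : ℝ) : ℂ) := by
      rw [← Complex.normSq_eq_norm_sq, Complex.normSq_eq_conj_mul_self]
      simp only [RCLike.inner_apply]
      ring
    rw [h6]
    push_cast
    ring
  have hre : (∫ ζ, hessTTbar n φ (t, ζ) * ((‖K t ζ‖ ^ 2 : ℝ) : ℂ)
      ∂(wm V fun ζ => φ (t, ζ))).re =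
      ∫ ζ in V, (hessTTbar n φ (t, ζ)).re * ‖K t ζ‖ ^ 2 * Real.exp (-φ (t, ζ)) := by
    rw [hw.integral_wm, ← Complex.ofReal_re (∫ ζ in V, _), ← integral_complex_ofReal]
    congr 1
    refine setIntegral_congr_fun hVo.measurableSet fun ζ hζ => ?_
    have hp : (t, ζ) ∈ W := hUW t ht ⟨rfl, subset_closure hζ⟩
    have : ((hessTTbar n φ (t, ζ)).re : ℂ) = hessTTbar n φ (t, ζ) := by
      rw [← Complex.conj_eq_iff_re, hessTTbar_eq hW hφ hp,
        leviForm_conj (contDiffAt_two_of_contDiffOn hW hφ hp)]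
    push_cast
    rw [this]
  rw [hin, Complex.sub_re, hre, Complex.ofReal_re, hpyth]
  ring

end Variation

section HessianBound

variable {n : ℕ} {V : Set (Cn n)} {W : Set (ℂ × Cn n)} {φ : ℂ × Cn n → ℝ} {t : ℂ} {U : Set ℂ}
  {z : Cn n} {K : ℂ → Cn n → ℂ}

lemma continuousOn_hessTTbar (hW : IsOpen W) (hφ : ContDiffOn ℝ (⊤ : ℕ∞) φ W) :
    ContinuousOn (hessTTbar n φ) W :=
  (contDiffOn_wirtingerD hW (contDiffOn_wirtingerDbar hW (contDiffOn_ofReal hφ) _) _).continuousOn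

lemma continuousOn_hessTZbar (hW : IsOpen W) (hφ : ContDiffOn ℝ (⊤ : ℕ∞) φ W) (k : Fin n) :
    ContinuousOn (hessTZbar n φ k) W :=
  (contDiffOn_wirtingerD hW (contDiffOn_wirtingerDbar hW (contDiffOn_ofReal hφ) _) _).continuousOn

lemma continuousOn_hessZZbar (hW : IsOpen W) (hφ : ContDiffOn ℝ (⊤ : ℕ∞) φ W) :
    ContinuousOn (hessZZbar n φ) W :=
  continuousOn_pi.2 fun _ => continuousOn_pi.2 fun _ =>
    (contDiffOn_wirtingerD hW (contDiffOn_wirtingerDbar hW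
      (contDiffOn_ofReal hφ) _) _).continuousOn

lemma continuousOn_bigD (hW : IsOpen W) (hφ : ContDiffOn ℝ (⊤ : ℕ∞) φ W)
    (hsp : StrictPlurisubharmonicOn φ W) : ContinuousOn (bigD n φ) W := by
  have hinv : ContinuousOn (fun p => (hessZZbar n φ p)⁻¹) W := fun p hp => by
    have hu := isUnit_det_hessZZbar hW hφ hsp hp
    have h1 : ContinuousAt Inv.inv (hessZZbar n φ p) := continuousAt_matrix_inv _ (by
      rw [Ring.inverse_eq_inv']
      exact continuousAt_inv₀ hu.ne_zero)
    exact h1.comp_continuousWithinAt (continuousOn_hessZZbar hW hφ p hp)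
  have hjk : ∀ j k, ContinuousOn (fun p => (hessZZbar n φ p)⁻¹ j k) W := fun j k =>
    continuousOn_pi.1 (continuousOn_pi.1 hinv j) k
  exact (continuousOn_hessTTbar hW hφ).sub <| continuousOn_finsetSum _ fun j _ =>
    continuousOn_finsetSum _ fun k _ => ((hjk j k).mul (continuousOn_hessTZbar hW hφ j)).mul
      (Complex.continuous_conj.comp_continuousOn (continuousOn_hessTZbar hW hφ k))

lemma continuousOn_fiber {G : Type*} [TopologicalSpace G] {f : ℂ × Cn n → G}
    (hf : ContinuousOn f W) (htW : {t} ×ˢ closure V ⊆ W) :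
    ContinuousOn (fun ζ => f (t, ζ)) (closure V) :=
  hf.comp (by fun_prop) fun _ hζ => htW ⟨rfl, hζ⟩

lemma exists_bound_fiber {G : Type*} [NormedAddCommGroup G] {f : ℂ × Cn n → G}
    (hVbd : Bornology.IsBounded V) (hf : ContinuousOn f W) (htW : {t} ×ˢ closure V ⊆ W) :
    ∃ C, ∀ ζ ∈ V, ‖f (t, ζ)‖ ≤ C := by
  obtain ⟨C, hC⟩ := hVbd.isCompact_closure.exists_bound_of_continuousOn
    (continuousOn_fiber hf htW)
  exact ⟨C, fun ζ hζ => hC ζ (subset_closure hζ)⟩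

lemma memLp_fiber_mul {f : ℂ × Cn n → ℂ} {u : Cn n → ℂ} (hVo : IsOpen V)
    (hVbd : Bornology.IsBounded V) (hf : ContinuousOn f W) (htW : {t} ×ˢ closure V ⊆ W)
    (hu : MemLp u 2 (volume.restrict V)) :
    MemLp (fun ζ => f (t, ζ) * u ζ) 2 (volume.restrict V) := by
  obtain ⟨C, hC⟩ := exists_bound_fiber hVbd hf htW
  refine hu.of_le_mul (c := C) ?_ ?_
  · exact (((continuousOn_fiber hf htW).mono subset_closure).aestronglyMeasurable
      hVo.measurableSet).mul hu.aestronglyMeasurable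
  · filter_upwards [ae_restrict_mem hVo.measurableSet] with ζ hζ
    rw [norm_mul]
    exact mul_le_mul_of_nonneg_right (hC ζ hζ) (norm_nonneg _)

lemma integrableOn_fiber_mul {f : ℂ × Cn n → ℝ} {u : Cn n → ℂ} (hVo : IsOpen V)
    (hVbd : Bornology.IsBounded V) (hf : ContinuousOn f W) (htW : {t} ×ˢ closure V ⊆ W)
    (hu : MemLp u 2 (volume.restrict V)) :
    IntegrableOn (fun ζ => f (t, ζ) * ‖u ζ‖ ^ 2) V := by
  obtain ⟨C, hC⟩ := exists_bound_fiber hVbd hf htW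
  refine (integrable_norm_sq hu).bdd_mul (c := C)
    (((continuousOn_fiber hf htW).mono subset_closure).aestronglyMeasurable hVo.measurableSet) ?_
  filter_upwards [ae_restrict_mem hVo.measurableSet] with ζ hζ using hC ζ hζ

lemma dzb_neg_wirtingerD_mul (hW : IsOpen W) (hφ : ContDiffOn ℝ (⊤ : ℕ∞) φ W) {u : Cn n → ℂ}
    {ζ : Cn n} (hp : (t, ζ) ∈ W) (hu : DifferentiableAt ℂ u ζ) (k : Fin n) :
    dzb k (fun y => -wirtingerD (fun p => (φ p : ℂ)) (t, y) (dirT n) * u y) ζ =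
      -u ζ * hessTZbar n φ k (t, ζ) := by
  have hφc := contDiffOn_ofReal hφ
  have h1 : DifferentiableAt ℝ (fun q => wirtingerD (fun p => (φ p : ℂ)) q (dirT n)) (t, ζ) :=
    differentiableAt_of_contDiffOn hW (contDiffOn_wirtingerD hW hφc _) hp
  have h2 : DifferentiableAt ℝ (fun y => wirtingerD (fun p => (φ p : ℂ)) (t, y) (dirT n)) ζ :=
    DifferentiableAt.comp (g := fun q => wirtingerD (fun p => (φ p : ℂ)) q (dirT n)) ζ h1
      (by fun_prop)
  have h3 := (wirtinger_comp_fiber h1 (EuclideanSpace.single k (1 : ℂ))).2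
  have h4 := wirtingerDbar_wirtingerD (differentiableAt_fderiv_ofReal hW hφ hp)
    ((hφc.contDiffAt (hW.mem_nhds hp)).isSymmSndFDerivAt (by simpa using two_le_top))
    (dirT n) (dirZ n k)
  have h5 : dzb k (fun y => wirtingerD (fun p => (φ p : ℂ)) (t, y) (dirT n)) ζ =
      hessTZbar n φ k (t, ζ) := by
    rw [hessTZbar_eq hW hφ hp, ← h4]
    exact h3
  have hneg : dzb k (fun y => -wirtingerD (fun p => (φ p : ℂ)) (t, y) (dirT n)) ζ =
      -dzb k (fun y => wirtingerD (fun p => (φ p : ℂ)) (t, y) (dirT n)) ζ := by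
    simp only [dzb, wirtingerDbar, fderiv_fun_neg, neg_apply]
    ring
  have h6 := wirtingerDbar_mul h2.neg (hu.restrictScalars ℝ) (EuclideanSpace.single k (1 : ℂ))
  have h7 := dzb_eq_zero_of_differentiableAt hu k
  change dzb k _ ζ = dzb k _ ζ * _ + _ * dzb k _ ζ at h6
  rw [h7, mul_zero, add_zero] at h6
  refine h6.trans ?_
  rw [show dzb k (-fun y => wirtingerD (fun p => (φ p : ℂ)) (t, y) (dirT n)) ζ = _ from hneg, h5]
  ring

set_option maxHeartbeats 800000 in
theorem integral_bigD_le {ρ : Cn n → ℝ} {W₀ : Set (Cn n)} (hW₀ : IsOpen W₀)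
    (hVW₀ : closure V ⊆ W₀) (hρ : ContDiffOn ℝ (⊤ : ℕ∞) ρ W₀)
    (hρsp : StrictPlurisubharmonicOn ρ W₀) (hV : V = {ζ | ρ ζ < 0})
    (hVbd : Bornology.IsBounded V) (hW : IsOpen W)
    (hφ : ContDiffOn ℝ (⊤ : ℕ∞) φ W) (hsp : StrictPlurisubharmonicOn φ W)
    (hU : IsOpen U) (hUW : ∀ s ∈ U, {s} ×ˢ closure V ⊆ W)
    (hK : ∀ s ∈ U, IsBergmanKernelAt V (fun ζ => φ (s, ζ)) z (K s)) (ht : t ∈ U) :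
    (∫ ζ in V, ‖K t ζ‖ ^ 2 * (bigD n φ (t, ζ)).re * Real.exp (-φ (t, ζ))) ≤
      (1 / 4) * (iteratedFDeriv ℝ 2 (fun s => (K s z).re) t ![1, 1] +
        iteratedFDeriv ℝ 2 (fun s => (K s z).re) t ![I, I]) := by
  have hex := isExhaustion_of_defining hW₀ hVW₀ hρ hV hVbd
  have hVo := hex.isOpen
  obtain ⟨M, hM⟩ := exists_bound_grad hW₀ hVW₀ hρ hVbd
  obtain ⟨c, hc, hlev⟩ := hρsp.exists_lower_bound hW₀ hρ hVbd.isCompact_closure hVW₀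
  have htW := hUW t ht
  have hpW : ∀ ζ ∈ V, (t, ζ) ∈ W := fun ζ hζ => htW ⟨rfl, subset_closure hζ⟩
  have hw := isWeight_fiber hVo hVbd hφ htW
  have hφc := contDiffOn_ofReal hφ
  have hud := (hK t ht).1.1
  have hum : MemLp (K t) 2 (volume.restrict V) := hw.memLp_wm_iff.1 (hw.memLp_kernel hw (hK t ht))
  have hdW := contDiffOn_wirtingerD hW hφc (dirT n)
  have hgs : ContDiffOn ℝ (⊤ : ℕ∞)
      (fun ζ => -wirtingerD (fun p => (φ p : ℂ)) (t, ζ) (dirT n) * K t ζ) V :=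
    (hdW.comp (contDiff_prodMk_right t).contDiffOn hpW).neg.mul
      (contDiffOn_of_differentiableOn hVo hud)
  have hg : MemLp (fun ζ => -wirtingerD (fun p => (φ p : ℂ)) (t, ζ) (dirT n) * K t ζ) 2
      (wm V fun ζ => φ (t, ζ)) :=
    hw.memLp_wm_iff.2 (memLp_fiber_mul hVo hVbd hdW.continuousOn.neg htW hum)
  have hdz : ∀ ζ ∈ V, ∀ k,
      dzb k (fun y => -wirtingerD (fun p => (φ p : ℂ)) (t, y) (dirT n) * K t y) ζ =
        -K t ζ * hessTZbar n φ k (t, ζ) := fun ζ hζ k =>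
    dzb_neg_wirtingerD_mul hW hφ (hpW ζ hζ) ((hud ζ hζ).differentiableAt (hVo.mem_nhds hζ)) k
  have hfm : ∀ k, MemLp
      (dzb k (fun y => -wirtingerD (fun p => (φ p : ℂ)) (t, y) (dirT n) * K t y)) 2
      (volume.restrict V) := fun k => by
    refine (memLp_congr_ae ?_).1
      (memLp_fiber_mul hVo hVbd (continuousOn_hessTZbar hW hφ k) htW hum).neg
    filter_upwards [ae_restrict_mem hVo.measurableSet] with ζ hζ
    rw [hdz ζ hζ k, Pi.neg_apply]
    ring
  have hexp : ContinuousOn (fun p => Real.exp (-φ p)) W :=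
    Real.continuous_exp.comp_continuousOn hφ.continuousOn.neg
  have hT : ContinuousOn (fun p => (hessTTbar n φ p).re * Real.exp (-φ p)) W :=
    (Complex.continuous_re.comp_continuousOn (continuousOn_hessTTbar hW hφ)).mul hexp
  have hB : ContinuousOn (fun p => (bigD n φ p).re * Real.exp (-φ p)) W :=
    (Complex.continuous_re.comp_continuousOn (continuousOn_bigD hW hφ hsp)).mul hexp
  have iT := integrableOn_fiber_mul hVo hVbd hT htW hum
  have iB := integrableOn_fiber_mul hVo hVbd hB htW hum
  have eF : ∀ ζ, ‖K t ζ‖ ^ 2 * ((hessTTbar n φ (t, ζ)).re - (bigD n φ (t, ζ)).re) *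
      Real.exp (-φ (t, ζ)) = (hessTTbar n φ (t, ζ)).re * Real.exp (-φ (t, ζ)) * ‖K t ζ‖ ^ 2 -
      (bigD n φ (t, ζ)).re * Real.exp (-φ (t, ζ)) * ‖K t ζ‖ ^ 2 := fun ζ => by ring
  have hor := hw.norm_sub_starProjection_sq_le hex hM hc
    (fun x hx => hlev x (subset_closure hx)) hgs hg hfm
    (F := fun ζ => ‖K t ζ‖ ^ 2 * ((hessTTbar n φ (t, ζ)).re - (bigD n φ (t, ζ)).re))
    (fun ζ hζ => mul_nonneg (sq_nonneg _) (sub_nonneg.2 (bigD_re_le hW hφ hsp (hpW ζ hζ))))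
    (by
      simp only [eF]
      exact iT.sub iB)
    (fun ζ hζ a => by
      have h := two_re_sum_hessTZbar_le hW hφ hsp (hpW ζ hζ) (-K t ζ) a
      rw [norm_neg] at h
      simp only [hdz ζ hζ, leviCoeff_fiber hW hφ (hpW ζ hζ)]
      exact h)
  simp only [eF] at hor
  rw [integral_sub iT iB] at hor
  have hk := levi_bergmanKernel_ge hVo hVbd hW hφ hU hUW hK ht hg
  have e1 : (∫ ζ in V, (hessTTbar n φ (t, ζ)).re * ‖K t ζ‖ ^ 2 * Real.exp (-φ (t, ζ))) =
      ∫ ζ in V, (hessTTbar n φ (t, ζ)).re * Real.exp (-φ (t, ζ)) * ‖K t ζ‖ ^ 2 := by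
    congr 1; ext ζ; ring
  have e2 : (∫ ζ in V, ‖K t ζ‖ ^ 2 * (bigD n φ (t, ζ)).re * Real.exp (-φ (t, ζ))) =
      ∫ ζ in V, (bigD n φ (t, ζ)).re * Real.exp (-φ (t, ζ)) * ‖K t ζ‖ ^ 2 := by
    congr 1; ext ζ; ring
  rw [e1] at hk
  rw [e2]
  linarith

end HessianBound

section Subharmonic

variable {U : Set ℂ} {k : ℂ → ℝ} {z w : ℂ}

/-- The exponential polar coordinates around a point. -/
def polarExp (w : ℂ) (p : ℝ × ℝ) : ℂ := Complex.exp (p.1 + p.2 * I) * w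

lemma hasFDerivAt_polarExp (w : ℂ) (p : ℝ × ℝ) :
    HasFDerivAt (polarExp w)
      (polarExp w p • (Complex.ofRealCLM.comp (ContinuousLinearMap.fst ℝ ℝ ℝ) +
        I • Complex.ofRealCLM.comp (ContinuousLinearMap.snd ℝ ℝ ℝ))) p := by
  have h1 : HasFDerivAt (fun p : ℝ × ℝ => (p.1 : ℂ) + p.2 * I)
      (Complex.ofRealCLM.comp (ContinuousLinearMap.fst ℝ ℝ ℝ) +
        I • Complex.ofRealCLM.comp (ContinuousLinearMap.snd ℝ ℝ ℝ)) p :=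
    ((Complex.ofRealCLM.hasFDerivAt.comp p hasFDerivAt_fst).add
      ((Complex.ofRealCLM.hasFDerivAt.comp p hasFDerivAt_snd).mul_const I))
  have h2 := h1.cexp.mul_const w
  refine h2.congr_fderiv ?_
  ext <;> simp [polarExp] <;> ring

lemma contDiff_polarExp (w : ℂ) : ContDiff ℝ (⊤ : ℕ∞) (polarExp w) := by
  have h : ContDiff ℝ (⊤ : ℕ∞) fun p : ℝ × ℝ => (p.1 : ℂ) + p.2 * I :=
    (Complex.ofRealCLM.contDiff.comp contDiff_fst).add
      ((Complex.ofRealCLM.contDiff.comp contDiff_snd).mul contDiff_const)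
  exact h.cexp.mul contDiff_const

lemma norm_polarExp (w : ℂ) (p : ℝ × ℝ) : ‖polarExp w p‖ = Real.exp p.1 * ‖w‖ := by
  simp [polarExp, Complex.norm_exp]

lemma polarExp_two_pi (w : ℂ) (x : ℝ) : polarExp w (x, 2 * Real.pi) = polarExp w (x, 0) := by
  simp [polarExp, Complex.exp_add]

lemma fderiv_fderiv_rotate {B : ℂ →L[ℝ] ℂ →L[ℝ] ℝ} (e : ℂ) :
    B e e + B (I * e) (I * e) = ‖e‖ ^ 2 * (B 1 1 + B I I) := by
  have h1 : e = e.re • (1 : ℂ) + e.im • I := by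
    simp [Complex.re_add_im]
  have h2 : I * e = (-e.im) • (1 : ℂ) + e.re • I := by
    apply Complex.ext <;> simp
  rw [h2]
  nth_rewrite 1 2 [h1]
  simp only [map_add, map_smul, add_apply, smul_apply,
    smul_eq_mul, ← Complex.normSq_eq_norm_sq, Complex.normSq_apply]
  ring

/-- The Green potential of the Laplacian in exponential polar coordinates. -/
lemma polar_green (hU : IsOpen U) (hk : ContDiffOn ℝ (⊤ : ℕ∞) k U)
    (hlap : ∀ t ∈ U, 0 ≤ fderiv ℝ (fderiv ℝ k) t 1 1 + fderiv ℝ (fderiv ℝ k) t I I)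
    {a X : ℝ} (haX : a ≤ X) (hin : ∀ p : ℝ × ℝ, p.1 ≤ X → z + polarExp w p ∈ U) :
    ∫ θ in (0 : ℝ)..(2 * Real.pi), ((X - a) * fderiv ℝ k (z + polarExp w (a, θ))
        (polarExp w (a, θ)) + k (z + polarExp w (a, θ))) ≤
      ∫ θ in (0 : ℝ)..(2 * Real.pi), k (z + polarExp w (X, θ)) := by
  set e := polarExp w with he
  have hec : ContDiff ℝ (⊤ : ℕ∞) fun p => z + e p := contDiff_const.add (contDiff_polarExp w)
  set Ω : Set (ℝ × ℝ) := (fun p => z + e p) ⁻¹' U with hΩ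
  have hΩo : IsOpen Ω := hU.preimage hec.continuous
  have hDk := hk.fderiv_of_isOpen (m := (⊤ : ℕ∞)) hU le_rfl
  have hDke : ContDiffOn ℝ (⊤ : ℕ∞) (fun p => fderiv ℝ k (z + e p)) Ω :=
    hDk.comp hec.contDiffOn fun p hp => hp
  have hXp : ContDiff ℝ (⊤ : ℕ∞) fun p : ℝ × ℝ => X - p.1 := contDiff_const.sub contDiff_fst
  set f : ℝ × ℝ → ℝ := fun p => (X - p.1) * fderiv ℝ k (z + e p) (e p) + k (z + e p) with hf
  set g : ℝ × ℝ → ℝ := fun p => (X - p.1) * fderiv ℝ k (z + e p) (I * e p) with hg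
  have hfs : ContDiffOn ℝ (⊤ : ℕ∞) f Ω :=
    (hXp.contDiffOn.mul (hDke.clm_apply (contDiff_polarExp w).contDiffOn)).add
      (hk.comp hec.contDiffOn fun p hp => hp)
  have hgs : ContDiffOn ℝ (⊤ : ℕ∞) g Ω :=
    hXp.contDiffOn.mul (hDke.clm_apply (contDiff_const.mul (contDiff_polarExp w)).contDiffOn)
  have hsub : uIcc a X ×ˢ uIcc (0 : ℝ) (2 * Real.pi) ⊆ Ω := fun p hp =>
    hin p (by
      have h := hp.1
      rw [uIcc_of_le haX] at h
      exact h.2)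
  have hsub' : Ioo (min a X) (max a X) ×ˢ Ioo (min 0 (2 * Real.pi)) (max 0 (2 * Real.pi)) \ ∅ ⊆
      Ω := fun p hp => hsub ⟨Ioo_subset_Icc_self hp.1.1, Ioo_subset_Icc_self hp.1.2⟩
  have hdiv : ∀ p ∈ Ω, fderiv ℝ f p (1, 0) + fderiv ℝ g p (0, 1) = (X - p.1) *
      (fderiv ℝ (fderiv ℝ k) (z + e p) (e p) (e p) +
        fderiv ℝ (fderiv ℝ k) (z + e p) (I * e p) (I * e p)) := by
    intro p hp
    have h1 : HasFDerivAt (fun p => z + e p) _ p := (hasFDerivAt_polarExp w p).const_add z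
    have h2 : HasFDerivAt (fun p => fderiv ℝ k (z + e p)) _ p :=
      (differentiableAt_of_contDiffOn hU hDk hp).hasFDerivAt.comp p h1
    have h3 : HasFDerivAt (fun p => k (z + e p)) _ p :=
      (differentiableAt_of_contDiffOn hU hk hp).hasFDerivAt.comp p h1
    have h4 : HasFDerivAt (fun p : ℝ × ℝ => X - p.1) (-ContinuousLinearMap.fst ℝ ℝ ℝ) p :=
      (hasFDerivAt_fst (𝕜 := ℝ)).const_sub X
    have h5 : HasFDerivAt f _ p :=
      (h4.mul (h2.clm_apply (hasFDerivAt_polarExp w p))).add h3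
    have h6 : HasFDerivAt g _ p :=
      h4.mul (h2.clm_apply ((hasFDerivAt_polarExp w p).const_mul I))
    rw [h5.fderiv, h6.fderiv]
    simp [← he, mul_comm _ I]
    rw [show I * (I * e p) = -e p by linear_combination e p * I_mul_I, map_neg]
    ring
  have hintg : IntegrableOn (fun p => fderiv ℝ f p (1, 0) + fderiv ℝ g p (0, 1))
      (uIcc a X ×ˢ uIcc (0 : ℝ) (2 * Real.pi)) := by
    refine ContinuousOn.integrableOn_compact (isCompact_uIcc.prod isCompact_uIcc) ?_
    have hf' := (hfs.continuousOn_fderiv_of_isOpen hΩo (by simp)).mono hsub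
    have hg' := (hgs.continuousOn_fderiv_of_isOpen hΩo (by simp)).mono hsub
    exact (hf'.clm_apply continuousOn_const).add (hg'.clm_apply continuousOn_const)
  have main := integral2_divergence_prod_of_hasFDerivAt_off_countable f g (fderiv ℝ f)
    (fderiv ℝ g) a 0 X (2 * Real.pi) ∅ countable_empty (hfs.continuousOn.mono hsub)
    (hgs.continuousOn.mono hsub)
    (fun p hp => (differentiableAt_of_contDiffOn hΩo hfs (hsub' hp)).hasFDerivAt)
    (fun p hp => (differentiableAt_of_contDiffOn hΩo hgs (hsub' hp)).hasFDerivAt) hintg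
  have hper : ∀ x, g (x, 2 * Real.pi) = g (x, 0) := fun x => by
    simp only [hg, he, polarExp_two_pi]
  simp only [hper, sub_self, zero_add] at main
  have hpos : 0 ≤ ∫ x in a..X, ∫ y in (0 : ℝ)..(2 * Real.pi),
      fderiv ℝ f (x, y) (1, 0) + fderiv ℝ g (x, y) (0, 1) := by
    refine intervalIntegral.integral_nonneg haX fun x hx =>
      intervalIntegral.integral_nonneg Real.two_pi_pos.le fun y hy => ?_
    have hp : (x, y) ∈ Ω := hin (x, y) hx.2
    rw [hdiv _ hp, fderiv_fderiv_rotate]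
    exact mul_nonneg (sub_nonneg.2 hx.2) (mul_nonneg (sq_nonneg _) (hlap _ hp))
  rw [main] at hpos
  simp only [hf, sub_self, zero_mul, zero_add] at hpos
  linarith

theorem sub_mean_value (hU : IsOpen U) (hk : ContDiffOn ℝ (⊤ : ℕ∞) k U)
    (hlap : ∀ t ∈ U, 0 ≤ fderiv ℝ (fderiv ℝ k) t 1 1 + fderiv ℝ (fderiv ℝ k) t I I)
    {r : ℝ} (hr : 0 < r) (hin : ∀ l : ℂ, ‖l‖ ≤ r → z + l * w ∈ U) :
    2 * Real.pi * k z ≤ ∫ θ in (0 : ℝ)..(2 * Real.pi), k (z + r * Complex.exp (θ * I) * w) := by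
  have hz : z ∈ U := by simpa using hin 0 (by simpa using hr.le)
  have hinp : ∀ p : ℝ × ℝ, p.1 ≤ Real.log r → z + polarExp w p ∈ U := fun p hp =>
    hin _ (by
      rw [Complex.norm_exp]
      simpa using (Real.exp_le_exp.2 hp).trans_eq (Real.exp_log hr))
  have hDk := hk.fderiv_of_isOpen (m := (⊤ : ℕ∞)) hU le_rfl
  have hpi := Real.two_pi_pos
  have hX : ∀ θ : ℝ, polarExp w (Real.log r, θ) = r * Complex.exp (θ * I) * w := fun θ => by
    rw [polarExp, Complex.exp_add, ← Complex.ofReal_exp, Real.exp_log hr]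
  suffices h : ∀ ε > 0, 2 * Real.pi * (k z - 2 * ε) ≤
      ∫ θ in (0 : ℝ)..(2 * Real.pi), k (z + r * Complex.exp (θ * I) * w) by
    refine le_of_forall_pos_le_add fun δ hδ => ?_
    have := h (δ / (4 * Real.pi)) (by positivity)
    have h2 : 2 * Real.pi * (k z - 2 * (δ / (4 * Real.pi))) = 2 * Real.pi * k z - δ := by
      field_simp
      ring
    linarith
  intro ε hε
  obtain ⟨C, hC⟩ : ∃ C, ∀ᶠ t in 𝓝 z, ‖fderiv ℝ k t‖ ≤ C := by
    have hc : ContinuousAt (fun t => ‖fderiv ℝ k t‖) z :=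
      (hDk.continuousOn.continuousAt (hU.mem_nhds hz)).norm
    exact ⟨‖fderiv ℝ k z‖ + 1, (hc.eventually_lt continuousAt_const (lt_add_one _)).mono
      fun t ht => ht.le⟩
  have hkz : ∀ᶠ t in 𝓝 z, k z - ε ≤ k t :=
    ((continuousAt_const (y := k z - ε)).eventually_lt
      (hk.continuousOn.continuousAt (hU.mem_nhds hz)) (by linarith)).mono fun t ht => ht.le
  obtain ⟨δ, hδ, hball⟩ := Metric.eventually_nhds_iff.1 (hC.and hkz)
  have hexp : Tendsto (fun a : ℝ => Real.exp a * ‖w‖) atBot (𝓝 0) := by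
    simpa using Real.tendsto_exp_atBot.mul_const ‖w‖
  have hlim : Tendsto (fun a : ℝ => (Real.log r - a) * (C * (Real.exp a * ‖w‖))) atBot
      (𝓝 0) := by
    have h1 : Tendsto (fun a : ℝ => a * Real.exp a) atBot (𝓝 0) := by
      have := (Real.tendsto_pow_mul_exp_neg_atTop_nhds_zero 1).comp tendsto_neg_atBot_atTop
      simpa [Function.comp_def] using this.neg
    have h2 := ((Real.tendsto_exp_atBot.const_mul (Real.log r)).sub h1).mul_const (C * ‖w‖)
    simp only [mul_zero, sub_zero, zero_mul] at h2
    exact h2.congr fun a => by ring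
  obtain ⟨a, haX, ha1, ha2⟩ := ((eventually_le_atBot (Real.log r)).and
    ((hexp.eventually_lt_const hδ).and (hlim.eventually_lt_const hε))).exists
  have hgreen := polar_green hU hk hlap haX hinp
  simp only [hX] at hgreen
  refine le_trans ?_ hgreen
  have hpt : ∀ θ ∈ Icc (0 : ℝ) (2 * Real.pi), k z - 2 * ε ≤
      (Real.log r - a) * fderiv ℝ k (z + polarExp w (a, θ)) (polarExp w (a, θ)) +
        k (z + polarExp w (a, θ)) := by
    intro θ _
    obtain ⟨h1, h2⟩ := hball (y := z + polarExp w (a, θ))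
      (by simpa [norm_polarExp] using ha1)
    have h3 : -(C * (Real.exp a * ‖w‖)) ≤
        fderiv ℝ k (z + polarExp w (a, θ)) (polarExp w (a, θ)) := by
      have h4 := (fderiv ℝ k (z + polarExp w (a, θ))).le_of_opNorm_le h1 (polarExp w (a, θ))
      rw [norm_polarExp, Real.norm_eq_abs] at h4
      exact (abs_le.1 h4).1
    have h5 := mul_le_mul_of_nonneg_left h3 (sub_nonneg.2 haX)
    linarith
  have hcont : Continuous fun θ : ℝ =>
      (Real.log r - a) * fderiv ℝ k (z + polarExp w (a, θ)) (polarExp w (a, θ)) +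
        k (z + polarExp w (a, θ)) := by
    have he : Continuous fun θ : ℝ => polarExp w (a, θ) :=
      (contDiff_polarExp w).continuous.comp (by fun_prop)
    have hze : Continuous fun θ : ℝ => z + polarExp w (a, θ) := continuous_const.add he
    exact (continuous_const.mul ((hDk.continuousOn.comp_continuous hze fun θ =>
      hinp _ haX).clm_apply he)).add (hk.continuousOn.comp_continuous hze fun θ => hinp _ haX)
  have hmono := intervalIntegral.integral_mono_on (μ := volume) hpi.le
    (continuous_const.intervalIntegrable 0 (2 * Real.pi))
    (hcont.intervalIntegrable 0 (2 * Real.pi)) hpt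
  rwa [intervalIntegral.integral_const, sub_zero, smul_eq_mul] at hmono

theorem plurisubharmonicOn_of_laplacian_nonneg (hU : IsOpen U)
    (hk : ContDiffOn ℝ (⊤ : ℕ∞) k U)
    (hlap : ∀ t ∈ U, 0 ≤ iteratedFDeriv ℝ 2 k t ![1, 1] + iteratedFDeriv ℝ 2 k t ![I, I]) :
    PlurisubharmonicOn (fun t => ((k t : ℝ) : EReal)) U := by
  refine ⟨(continuous_coe_real_ereal.comp_continuousOn hk.continuousOn).upperSemicontinuousOn,
    fun z _ w r hr hin h hh hle => ?_⟩
  have hlap' : ∀ t ∈ U, 0 ≤ fderiv ℝ (fderiv ℝ k) t 1 1 + fderiv ℝ (fderiv ℝ k) t I I :=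
    fun t ht => by simpa [iteratedFDeriv_two_apply] using hlap t ht
  have hmv := sub_mean_value hU hk hlap' hr (z := z) (w := w) fun l hl => hin l hl
  have hcirc : Continuous fun θ : ℝ => z + r * Complex.exp (θ * I) * w := by fun_prop
  have hmono : (∫ θ in (0 : ℝ)..(2 * Real.pi), k (z + r * Complex.exp (θ * I) * w)) ≤
      ∫ θ in (0 : ℝ)..(2 * Real.pi), h θ := by
    refine intervalIntegral.integral_mono_on (μ := volume) Real.two_pi_pos.le
      ((hk.continuousOn.comp_continuous hcirc fun θ => hin _ ?_).intervalIntegrable _ _)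
      (hh.intervalIntegrable _ _) fun θ _ => EReal.coe_le_coe_iff.1 (hle θ)
    rw [norm_mul, Complex.norm_exp_ofReal_mul_I, mul_one, Complex.norm_real, Real.norm_eq_abs,
      abs_of_pos hr]
  refine EReal.coe_le_coe_iff.2 ?_
  rw [inv_mul_eq_div, le_div_iff₀ Real.two_pi_pos]
  linarith

end Subharmonic

/-- **Section 2 of Berndtsson's paper.**  `V = {ρ < 0}` smoothly bounded strictly pseudoconvex
in `ℂⁿ`, `U ⊆ ℂ` open, `φ` smooth and strictly plurisubharmonic in a neighbourhood of the
closure of `U × V`, `z ∈ V` fixed, `K_t(·,z)` the Bergman kernel of `V` with weight `φ^t`.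
Then `t ↦ K_t(z,z)` is subharmonic on `U`; more precisely
`∂²K_t(z,z)/∂t∂t̄ ≥ ∫_V |K_t(·,z)|² D e^{-φ^t}` with `D ≥ 0` as above
(`∂²/∂t∂t̄ = (1/4)(∂²/∂(Re t)² + ∂²/∂(Im t)²)`). -/
theorem bergman_diag_subharmonic (n : ℕ) (V : Set (Cn n))
    (ρ : Cn n → ℝ) (W : Set (Cn n)) (hW : IsOpen W) (hVW : closure V ⊆ W)
    (hρ : ContDiffOn ℝ (⊤ : ℕ∞) ρ W) (hρspsh : StrictPlurisubharmonicOn ρ W)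
    (hV : V = {ζ | ρ ζ < 0}) (hVbd : Bornology.IsBounded V)
    (hgrad : ∀ ζ ∈ frontier V, fderiv ℝ ρ ζ ≠ 0)
    (U : Set ℂ) (hU : IsOpen U)
    (φ : ℂ × Cn n → ℝ) (W' : Set (ℂ × Cn n)) (hW' : IsOpen W')
    (hW'cl : closure (U ×ˢ V) ⊆ W') (hφ : ContDiffOn ℝ (⊤ : ℕ∞) φ W')
    (hφspsh : StrictPlurisubharmonicOn φ W')
    (z : Cn n) (hz : z ∈ V)
    (K : ℂ → Cn n → Cn n → ℂ)
    (hK : ∀ t ∈ U, IsBergmanKernelAt V (fun ζ => φ (t, ζ)) z (fun ζ => K t ζ z)) :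
    PlurisubharmonicOn (fun t : ℂ => (((K t z z).re : ℝ) : EReal)) U ∧
      (∀ t ∈ U, ∀ ζ ∈ V, 0 ≤ (bigD n φ (t, ζ)).re) ∧
      ∀ t ∈ U,
        (∫ ζ in V, ‖K t ζ z‖ ^ 2 * (bigD n φ (t, ζ)).re * Real.exp (-φ (t, ζ))) ≤
          (1 / 4) * (iteratedFDeriv ℝ 2 (fun s : ℂ => (K s z z).re) t ![1, 1] +
            iteratedFDeriv ℝ 2 (fun s : ℂ => (K s z z).re) t ![Complex.I, Complex.I]) := by
  have hcl : ∀ s ∈ U, {s} ×ˢ closure V ⊆ W' := fun s hs =>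
    (prod_mono (singleton_subset_iff.2 (subset_closure hs)) Subset.rfl).trans
      (closure_prod_eq.symm.subset.trans hW'cl)
  have hVo := (isExhaustion_of_defining hW hVW hρ hV hVbd).isOpen
  have hD : ∀ t ∈ U, ∀ ζ ∈ V, 0 ≤ (bigD n φ (t, ζ)).re := fun t ht ζ hζ =>
    bigD_re_nonneg hW' hφ hφspsh (hcl t ht ⟨rfl, subset_closure hζ⟩)
  have hmain := fun t ht => integral_bigD_le (K := fun t ζ => K t ζ z) hW hVW hρ hρspsh hV hVbd
    hW' hφ hφspsh hU hcl hK (t := t) ht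
  refine ⟨plurisubharmonicOn_of_laplacian_nonneg hU (fun t ht =>
    (contDiffAt_bergmanKernel (K := fun t ζ => K t ζ z) hVo hVbd hW' hφ hU hcl hK
      ht).contDiffWithinAt) fun t ht => ?_, hD, hmain⟩
  have hpos : 0 ≤ ∫ ζ in V, ‖K t ζ z‖ ^ 2 * (bigD n φ (t, ζ)).re * Real.exp (-φ (t, ζ)) :=
    setIntegral_nonneg hVo.measurableSet fun ζ hζ =>
      mul_nonneg (mul_nonneg (sq_nonneg _) (hD t ht ζ hζ)) (Real.exp_pos _).le
  linarith [hmain t ht]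

end Berndtsson
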